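/- Let n ∈ ℕ. Let (C,u) be an equicharacteristic ℤ-valued field with uniformizer π such that O_u is excellent, and let (K,v) and (L,w) be henselian valued field extensions of (C,u) in which π is still a uniformizer, such that the residue field extensions Kv/Cu and Lw/Cu are separable. If Th_{∃_n∃_1}(Kv,Cu) ⊆ Th_{∃_n∃_1}(Lw,Cu) and (R4_{n+1}) holds, then Th_{∃_n∃_1}(K,C) ⊆ Th_{∃_n∃_1}(L,C) (as L_ring(C)-theories). -/

import Mathlib

open FirstOrder FirstOrder.Language

universe u v w x

namespace Paper



/-! ### Syntactic fragments -/

/-- `IsExistsN n φ`: `φ` is an `∃_n`-formula, i.e. of the form `∃ x₁ … x_m ψ`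
with `m ≤ n` and `ψ` quantifier-free. -/
inductive IsExistsN {L : Language} {α : Type*} : ℕ → ∀ {k : ℕ}, L.BoundedFormula α k → Prop
  | qf {n k : ℕ} {φ : L.BoundedFormula α k} : φ.IsQF → IsExistsN n φ
  | ex {n k : ℕ} {φ : L.BoundedFormula α (k + 1)} : IsExistsN n φ → IsExistsN (n + 1) φ.ex

/-- `φ` is an existential formula. -/
def IsExists {L : Language} {α : Type*} {k : ℕ} (φ : L.BoundedFormula α k) : Prop :=
  ∃ n : ℕ, IsExistsN n φ

/-- Positive boolean combinations of formulas satisfying `P`. -/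
inductive IsPosBC {L : Language} {α : Type*} (P : ∀ {k : ℕ}, L.BoundedFormula α k → Prop) :
    ∀ {k : ℕ}, L.BoundedFormula α k → Prop
  | base {k : ℕ} {φ : L.BoundedFormula α k} : P φ → IsPosBC P φ
  | inf {k : ℕ} {φ ψ : L.BoundedFormula α k} :
      IsPosBC P φ → IsPosBC P ψ → IsPosBC P (φ ⊓ ψ)
  | sup {k : ℕ} {φ ψ : L.BoundedFormula α k} :
      IsPosBC P φ → IsPosBC P ψ → IsPosBC P (φ ⊔ ψ)

/-- The `∃₁`-fragment: positive boolean combinations of formulas of the form `η` or `∃ y η`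
with `η` quantifier-free. -/
def IsE1 {L : Language} {α : Type*} {k : ℕ} (φ : L.BoundedFormula α k) : Prop :=
  IsPosBC (fun {k} φ => φ.IsQF ∨ ∃ ψ : L.BoundedFormula α (k + 1), ψ.IsQF ∧ φ = ψ.ex) φ

/-- `∃_n∃₁`-formulas: `∃ x₁ … x_m ψ` with `m ≤ n` and `ψ` in the `∃₁`-fragment. -/
inductive IsExistsNE1 {L : Language} {α : Type*} : ℕ → ∀ {k : ℕ}, L.BoundedFormula α k → Prop
  | e1 {n k : ℕ} {φ : L.BoundedFormula α k} : IsE1 φ → IsExistsNE1 n φ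
  | ex {n k : ℕ} {φ : L.BoundedFormula α (k + 1)} : IsExistsNE1 n φ → IsExistsNE1 (n + 1) φ.ex

/-- The `∃^n`-fragments, defined inductively: `∃^0`-formulas are the quantifier-free ones,
and an `∃^{n+1}`-formula is of the form `ψ` or `∃ x ψ` with `ψ` a positive boolean
combination of `∃^n`-formulas. -/
def IsExpN {L : Language} {α : Type*} : ℕ → ∀ {k : ℕ}, L.BoundedFormula α k → Prop
  | 0, _, φ => φ.IsQF
  | n + 1, k, φ => IsPosBC (IsExpN n) φ ∨
      ∃ ψ : L.BoundedFormula α (k + 1), IsPosBC (IsExpN n) ψ ∧ φ = ψ.ex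



/-! ### The language of rings with constants, and realization -/

/-- The `Language.ring`-structure on a ring. -/
noncomputable def ringStructure (M : Type*) [CommRing M] : Language.ring.Structure M :=
  (FirstOrder.Ring.compatibleRingOfRing M).toStructure

/-- The `L_ring(α)`-structure on a ring `M` with constants interpreted via `f : α → M`. -/
noncomputable def ringConStructure {α M : Type*} [CommRing M] (f : α → M) :
    (Language.ring[[α]]).Structure M :=
  letI := ringStructure M
  letI := constantsOn.structure f
  inferInstance

/-- `M ⊨ φ` for an `L_ring(α)`-sentence, with constants interpreted via `f`. -/
def RealizeRing (M : Type*) [CommRing M] {α : Type*} (f : α → M)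
    (φ : (Language.ring[[α]]).Sentence) : Prop :=
  @Sentence.Realize _ M (ringConStructure f) φ

/-- The unary relation symbol `O` for the valuation ring. -/
inductive ValRel : ℕ → Type
  | isO : ValRel 1

/-- The language with a single unary predicate `O`. -/
def oLang : Language := ⟨fun _ => Empty, ValRel⟩

/-- The language of valued fields `L_val = L_ring ∪ {O}`. -/
abbrev Lval : Language := Language.ring.sum oLang

/-- The `oLang`-structure on `M` in which `O` is interpreted as the set `O`. -/
def oStructure {M : Type*} (O : Set M) : oLang.Structure M where
  funMap := fun f _ => f.elim
  RelMap := fun {_} r => match r with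
    | .isO => fun xs => xs 0 ∈ O

/-- The `L_val(α)`-structure on a ring `M`, with `O` interpreted as the set `O` and
constants interpreted via `f : α → M`. -/
noncomputable def valConStructure {α M : Type*} [CommRing M] (O : Set M) (f : α → M) :
    (Lval[[α]]).Structure M :=
  letI := ringStructure M
  letI := oStructure O
  letI : Lval.Structure M := inferInstance
  letI := constantsOn.structure f
  inferInstance

/-- `M ⊨ φ` for an `L_val(α)`-sentence. -/
def RealizeVal (M : Type*) [CommRing M] (O : Set M) {α : Type*} (f : α → M)
    (φ : (Lval[[α]]).Sentence) : Prop :=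
  @Sentence.Realize _ M (valConStructure O f) φ



abbrev Zm0 : Type := WithZero (Multiplicative ℤ)

variable {K : Type*} [Field K] {Γ : Type*} [LinearOrderedCommGroupWithZero Γ]

/-- `π` is a uniformizer of `(K, v)`: `v π` is minimal positive
(multiplicatively: `0 < v π < 1` and `v π` is the largest value `< 1`). -/
def IsUniformizer (v : Valuation K Γ) (π : K) : Prop :=
  0 < v π ∧ v π < 1 ∧ ∀ x : K, v x < 1 → v x ≤ v π

/-- The valuation ring of `v`, as a set. -/
def Oset (v : Valuation K Γ) : Set K := {x | v x ≤ 1}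

/-- The residue field `Kv` of the valued field `(K, v)`. -/
abbrev ResF (v : Valuation K Γ) : Type _ :=
  IsLocalRing.ResidueField v.valuationSubring

/-- The residue map `O_v → Kv`. -/
abbrev resMap (v : Valuation K Γ) : v.valuationSubring →+* ResF v :=
  IsLocalRing.residue _

/-- `(K, v)` is a henselian valued field. -/
abbrev IsHenselian (v : Valuation K Γ) : Prop :=
  HenselianLocalRing v.valuationSubring

/-- compatibility of a ring homomorphism between residue fields with the residue maps,
for an extension `(K, v)` of `(C, u)`. -/
def ResCompat {C : Type*} [Field C] {Γ₀ : Type*} [LinearOrderedCommGroupWithZero Γ₀]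
    (u : Valuation C Γ₀) [Algebra C K] (v : Valuation K Γ)
    (g : ResF u →+* ResF v) : Prop :=
  ∀ (x : u.valuationSubring) (hx : algebraMap C K ↑x ∈ v.valuationSubring),
    g (resMap u x) = resMap v ⟨algebraMap C K ↑x, hx⟩

/-- `(K, v)` is complete (with respect to the valuation uniformity). -/
def IsCompleteValued (v : Valuation K Γ) : Prop :=
  letI : Valued K Γ := Valued.mk' v
  CompleteSpace K



/-- `E/F` admits a separating transcendence basis. -/
def HasSepTransBasis (F E : Type*) [Field F] [Field E] [Algebra F E] : Prop :=
  ∃ s : Set E, AlgebraicIndependent F ((↑) : s → E) ∧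
    Algebra.IsSeparable (IntermediateField.adjoin F s) E

/-- The field extension `E/F` is separable: every finitely generated subextension
admits a separating transcendence basis. -/
def IsSepExt (F E : Type*) [Field F] [Field E] [Algebra F E] : Prop :=
  ∀ s : Finset E, HasSepTransBasis F (IntermediateField.adjoin F (s : Set E))

/-- The extension given by a ring homomorphism `f : F →+* E` of fields is separable. -/
def IsSepExtHom {F E : Type*} [Field F] [Field E] (f : F →+* E) : Prop :=
  letI := f.toAlgebra
  IsSepExt F E

/-- `trdeg(E/F) ≤ d`: there is a finite transcendence basis with at most `d` elements. -/
def TrdegLE (F E : Type*) [CommRing F] [CommRing E] [Algebra F E] (d : ℕ) : Prop :=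
  ∃ s : Finset E, s.card ≤ d ∧ IsTranscendenceBasis F (Subtype.val : ((s : Set E)) → E)

/-- `F` is a large field: `F` is existentially closed in `F((t))`. -/
def LargeField (F : Type u) [Field F] : Prop :=
  ∀ φ : (Language.ring[[F]]).Sentence, IsExists φ →
    RealizeRing (LaurentSeries F) (algebraMap F (LaurentSeries F)) φ →
    RealizeRing F (id : F → F) φ

/-- `(R4_n)`: whenever a valuation `w` on a field `E` is trivial on a large subfield `F` of `E`
with residue field `Eu = F` (via the residue map), every `∃_n`-`L_ring(F)`-sentence true in `E`
is true in `F`. -/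
def R4N (n : ℕ) : Prop :=
  ∀ (E : Type u) [Field E] (Γ : Type u) [LinearOrderedCommGroupWithZero Γ]
    (w : Valuation E Γ) (F : Subfield E),
    LargeField.{u} F →
    (∀ y : F, (y : E) ≠ 0 → w y = 1) →
    (∀ y : E, w y ≤ 1 → ∃ x : F, w (y - x) < 1) →
    ∀ φ : (Language.ring[[F]]).Sentence, IsExistsN n φ →
      RealizeRing E ((↑) : F → E) φ → RealizeRing F (id : F → F) φ

/-- Excellence of the valuation ring of an (equicharacteristic, `ℤ`-valued) valued field
`(C, u)`, via the characterization: the fraction field of the completion (i.e. the completion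
of `C`) is a separable extension of `C`. -/
def ExcellentCompletion (C : Type u) [Field C] (u : Valuation C Zm0) : Prop :=
  letI : Valued C Zm0 := Valued.mk' u
  letI : Field (UniformSpace.Completion C) := UniformSpace.Completion.instField
  IsSepExtHom (UniformSpace.Completion.coeRingHom : C →+* UniformSpace.Completion C)


/-- `Th_P(K, fK) ⊆ Th_P(L, fL)`: every positive boolean combination of `L_ring(α)`-sentences
of the fragment `P` that is true in `K` is true in `L`. -/
def ThRingSub {α : Type*} (P : ∀ {k : ℕ}, (Language.ring[[α]]).BoundedFormula Empty k → Prop)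
    (K : Type*) [CommRing K] (fK : α → K) (L : Type*) [CommRing L] (fL : α → L) : Prop :=
  ∀ φ : (Language.ring[[α]]).Sentence, IsPosBC P φ →
    RealizeRing K fK φ → RealizeRing L fL φ

/-- `Th_P(K, OK, fK) ⊆ Th_P(L, OL, fL)` for `L_val(α)`-sentences. -/
def ThValSub {α : Type*} (P : ∀ {k : ℕ}, (Lval[[α]]).BoundedFormula Empty k → Prop)
    (K : Type*) [CommRing K] (OK : Set K) (fK : α → K)
    (L : Type*) [CommRing L] (OL : Set L) (fL : α → L) : Prop :=
  ∀ φ : (Lval[[α]]).Sentence, IsPosBC P φ →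
    RealizeVal K OK fK φ → RealizeVal L OL fL φ

end Paper

namespace Paper

section HenselNewton

open Polynomial

/-- A polynomial `1 - Z + ∑_{2 ≤ i ≤ D} c_i Z^i` with all `c_i` in the maximal ideal of a henselian
local ring has a unit root. -/
theorem exists_unit_root {R : Type*} [CommRing R] [HenselianLocalRing R] (D : ℕ) (hD : 2 ≤ D)
    (c : ℕ → R) (hc : ∀ i, c i ∈ IsLocalRing.maximalIdeal R) :
    ∃ z : R, IsUnit z ∧ 1 - z + ∑ i ∈ Finset.Icc 2 D, c i * z ^ i = 0 := by
  set g : R[X] := ∑ i ∈ Finset.Icc 2 D, C (c i) * X ^ (D - i) with hg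
  set f : R[X] := X ^ D + (-X ^ (D - 1) + g) with hf
  have hgdeg : (-X ^ (D - 1) + g).degree < (D : WithBot ℕ) := by
    refine (degree_add_le _ _).trans_lt (max_lt ?_ ?_)
    · rw [degree_neg]
      refine (degree_X_pow_le _).trans_lt ?_
      exact_mod_cast (by omega : D - 1 < D)
    · rw [← mem_degreeLT]
      refine Submodule.sum_mem _ fun i hi => mem_degreeLT.2 ?_
      rw [Finset.mem_Icc] at hi
      refine (degree_C_mul_X_pow_le _ _).trans_lt ?_
      exact_mod_cast (by omega : D - i < D)
  have hmon : f.Monic := monic_X_pow_add hgdeg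
  have hg1 : g.eval 1 ∈ IsLocalRing.maximalIdeal R := by
    rw [hg, eval_finsetSum]
    exact Ideal.sum_mem _ fun i _ => by simpa using hc i
  have hg1' : g.derivative.eval 1 ∈ IsLocalRing.maximalIdeal R := by
    rw [hg, derivative_sum, eval_finsetSum]
    exact Ideal.sum_mem _ fun i _ => by
      simpa using Ideal.mul_mem_right _ _ (hc i)
  have h1 : f.eval 1 ∈ IsLocalRing.maximalIdeal R := by
    simpa [hf] using hg1
  have h2 : IsUnit (f.derivative.eval 1) := by
    have : f.derivative.eval 1 = 1 + g.derivative.eval 1 := by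
      have : ((D : R)) - ((D - 1 : ℕ) : R) = 1 := by
        rw [Nat.cast_sub (by omega)]; simp
      simp only [hf, derivative_add, derivative_X_pow, derivative_neg, eval_add, eval_neg, eval_mul,
        eval_natCast, eval_pow, eval_X, one_pow, mul_one, map_natCast]
      linear_combination this
    rw [this]
    by_contra hcon
    have := (IsLocalRing.mem_maximalIdeal _).2 hcon
    have h3 := Ideal.sub_mem _ this hg1'
    simp at h3
  obtain ⟨b, hb, hb1⟩ := HenselianLocalRing.is_henselian f hmon 1 h1 h2
  have hbu : IsUnit b := by
    by_contra hcon
    have := (IsLocalRing.mem_maximalIdeal _).2 hcon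
    have h3 := Ideal.sub_mem _ this hb1
    simp at h3
  obtain ⟨b, rfl⟩ := hbu
  refine ⟨((b⁻¹ : Rˣ) : R), Units.isUnit _, ?_⟩
  have hb2 : ((b : R)) ^ D + (-(b : R) ^ (D - 1) + ∑ i ∈ Finset.Icc 2 D, c i * (b : R) ^ (D - i))
      = 0 := by
    simpa [hf, hg, eval_finsetSum, IsRoot] using hb
  have key : ∀ i ≤ D, (((b⁻¹ : Rˣ) : R)) ^ D * (b : R) ^ (D - i) = (((b⁻¹ : Rˣ) : R)) ^ i := by
    intro i hi
    obtain ⟨j, rfl⟩ := Nat.exists_eq_add_of_le hi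
    rw [Nat.add_sub_cancel_left, pow_add, mul_assoc, ← mul_pow]
    simp
  have h0 := key 0 (by omega)
  have h1 := key 1 (by omega)
  have := congrArg (fun x => (((b⁻¹ : Rˣ) : R)) ^ D * x) hb2
  simp only [mul_add, mul_neg, mul_zero, Finset.mul_sum] at this
  rw [h1] at this
  simp only [pow_one, Nat.sub_zero, pow_zero] at this h0
  rw [h0] at this
  rw [← this, sub_eq_add_neg, add_assoc]
  congr 2
  refine Finset.sum_congr rfl fun i hi => ?_
  rw [Finset.mem_Icc] at hi
  rw [mul_left_comm, key i hi.2]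

theorem mem_maximalIdeal_iff {K : Type*} [Field K] {Γ : Type*} [LinearOrderedCommGroupWithZero Γ]
    (v : Valuation K Γ) (x : v.valuationSubring) :
    x ∈ IsLocalRing.maximalIdeal v.valuationSubring ↔ v (x : K) < 1 := by
  rw [IsLocalRing.mem_maximalIdeal, mem_nonunits_iff, ← not_iff_not, not_not, not_lt]
  have hx : v (x : K) ≤ 1 := x.2
  constructor
  · rintro ⟨y, rfl⟩
    have h1 : v ((y⁻¹ : (v.valuationSubring)ˣ) : K) ≤ 1 :=
      ((y⁻¹ : (v.valuationSubring)ˣ) : v.valuationSubring).2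
    have h2 : v (((y : v.valuationSubring) : K)) *
        v (((y⁻¹ : (v.valuationSubring)ˣ) : v.valuationSubring) : K) = 1 := by
      rw [← map_mul, ← v.map_one]; congr 1
      exact_mod_cast congrArg Subtype.val (Units.mul_inv y)
    calc (1 : Γ) = _ := h2.symm
      _ ≤ _ := mul_le_of_le_one_right' h1
  · intro h
    have h1 : v (x : K) = 1 := le_antisymm hx h
    have h0 : (x : K) ≠ 0 := by rintro h0; simp [h0] at h1
    refine IsUnit.of_mul_eq_one ⟨(x : K)⁻¹, (v.mem_valuationSubring_iff _).2 (by simp [h1])⟩ ?_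
    ext; simp [h0]

/-- The Hensel–Newton lemma for henselian valued fields. -/
theorem hensel_newton {K : Type*} [Field K] {Γ : Type*} [LinearOrderedCommGroupWithZero Γ]
    (v : Valuation K Γ) (hv : IsHenselian v) (f : K[X]) (a : K)
    (h : ∀ i, 1 ≤ i → v ((taylor a f).coeff 0) * v ((taylor a f).coeff i)
      < v ((taylor a f).coeff 1) ^ 2) :
    ∃ b, f.eval b = 0 ∧ v (b - a) * v (f.derivative.eval a) ≤ v (f.eval a) := by
  set F := taylor a f with hF
  have hF0 : F.coeff 0 = f.eval a := taylor_coeff_zero _ _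
  have hF1 : F.coeff 1 = f.derivative.eval a := taylor_coeff_one _ _
  by_cases h00 : F.coeff 0 = 0
  · exact ⟨a, by rw [← hF0, h00], by simp⟩
  have h01 := h 1 le_rfl
  have h1 : F.coeff 1 ≠ 0 := by
    intro h1; simp [h1] at h01
  set r : K := F.coeff 0 / F.coeff 1 with hr
  have hv1 : v (F.coeff 1) ≠ 0 := by simpa using h1
  have hrlt : v r < 1 := by
    rw [hr, map_div₀, div_lt_one₀ (zero_lt_iff.2 hv1)]
    rw [pow_two] at h01
    exact lt_of_mul_lt_mul_right' h01
  set c' : ℕ → K := fun i => if 2 ≤ i then (-1) ^ i * (F.coeff i * F.coeff 0 / F.coeff 1 ^ 2)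
    * r ^ (i - 2) else 0 with hc'
  have hc'v : ∀ i, v (c' i) < 1 := by
    intro i
    simp only [hc']
    split_ifs with hi
    · have h2 : v (F.coeff i * F.coeff 0 / F.coeff 1 ^ 2) < 1 := by
        rw [map_div₀, map_mul, map_pow, mul_comm, div_lt_one₀ (zero_lt_iff.2 (pow_ne_zero _ hv1))]
        exact h i (by omega)
      rw [map_mul, map_mul, map_pow, map_pow, Valuation.map_neg, map_one, one_pow, one_mul]
      exact (mul_le_of_le_one_right' (pow_le_one' hrlt.le _)).trans_lt h2
    · simp
  have : HenselianLocalRing v.valuationSubring := hv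
  obtain ⟨z, hz, hz0⟩ := exists_unit_root (R := v.valuationSubring) (max 2 F.natDegree)
    (le_max_left _ _) (fun i => ⟨c' i, (v.mem_valuationSubring_iff _).2 (hc'v i).le⟩) (fun i => by
      exact (mem_maximalIdeal_iff v _).2 (hc'v i))
  have hz0' : (1 : K) - z + ∑ i ∈ Finset.Icc 2 (max 2 F.natDegree), c' i * (z : K) ^ i = 0 := by
    have := congrArg (Subtype.val) hz0
    push_cast at this
    simpa using this
  refine ⟨a - r * z, ?_, ?_⟩
  · have e1 : f.eval (a - r * z) = F.eval (-(r * z)) := by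
      rw [hF, taylor_eval]; ring_nf
    rw [e1]
    set D := max 2 F.natDegree with hD
    rw [eval_eq_sum_range' (n := D + 1) (by have := le_max_right 2 F.natDegree; omega)]
    have hrange : Finset.range (D + 1) = insert 0 (insert 1 (Finset.Icc 2 D)) := by
      have := le_max_left 2 F.natDegree
      ext i; simp only [Finset.mem_range, Finset.mem_insert, Finset.mem_Icc]; omega
    rw [hrange, Finset.sum_insert (by simp), Finset.sum_insert (by simp)]
    have : F.coeff 0 * ((1 : K) - z + ∑ i ∈ Finset.Icc 2 D, c' i * (z : K) ^ i) = 0 := by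
      rw [hz0', mul_zero]
    rw [← this, mul_add, mul_sub, Finset.mul_sum, ← add_assoc]
    congr 1
    · rw [hr]; field_simp; ring
    · refine Finset.sum_congr rfl fun i hi => ?_
      rw [Finset.mem_Icc] at hi
      obtain ⟨j, rfl⟩ := Nat.exists_eq_add_of_le hi.1
      simp only [hc', if_pos hi.1, Nat.add_sub_cancel_left]
      rw [neg_pow, mul_pow, pow_add r 2, hr]
      field_simp
  · rw [show a - r * z - a = -(r * z) by ring, Valuation.map_neg, map_mul, ← hF1, ← hF0]
    have hzv : v z ≤ 1 := z.2
    calc v r * v z * v (F.coeff 1) ≤ v r * 1 * v (F.coeff 1) := by gcongr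
      _ = v (F.coeff 0) := by
        rw [mul_one, hr, map_div₀, div_mul_cancel₀ _ hv1]

/-- Hensel–Newton for integral polynomials. -/
theorem hensel_newton_integral {K : Type*} [Field K] {Γ : Type*} [LinearOrderedCommGroupWithZero Γ]
    (v : Valuation K Γ) (hv : IsHenselian v) (f : K[X]) (a : K)
    (hf : ∀ i, v (f.coeff i) ≤ 1) (ha : v a ≤ 1)
    (h : v (f.eval a) < v (f.derivative.eval a) ^ 2) :
    ∃ b, f.eval b = 0 ∧ v (b - a) * v (f.derivative.eval a) ≤ v (f.eval a) := by
  refine hensel_newton v hv f a fun i _ => ?_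
  rw [taylor_coeff_zero, taylor_coeff_one]
  refine lt_of_le_of_lt ?_ h
  refine mul_le_of_le_one_right' ?_
  have hmem : ∀ i, f.coeff i ∈ v.valuationSubring := hf
  have ham : a ∈ v.valuationSubring := ha
  let g : v.valuationSubring[X] := f.toSubring v.valuationSubring.toSubring fun x hx => by
    obtain ⟨i, -, rfl⟩ := mem_coeffs_iff.1 hx
    exact hmem i
  have hg : g.map v.valuationSubring.subtype = f :=
    map_toSubring f v.valuationSubring.toSubring _
  have : taylor a f = (taylor (⟨a, ham⟩ : v.valuationSubring) g).map
      v.valuationSubring.subtype := by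
    rw [← hg, taylor_apply, taylor_apply, map_comp]
    simp
  rw [this, coeff_map]
  exact ((taylor (⟨a, ham⟩ : v.valuationSubring) g).coeff i).2

end HenselNewton

section Separability

/-- `e` is linearly independent over the field of `p`-th powers of `F`, seen inside `R`. -/
def FrobIndep {F R : Type*} [Field F] [Field R] [Algebra F R] (p : ℕ) {m : ℕ} (e : Fin m → F) :
    Prop :=
  ∀ y : Fin m → R, ∑ i, algebraMap F R (e i) * y i ^ p = 0 → ∀ i, y i = 0

/-- MacLane's criterion for separability of `R/F`. -/
def Sep (F R : Type*) [Field F] [Field R] [Algebra F R] : Prop :=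
  ∀ p : ℕ, p.Prime → CharP F p → ∀ (m : ℕ) (e : Fin m → F),
    FrobIndep (R := F) p e → FrobIndep (R := R) p e

/-- Every finite family in a field of characteristic `p` is a combination, with `p`-th powers
as coefficients, of a family independent over the `p`-th powers. -/
theorem exists_frobIndep {F : Type*} [Field F] (p : ℕ) (hp : p.Prime) [CharP F p]
    {ι : Type*} [Finite ι] (c : ι → F) :
    ∃ (r : ℕ) (e : Fin r → F) (d : ι → Fin r → F), FrobIndep (R := F) p e ∧
      ∀ i, c i = ∑ j, d i j ^ p * e j := by
  classical
  have : Fact p.Prime := ⟨hp⟩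
  let P : Subfield F := (frobenius F p).fieldRange
  let W : Submodule P F := Submodule.span P (Set.range c)
  have : FiniteDimensional P W := FiniteDimensional.span_of_finite P (Set.finite_range c)
  let b := Module.finBasis P W
  have hroot : ∀ x : P, ∃ y : F, y ^ p = x := fun x => x.2
  choose rt hrt using hroot
  refine ⟨_, fun j => (b j : F), fun i j => rt (b.repr ⟨c i, Submodule.subset_span ⟨i, rfl⟩⟩ j),
    ?_, fun i => ?_⟩
  · intro y hy i
    have h1 : ∑ j, (⟨y j ^ p, ⟨y j, rfl⟩⟩ : P) • b j = 0 := by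
      ext
      rw [AddSubmonoidClass.coe_finsetSum]
      rw [ZeroMemClass.coe_zero, ← hy]
      exact Finset.sum_congr rfl fun j _ => mul_comm _ _
    have h2 := Fintype.linearIndependent_iff.1 b.linearIndependent _ h1 i
    exact eq_zero_of_pow_eq_zero (congrArg Subtype.val h2)
  · have h1 := congrArg (Subtype.val) (b.sum_repr ⟨c i, Submodule.subset_span ⟨i, rfl⟩⟩)
    rw [AddSubmonoidClass.coe_finsetSum] at h1
    rw [← show _ = c i from h1]
    refine Finset.sum_congr rfl fun j _ => ?_
    rw [hrt]; rfl

theorem Sep.linearIndependent_pow {F R : Type*} [Field F] [Field R] [Algebra F R] (h : Sep F R)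
    (p : ℕ) (hp : p.Prime) [CharP F p] {ι : Type*} [Fintype ι] (x : ι → R)
    (hx : LinearIndependent F x) : LinearIndependent F (fun i => x i ^ p) := by
  have : Fact p.Prime := ⟨hp⟩
  have : CharP R p := charP_of_injective_algebraMap (algebraMap F R).injective p
  rw [Fintype.linearIndependent_iff] at hx ⊢
  intro c hc
  obtain ⟨r, e, d, he, hd⟩ := exists_frobIndep p hp c
  have h1 : ∑ j, algebraMap F R (e j) * (∑ i, d i j • x i) ^ p = 0 := by
    rw [← hc]
    simp_rw [hd, Finset.sum_smul, sum_pow_char, Finset.mul_sum]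
    rw [Finset.sum_comm]
    refine Finset.sum_congr rfl fun i _ => Finset.sum_congr rfl fun j _ => ?_
    simp only [Algebra.smul_def, mul_pow, map_mul, map_pow]; ring
  have h2 := h p hp inferInstance r e he _ h1
  intro i
  rw [hd i]
  refine Finset.sum_eq_zero fun j _ => ?_
  rw [hx _ (h2 j) i, zero_pow hp.ne_zero, zero_mul]

theorem Sep.of_algHom {F E R : Type*} [Field F] [Field E] [Field R] [Algebra F E] [Algebra F R]
    (h : Sep F R) (f : E →ₐ[F] R) : Sep F E := by
  intro p hp _ m e he y hy i
  have := h p hp inferInstance m e he (fun i => f (y i)) (by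
    rw [← map_zero f, ← hy, map_sum]
    simp) i
  exact f.injective (by simpa using this)

theorem Sep.exists_separating {F E : Type*} [Field F] [Field E] [Algebra F E] (h : Sep F E)
    [Algebra.EssFiniteType F E] :
    ∃ s : Finset E, IsTranscendenceBasis F ((↑) : s → E) ∧
      Algebra.IsSeparable (IntermediateField.adjoin F (s : Set E)) E := by
  obtain _ | ⟨p, hp, hpk⟩ := CharP.exists' F
  · exact exists_isTranscendenceBasis_and_isSeparable_of_perfectField F E
  · have : ExpChar F p := .prime hp.out
    exact exists_isTranscendenceBasis_and_isSeparable_of_linearIndepOn_pow_of_essFiniteType p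
      hp.out fun s hs => h.linearIndependent_pow p hp.out (ι := s) _ hs

theorem Sep.of_algebraicIndependent {F E : Type*} [Field F] [Field E] [Algebra F E]
    {s : Set E} (hs : AlgebraicIndependent F ((↑) : s → E)) :
    Sep F (IntermediateField.adjoin F s) := by
  intro p hp _ m e he y hy i
  have : Fact p.Prime := ⟨hp⟩
  have : CharP E p := charP_of_injective_algebraMap (algebraMap F E).injective p
  have hfrac : ∀ x : IntermediateField.adjoin F s, ∃ a b : Algebra.adjoin F s, b ≠ 0 ∧
      (x : E) = a / b := by
    rintro ⟨x, hx⟩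
    obtain ⟨a, ha, b, hb, rfl⟩ := IntermediateField.mem_adjoin_iff_div.1 hx
    by_cases h0 : b = 0
    · exact ⟨0, 1, one_ne_zero, by simp [h0]⟩
    · exact ⟨⟨a, ha⟩, ⟨b, hb⟩, fun h => h0 (congrArg Subtype.val h), rfl⟩
  choose a b hb hab using hfrac
  have hrange : ∀ x : Algebra.adjoin F s, ∃ q : MvPolynomial s F, MvPolynomial.aeval
      ((↑) : s → E) q = x := by
    rintro ⟨x, hx⟩
    rw [Algebra.adjoin_eq_range] at hx
    exact hx
  choose P hP using hrange
  have hb' : ∀ x, ((b x : Algebra.adjoin F s) : E) ≠ 0 := fun x h => hb x (Subtype.ext h)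
  set D : Algebra.adjoin F s := ∏ j, b (y j) with hD
  have hD0 : D ≠ 0 := Finset.prod_ne_zero_iff.2 fun j _ => hb _
  have hg : ∀ j, ∃ g : MvPolynomial s F, MvPolynomial.aeval ((↑) : s → E) g = (y j : E) * D := by
    intro j
    refine ⟨P (a (y j) * ∏ k ∈ Finset.univ.erase j, b (y k)), ?_⟩
    rw [hP, hab (y j), hD, ← Finset.mul_prod_erase _ _ (Finset.mem_univ j)]
    push_cast
    field_simp [hb' (y j)]
  choose g hg using hg
  have hrel : ∑ j, MvPolynomial.C (e j) * g j ^ p = 0 := by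
    apply hs
    simp only [map_sum, map_mul, map_pow, hg, map_zero, mul_pow, MvPolynomial.algHom_C]
    have := congrArg (fun z : IntermediateField.adjoin F s => (z : E) * (D : E) ^ p) hy
    simp only [ZeroMemClass.coe_zero, zero_mul] at this
    rw [← this]
    push_cast
    rw [Finset.sum_mul]
    refine Finset.sum_congr rfl fun j _ => ?_
    rw [mul_assoc]
  have hg0 : g i = 0 := by
    ext μ
    have := congrArg (MvPolynomial.coeff (p • μ)) hrel
    simp only [MvPolynomial.coeff_sum, MvPolynomial.coeff_C_mul, MvPolynomial.coeff_zero,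
      ← MvPolynomial.map_frobenius_expand p, MvPolynomial.coeff_map,
      MvPolynomial.coeff_expand_smul p hp.ne_zero, frobenius_def] at this
    exact he (fun j => (g j).coeff μ) this i
  have := hg i
  rw [hg0, map_zero, eq_comm, mul_eq_zero] at this
  exact Subtype.ext (this.resolve_right fun h => hD0 (Subtype.ext h))

theorem Sep.trans_isSeparable {F k E : Type*} [Field F] [Field k] [Field E] [Algebra F k]
    [Algebra k E] [Algebra F E] [IsScalarTower F k E] (h : Sep F k) [Algebra.IsSeparable k E] :
    Sep F E := by
  classical
  intro p hp _ m e he y hy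
  have : Fact p.Prime := ⟨hp⟩
  have : CharP k p := charP_of_injective_algebraMap (algebraMap F k).injective p
  have : CharP E p := charP_of_injective_algebraMap (algebraMap F E).injective p
  have : ExpChar k p := .prime hp
  let W : Submodule k E := Submodule.span k (Set.range y)
  have : FiniteDimensional k W := FiniteDimensional.span_of_finite k (Set.finite_range y)
  let b := Module.finBasis k W
  let z := fun j => (b j : E)
  have hz : LinearIndependent k z := b.linearIndependent.map' W.subtype (by simp)
  have hz' := hz.map_pow_expChar_pow_of_isSeparable p 1
  simp only [pow_one] at hz'
  rw [Fintype.linearIndependent_iff] at hz'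
  let a := fun i j => b.repr ⟨y i, Submodule.subset_span ⟨i, rfl⟩⟩ j
  have ha : ∀ i, y i = ∑ j, a i j • z j := fun i => by
    have h1 := congrArg (Subtype.val) (b.sum_repr ⟨y i, Submodule.subset_span ⟨i, rfl⟩⟩)
    rw [AddSubmonoidClass.coe_finsetSum] at h1
    exact h1.symm
  have h1 : ∀ j, ∑ i, algebraMap F k (e i) * a i j ^ p = 0 := by
    apply hz'
    rw [← hy]
    simp_rw [ha, sum_pow_char, Finset.mul_sum, Finset.sum_smul]
    rw [Finset.sum_comm]
    refine Finset.sum_congr rfl fun i _ => Finset.sum_congr rfl fun j _ => ?_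
    rw [Algebra.smul_def, Algebra.smul_def, mul_pow, map_mul, map_pow,
      ← IsScalarTower.algebraMap_apply]; ring
  intro i
  rw [ha i]
  exact Finset.sum_eq_zero fun j _ => by rw [h p hp inferInstance m e he _ (h1 j) i, zero_smul]

theorem IsSepExt.sep {F E : Type*} [Field F] [Field E] [Algebra F E] (h : IsSepExt F E) :
    Sep F E := by
  classical
  intro p hp _ m e he y hy i
  obtain ⟨s, hs, hsep⟩ := h (Finset.univ.image y)
  have h1 := (Sep.of_algebraicIndependent hs).trans_isSeparable
    (E := IntermediateField.adjoin F ((Finset.univ.image y : Finset E) : Set E))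
  have := h1 p hp inferInstance m e he (fun i => ⟨y i, IntermediateField.subset_adjoin _ _
    (by simp)⟩) (by
      ext
      rw [ZeroMemClass.coe_zero, ← hy, AddSubmonoidClass.coe_finsetSum]
      rfl) i
  exact congrArg Subtype.val this

end Separability

section Hypersurface

open Polynomial
open scoped IntermediateField.algebraAdjoinAdjoin

/-- Evaluation of a polynomial in `d + 1` variables, the last one distinguished. -/
noncomputable def ev {C L : Type*} [Field C] [Field L] [Algebra C L] {d : ℕ} (s : Fin d → L)
    (b : L) : (MvPolynomial (Fin d) C)[X] →ₐ[C] L :=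
  { eval₂RingHom (MvPolynomial.aeval s : MvPolynomial (Fin d) C →ₐ[C] L).toRingHom b with
    commutes' := fun c => by
      have : algebraMap C (MvPolynomial (Fin d) C)[X] c = Polynomial.C (MvPolynomial.C c) := rfl
      simp [this] }

theorem ev_apply {C L : Type*} [Field C] [Field L] [Algebra C L] {d : ℕ} (s : Fin d → L)
    (b : L) (G : (MvPolynomial (Fin d) C)[X]) :
    ev s b G = (G.map (MvPolynomial.aeval s : MvPolynomial (Fin d) C →ₐ[C] L).toRingHom).eval
        b := by
  rw [eval_map]; rfl

theorem ev_C {C L : Type*} [Field C] [Field L] [Algebra C L] {d : ℕ} (s : Fin d → L)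
    (b : L) (G : MvPolynomial (Fin d) C) :
    ev s b (Polynomial.C G) = MvPolynomial.aeval s G := by
  rw [ev_apply, Polynomial.map_C, eval_C]; rfl

theorem ev_X {C L : Type*} [Field C] [Field L] [Algebra C L] {d : ℕ} (s : Fin d → L)
    (b : L) : ev s b (X : (MvPolynomial (Fin d) C)[X]) = b := by
  rw [ev_apply, Polynomial.map_X, eval_X]

theorem map_ev {C L M : Type*} [Field C] [Field L] [Algebra C L] [Field M] [Algebra C M]
    (f : L →ₐ[C] M) {d : ℕ} (s : Fin d → L) (b : L) (G : (MvPolynomial (Fin d) C)[X]) :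
    ev (fun i => f (s i)) (f b) G = f (ev s b G) := by
  induction G using Polynomial.induction_on' with
  | add p q hp hq => rw [map_add, map_add, map_add, hp, hq]
  | monomial n a =>
    rw [← C_mul_X_pow_eq_monomial, map_mul, map_mul, map_pow, map_pow, ev_C, ev_X, ev_C, ev_X,
      map_mul, map_pow]
    congr 1
    rw [MvPolynomial.comp_aeval_apply]

/-- Homomorphisms extend to the fractions whose denominators stay nonzero. -/
theorem exists_algHom_adjoin {C E L P : Type*} [Field C] [Field E] [Field L] [CommRing P]
    [Algebra C E] [Algebra C L] [Algebra C P] (f : P →ₐ[C] E) (g : P →ₐ[C] L)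
    (hfg : ∀ a, f a = 0 → g a = 0) (Z : Set E)
    (hZ : ∀ z ∈ Z, ∃ a b, g b ≠ 0 ∧ z * f b = f a) :
    ∃ φ : Algebra.adjoin C Z →ₐ[C] L, ∀ (z : Algebra.adjoin C Z) (a b : P), g b ≠ 0 →
        (z : E) * f b = f a →
      φ z * g b = g a := by
  classical
  let T : Subalgebra C E :=
    { carrier := {z | ∃ a b, g b ≠ 0 ∧ z * f b = f a}
      mul_mem' := by
        rintro x y ⟨a, b, hb, hx⟩ ⟨a', b', hb', hy⟩
        exact ⟨a * a', b * b', by simp [hb, hb'], by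
          rw [map_mul, map_mul, ← hx, ← hy]; ring⟩
      add_mem' := by
        rintro x y ⟨a, b, hb, hx⟩ ⟨a', b', hb', hy⟩
        exact ⟨a * b' + a' * b, b * b', by simp [hb, hb'], by
          rw [map_mul, map_add, map_mul, map_mul, ← hx, ← hy]; ring⟩
      algebraMap_mem' := fun c => ⟨algebraMap C P c, 1, by simp, by simp⟩ }
  have hT : ∀ z : T, ∃ y : L, ∀ a b, g b ≠ 0 → (z : E) * f b = f a → y = g a / g b := by
    rintro ⟨z, a, b, hb, hz⟩
    refine ⟨g a / g b, fun a' b' hb' hz' => ?_⟩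
    rw [div_eq_div_iff hb hb', ← sub_eq_zero, ← map_mul, ← map_mul, ← map_sub]
    apply hfg
    rw [map_sub, map_mul, map_mul, ← hz, ← hz']; ring
  choose φ hφ using hT
  let Φ : T →ₐ[C] L :=
    { toFun := φ
      map_one' := by rw [hφ 1 1 1 (by simp) (by simp)]; simp
      map_mul' := by
        rintro ⟨x, a, b, hb, hx⟩ ⟨y, a', b', hb', hy⟩
        rw [hφ ⟨x, a, b, hb, hx⟩ a b hb hx, hφ ⟨y, a', b', hb', hy⟩ a' b' hb' hy,
          hφ _ (a * a') (b * b') (by simp [hb, hb']) (by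
            change x * y * _ = _
            rw [map_mul, map_mul, ← hx, ← hy]; ring)]
        rw [map_mul, map_mul]; field_simp
      map_zero' := by rw [hφ 0 0 1 (by simp) (by simp)]; simp
      map_add' := by
        rintro ⟨x, a, b, hb, hx⟩ ⟨y, a', b', hb', hy⟩
        rw [hφ ⟨x, a, b, hb, hx⟩ a b hb hx, hφ ⟨y, a', b', hb', hy⟩ a' b' hb' hy,
          hφ _ (a * b' + a' * b) (b * b') (by simp [hb, hb']) (by
            change (x + y) * _ = _
            rw [map_mul, map_add, map_mul, map_mul, ← hx, ← hy]; ring)]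
        rw [map_mul, map_add, map_mul, map_mul]; field_simp
      commutes' := fun c => by
        rw [hφ _ (algebraMap C P c) 1 (by simp) (by
          change algebraMap C E c * _ = _
          simp)]; simp }
  refine ⟨Φ.comp (Subalgebra.inclusion (Algebra.adjoin_le hZ)), fun z a b hb hz => ?_⟩
  change φ _ * _ = _
  rw [hφ _ a b hb hz, div_mul_cancel₀ _ hb]

/-- Any `n + 1` elements of `S` are algebraically dependent over `C`. -/
def TrLE (C : Type*) {E : Type*} [Field C] [Field E] [Algebra C E] (n : ℕ) (S : Set E) : Prop :=
  ∀ x : Fin (n + 1) → E, (∀ i, x i ∈ S) → ¬ AlgebraicIndependent C x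

/-- Finitely generated separable extensions have models that are generically hypersurfaces. -/
theorem exists_hypersurface {C E : Type*} [Field C] [Field E] [Algebra C E]
    [Algebra.EssFiniteType C E] (hE : Sep C E) (n : ℕ) (hn : TrLE C n (Set.univ : Set E))
    (Z : Finset E) :
    ∃ (d : ℕ) (_ : d ≤ n) (s : Fin d → E) (b : E) (G H : (MvPolynomial (Fin d) C)[X]),
      ev s b G = 0 ∧ ev s b (derivative G) ≠ 0 ∧ ev s b H ≠ 0 ∧
      (∀ z : E, ∃ A B : (MvPolynomial (Fin d) C)[X], ev s b B ≠ 0 ∧ z * ev s b B = ev s b A) ∧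
      ∀ (L : Type w) [Field L] [Algebra C L] (s' : Fin d → L) (b' : L),
        ev s' b' G = 0 → ev s' b' H ≠ 0 → ∃ φ : Algebra.adjoin C (Z : Set E) →ₐ[C] L,
          ∀ (z : Algebra.adjoin C (Z : Set E)) (A B : (MvPolynomial (Fin d) C)[X]),
              ev s' b' B ≠ 0 → (z : E) * ev s b B = ev s b A →
            φ z * ev s' b' B = ev s' b' A := by
  classical
  obtain ⟨s0, hs0, hsep0⟩ := hE.exists_separating
  let d := s0.card
  let e : Fin d ≃ s0 := s0.equivFin.symm
  let s : Fin d → E := fun i => e i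
  have hs : AlgebraicIndependent C s := hs0.1.comp e e.injective
  have hrange : Set.range s = s0 := by
    ext x
    constructor
    · rintro ⟨i, rfl⟩; exact (e i).2
    · intro hx; exact ⟨e.symm ⟨x, hx⟩, by simp [s]⟩
  have hdn : d ≤ n := by
    by_contra hcon
    exact hn (fun i => s (Fin.castLE (by omega) i)) (fun _ => trivial)
      (hs.comp _ (Fin.castLE_injective (by omega : n + 1 ≤ d)))
  rw [← hrange] at hsep0
  have hfd : FiniteDimensional (IntermediateField.adjoin C (Set.range s)) E := by
    have : Algebra.EssFiniteType (IntermediateField.adjoin C (Set.range s)) E :=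
        Algebra.EssFiniteType.of_comp C (IntermediateField.adjoin C (Set.range s)) E
    have : Algebra.IsAlgebraic (IntermediateField.adjoin C (Set.range s)) E :=
        Algebra.IsSeparable.isAlgebraic _ _
    exact Algebra.finite_of_essFiniteType_of_isAlgebraic
  obtain ⟨b, hb⟩ := Field.exists_primitive_element (IntermediateField.adjoin C (Set.range s)) E
  have hfrac : ∀ z : E, ∃ α β : (MvPolynomial (Fin d) C)[X], ev s b β ≠ 0 ∧
      z * ev s b β = ev s b α := by
    intro z
    have hz : z ∈ IntermediateField.adjoin C (Set.range s ∪ {b}) := by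
      rw [← IntermediateField.adjoin_adjoin_left]
      change z ∈ IntermediateField.adjoin (IntermediateField.adjoin C (Set.range s)) {b}
      rw [hb]; trivial
    have hle : Algebra.adjoin C (Set.range s ∪ {b}) ≤ (ev s b : _ →ₐ[C] E).range := by
      refine Algebra.adjoin_le ?_
      rintro x (⟨i, rfl⟩ | rfl)
      · exact ⟨Polynomial.C (MvPolynomial.X i), by
          change ev s b _ = _
          rw [ev_C, MvPolynomial.aeval_X]⟩
      · exact ⟨X, ev_X _ _⟩
    obtain ⟨r, hr, t, ht, rfl⟩ := IntermediateField.mem_adjoin_iff_div.1 hz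
    obtain ⟨α, rfl⟩ := hle hr
    obtain ⟨β, rfl⟩ := hle ht
    by_cases h0 : ev s b β = 0
    · exact ⟨0, 1, by simp, by simp [h0]⟩
    · exact ⟨α, β, h0, div_mul_cancel₀ _ h0⟩
  let θ : MvPolynomial (Fin d) C ≃ₐ[C] Algebra.adjoin C (Set.range s) := hs.aevalEquiv
  have hθ : ∀ F : (Algebra.adjoin C (Set.range s))[X],
      ev s b (F.map (θ.symm : _ →+* MvPolynomial (Fin d) C)) = aeval b F := by
    intro F
    rw [ev_apply, Polynomial.map_map, aeval_def, eval_map]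
    congr 1
    ext x
    obtain ⟨y, rfl⟩ := θ.surjective x
    simp [θ]
  have hθ' : ∀ F : (MvPolynomial (Fin d) C)[X], ∃ F1 : (Algebra.adjoin C (Set.range s))[X],
      F = F1.map (θ.symm : _ →+* MvPolynomial (Fin d) C) := by
    intro F
    refine ⟨F.map (θ : _ →+* Algebra.adjoin C (Set.range s)), ?_⟩
    rw [Polynomial.map_map]
    conv_lhs => rw [← Polynomial.map_id (p := F)]
    congr 1
    ext x <;> simp
  set m := minpoly (IntermediateField.adjoin C (Set.range s)) b
  have hint : IsIntegral (IntermediateField.adjoin C (Set.range s)) b :=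
      Algebra.IsIntegral.isIntegral b
  obtain ⟨D0, hD0, hG⟩ := IsLocalization.integerNormalization_spec
    (nonZeroDivisors (Algebra.adjoin C (Set.range s))) m
  set G1 := IsLocalization.integerNormalization
    (nonZeroDivisors (Algebra.adjoin C (Set.range s))) m with hG1
  have hinj : Function.Injective
      (algebraMap (Algebra.adjoin C (Set.range s)) (IntermediateField.adjoin C (Set.range s))) :=
    IsFractionRing.injective _ _
  have hinjE : Function.Injective (algebraMap (Algebra.adjoin C (Set.range s)) E) :=
    Subtype.val_injective
  have hD0' : algebraMap (Algebra.adjoin C (Set.range s)) E D0 ≠ 0 := fun h =>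
    nonZeroDivisors.ne_zero hD0 (hinjE (by rw [h, map_zero]))
  have hGC : G1.map (algebraMap (Algebra.adjoin C (Set.range s))
      (IntermediateField.adjoin C (Set.range s))) =
      Polynomial.C (algebraMap _ (IntermediateField.adjoin C (Set.range s)) D0) * m := by
    rw [hG, Algebra.smul_def]; rfl
  have hG0 : aeval b G1 = 0 := by
    rw [← aeval_map_algebraMap (IntermediateField.adjoin C (Set.range s)), hGC, map_mul,
        minpoly.aeval, mul_zero]
  have hG0' : aeval b (derivative G1) ≠ 0 := by
    rw [← aeval_map_algebraMap (IntermediateField.adjoin C (Set.range s)), ← derivative_map, hGC,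
        derivative_C_mul, map_mul, aeval_C,
      ← IsScalarTower.algebraMap_apply]
    exact mul_ne_zero hD0' ((Algebra.IsSeparable.isSeparable
        (IntermediateField.adjoin C (Set.range s)) b).aeval_derivative_ne_zero
      (minpoly.aeval _ _))
  have hker : ∀ F : (MvPolynomial (Fin d) C)[X], ev s b F = 0 →
      ∃ (D : MvPolynomial (Fin d) C) (Q : (MvPolynomial (Fin d) C)[X]),
        ev s b (Polynomial.C D) ≠ 0 ∧
        Polynomial.C D * F = G1.map (θ.symm : _ →+* MvPolynomial (Fin d) C) * Q := by
    intro F hF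
    obtain ⟨F1, rfl⟩ := hθ' F
    rw [hθ] at hF
    rw [← aeval_map_algebraMap (IntermediateField.adjoin C (Set.range s))] at hF
    obtain ⟨Q, hQ⟩ := minpoly.dvd (IntermediateField.adjoin C (Set.range s)) b hF
    obtain ⟨D1, hD1, hQ1⟩ := IsLocalization.integerNormalization_spec
      (nonZeroDivisors (Algebra.adjoin C (Set.range s))) Q
    set Q1 := IsLocalization.integerNormalization
      (nonZeroDivisors (Algebra.adjoin C (Set.range s))) Q
    refine ⟨θ.symm (D0 * D1), Q1.map (θ.symm : _ →+* MvPolynomial (Fin d) C), ?_, ?_⟩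
    · have := hθ (Polynomial.C (D0 * D1))
      rw [Polynomial.map_C] at this
      refine fun h => nonZeroDivisors.ne_zero (mul_mem hD0 hD1) (hinjE ?_)
      rw [map_zero]
      rw [aeval_C] at this
      rw [← this]; exact h
    · have h1 : Polynomial.C (D0 * D1) * F1 = G1 * Q1 := by
        apply Polynomial.map_injective _ hinj
        rw [Polynomial.map_mul, Polynomial.map_mul, hG, hQ1, hQ, Polynomial.map_C, map_mul,
          Algebra.smul_def, Algebra.smul_def, map_mul]
        change _ = (Polynomial.C (algebraMap _ (IntermediateField.adjoin C (Set.range s)) D0) * m)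
            * (Polynomial.C (algebraMap _ (IntermediateField.adjoin C (Set.range s)) D1) * Q)
        ring
      have h2 := congrArg (Polynomial.map (θ.symm : _ →+* MvPolynomial (Fin d) C)) h1
      rw [Polynomial.map_mul, Polynomial.map_mul, Polynomial.map_C] at h2
      exact h2
  obtain ⟨S, hS⟩ := (isNoetherianRing_iff_ideal_fg _).1 inferInstance
    (RingHom.ker (ev s b : (MvPolynomial (Fin d) C)[X] →ₐ[C] E))
  have hSker : ∀ F ∈ S, ev s b F = 0 := fun F hF => by
    have : F ∈ RingHom.ker (ev s b : (MvPolynomial (Fin d) C)[X] →ₐ[C] E) :=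
      hS ▸ Ideal.subset_span hF
    exact this
  choose! D Q hD hDQ using hker
  have hfrac' := hfrac
  choose α β hβ hαβ using hfrac
  refine ⟨d, hdn, s, b, G1.map (θ.symm : _ →+* MvPolynomial (Fin d) C),
    (∏ F ∈ S, Polynomial.C (D F)) * ∏ z ∈ Z, β z, by rw [hθ, hG0], by
        rw [derivative_map, hθ]; exact hG0', ?_, ?_, ?_⟩
  · rw [map_mul, map_prod, map_prod]
    exact mul_ne_zero (Finset.prod_ne_zero_iff.2 fun F hF => hD F (hSker F hF))
      (Finset.prod_ne_zero_iff.2 fun z _ => hβ z)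
  · intro z
    obtain ⟨A, B, hB, hAB⟩ := hfrac' z
    exact ⟨A, B, hB, hAB⟩
  · intro L _ _ s' b' hG' hH'
    rw [map_mul, map_prod, map_prod] at hH'
    have h1 := Finset.prod_ne_zero_iff.1 (left_ne_zero_of_mul hH')
    have h2 := Finset.prod_ne_zero_iff.1 (right_ne_zero_of_mul hH')
    refine exists_algHom_adjoin (ev s b) (ev s' b') ?_ _ fun z hz => ⟨α z, β z, h2 z hz, hαβ z⟩
    intro F hF
    have hF' : F ∈ Ideal.span (S : Set (MvPolynomial (Fin d) C)[X]) := hS ▸ hF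
    have hle : Ideal.span (S : Set (MvPolynomial (Fin d) C)[X]) ≤
        RingHom.ker (ev s' b' : (MvPolynomial (Fin d) C)[X] →ₐ[C] L) := by
      refine Ideal.span_le.2 fun F hF => ?_
      have := congrArg (ev s' b') (hDQ F (hSker F hF))
      rw [map_mul, map_mul, hG', zero_mul] at this
      exact (mul_eq_zero.1 this).resolve_left (h1 F hF)
    exact hle hF'

end Hypersurface

section QuantifierFree

open Polynomial

/-- Satisfaction of a formula with constants from `C` in a `C`-algebra. -/
def Rz {C : Type*} [Field C] (M : Type*) [CommRing M] [Algebra C M] {k : ℕ}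
    (φ : (Language.ring[[C]]).BoundedFormula Empty k) (x : Fin k → M) : Prop :=
  @BoundedFormula.Realize _ M (ringConStructure (algebraMap C M)) _ k φ default x

/-- The value of a term with constants from `C` in a `C`-algebra. -/
noncomputable def rzTerm {C : Type*} [Field C] (M : Type*) [CommRing M] [Algebra C M] {k : ℕ}
    (t : (Language.ring[[C]]).Term (Empty ⊕ Fin k)) (x : Fin k → M) : M :=
  @Term.realize _ M (ringConStructure (algebraMap C M)) _ (Sum.elim default x) t

theorem exists_rzTerm_eq {C : Type*} [Field C] {k : ℕ}
    (t : (Language.ring[[C]]).Term (Empty ⊕ Fin k)) :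
    ∃ p : MvPolynomial (Fin k) C, ∀ (M : Type u) [CommRing M] [Algebra C M] (x : Fin k → M),
      rzTerm M t x = MvPolynomial.aeval x p := by
  induction t with
  | var a =>
    rcases a with a | i
    · exact a.elim
    · exact ⟨MvPolynomial.X i, fun M _ _ x => by rw [MvPolynomial.aeval_X]; rfl⟩
  | @func l f ts ih =>
    choose p hp using ih
    have key : ∀ (M : Type u) [CommRing M] [Algebra C M] (x : Fin k → M),
        rzTerm M (Term.func f ts) x = @Structure.funMap _ M (ringConStructure (algebraMap C M)) _ f
          (fun i => MvPolynomial.aeval x (p i)) := by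
      intro M _ _ x
      have : (fun i => MvPolynomial.aeval x (p i)) = fun i => rzTerm M (ts i) x :=
        funext fun i => (hp i M x).symm
      rw [this]; rfl
    rcases f with f | f
    · cases f with
      | add => exact ⟨p 0 + p 1, fun M _ _ x => by rw [key, map_add]; rfl⟩
      | mul => exact ⟨p 0 * p 1, fun M _ _ x => by rw [key, map_mul]; rfl⟩
      | neg => exact ⟨- p 0, fun M _ _ x => by rw [key, map_neg]; rfl⟩
      | zero => exact ⟨0, fun M _ _ x => by rw [key, map_zero]; rfl⟩
      | one => exact ⟨1, fun M _ _ x => by rw [key, map_one]; rfl⟩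
    · cases l with
      | zero => exact ⟨@MvPolynomial.C C (Fin k) _ f, fun M _ _ x =>
        (key M x).trans (@MvPolynomial.aeval_C C M (Fin k) _ _ _ x f).symm⟩
      | succ l => exact (f : PEmpty).elim

theorem exists_term {C : Type*} [Field C] {k : ℕ} (p : MvPolynomial (Fin k) C) :
    ∃ t : (Language.ring[[C]]).Term (Empty ⊕ Fin k),
      ∀ (M : Type u) [CommRing M] [Algebra C M] (x : Fin k → M),
        rzTerm M t x = MvPolynomial.aeval x p := by
  induction p using MvPolynomial.induction_on with
  | C a =>
    exact ⟨Term.func (Sum.inr a : (Language.ring[[C]]).Functions 0) ![], fun M _ _ x => by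
      rw [MvPolynomial.aeval_C]; rfl⟩
  | add p q hp hq =>
    obtain ⟨t, ht⟩ := hp
    obtain ⟨t', ht'⟩ := hq
    refine ⟨Term.func (Sum.inl ringFunc.add : (Language.ring[[C]]).Functions 2) ![t, t'],
      fun M _ _ x => ?_⟩
    rw [map_add, ← ht, ← ht']; rfl
  | mul_X p i hp =>
    obtain ⟨t, ht⟩ := hp
    refine ⟨Term.func (Sum.inl ringFunc.mul : (Language.ring[[C]]).Functions 2)
      ![t, Term.var (Sum.inr i)], fun M _ _ x => ?_⟩
    rw [map_mul, ← ht, MvPolynomial.aeval_X]; rfl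

theorem rz_equal {C : Type*} [Field C] (M : Type*) [CommRing M] [Algebra C M] {k : ℕ}
    (t t' : (Language.ring[[C]]).Term (Empty ⊕ Fin k)) (x : Fin k → M) :
    Rz M (t.bdEqual t') x ↔ rzTerm M t x = rzTerm M t' x := Iff.rfl

theorem rz_inf {C : Type*} [Field C] (M : Type*) [CommRing M] [Algebra C M] {k : ℕ}
    (φ ψ : (Language.ring[[C]]).BoundedFormula Empty k) (x : Fin k → M) :
    Rz M (φ ⊓ ψ) x ↔ Rz M φ x ∧ Rz M ψ x :=
  letI := ringConStructure (algebraMap C M)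
  BoundedFormula.realize_inf

theorem rz_sup {C : Type*} [Field C] (M : Type*) [CommRing M] [Algebra C M] {k : ℕ}
    (φ ψ : (Language.ring[[C]]).BoundedFormula Empty k) (x : Fin k → M) :
    Rz M (φ ⊔ ψ) x ↔ Rz M φ x ∨ Rz M ψ x :=
  letI := ringConStructure (algebraMap C M)
  BoundedFormula.realize_sup

theorem rz_imp {C : Type*} [Field C] (M : Type*) [CommRing M] [Algebra C M] {k : ℕ}
    (φ ψ : (Language.ring[[C]]).BoundedFormula Empty k) (x : Fin k → M) :
    Rz M (φ.imp ψ) x ↔ (Rz M φ x → Rz M ψ x) := Iff.rfl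

theorem rz_not {C : Type*} [Field C] (M : Type*) [CommRing M] [Algebra C M] {k : ℕ}
    (φ : (Language.ring[[C]]).BoundedFormula Empty k) (x : Fin k → M) :
    Rz M φ.not x ↔ ¬ Rz M φ x := Iff.rfl

theorem rz_ex {C : Type*} [Field C] (M : Type*) [CommRing M] [Algebra C M] {k : ℕ}
    (φ : (Language.ring[[C]]).BoundedFormula Empty (k + 1)) (x : Fin k → M) :
    Rz M φ.ex x ↔ ∃ a, Rz M φ (Fin.snoc x a) :=
  letI := ringConStructure (algebraMap C M)
  BoundedFormula.realize_ex

/-- Truth of a quantifier-free formula depends on the vanishing of finitely many polynomials. -/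
theorem exists_polys {C : Type*} [Field C] {k : ℕ}
    {φ : (Language.ring[[C]]).BoundedFormula Empty k} (hφ : φ.IsQF) :
    ∃ P : Finset (MvPolynomial (Fin k) C),
      ∀ (M N : Type u) [CommRing M] [Algebra C M] [CommRing N] [Algebra C N]
        (x : Fin k → M) (y : Fin k → N),
        (∀ p ∈ P, MvPolynomial.aeval x p = 0 ↔ MvPolynomial.aeval y p = 0) →
          (Rz M φ x ↔ Rz N φ y) := by
  classical
  induction hφ with
  | falsum => exact ⟨∅, fun M N _ _ _ _ x y _ => Iff.rfl⟩
  | of_isAtomic h =>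
    cases h with
    | equal t t' =>
      obtain ⟨p, hp⟩ := exists_rzTerm_eq.{u} t
      obtain ⟨p', hp'⟩ := exists_rzTerm_eq.{u} t'
      refine ⟨{p - p'}, fun M N _ _ _ _ x y h => ?_⟩
      have := h _ (Finset.mem_singleton_self _)
      rw [map_sub, map_sub, sub_eq_zero, sub_eq_zero, ← hp, ← hp', ← hp, ← hp'] at this
      exact this
    | rel R ts => rcases R with R | R <;> exact (R : Empty).elim
  | imp _ _ ih ih' =>
    obtain ⟨P, hP⟩ := ih
    obtain ⟨P', hP'⟩ := ih'
    refine ⟨P ∪ P', fun M N _ _ _ _ x y h => ?_⟩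
    rw [rz_imp, rz_imp, hP M N x y fun p hp => h p (Finset.mem_union_left _ hp),
      hP' M N x y fun p hp => h p (Finset.mem_union_right _ hp)]

end QuantifierFree

section WitnessSets

open Polynomial

/-- The finite set `Z` witnesses the truth of `φ` at `x`, in the sense that `φ` remains true under
all `C`-algebra homomorphisms on the algebra generated by `Z`. -/
def Witnesses {C : Type*} {K : Type u} [Field C] [Field K] [Algebra C K] {k : ℕ}
    (φ : (Language.ring[[C]]).BoundedFormula Empty k) (x : Fin k → K) (Z : Finset K) : Prop :=
  (∀ i, x i ∈ Z) ∧ ∀ (L : Type u) [Field L] [Algebra C L] (x' : Fin k → L)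
    (h : Algebra.adjoin C (Z : Set K) →ₐ[C] L),
    (∀ i hi, h ⟨x i, hi⟩ = x' i) → Rz L φ x'

theorem Witnesses.mono {C : Type*} {K : Type u} [Field C] [Field K] [Algebra C K] {k : ℕ}
    {φ : (Language.ring[[C]]).BoundedFormula Empty k} {x : Fin k → K} {Z Z' : Finset K}
    (h : Witnesses φ x Z) (hZ : Z ⊆ Z') : Witnesses φ x Z' := by
  refine ⟨fun i => hZ (h.1 i), fun L _ _ x' g hg => h.2 L x'
    (g.comp (Subalgebra.inclusion (Algebra.adjoin_mono (Finset.coe_subset.2 hZ)))) fun i hi => ?_⟩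
  exact hg i _

theorem exists_witnesses_qf {C : Type*} {K : Type u} [Field C] [Field K] [Algebra C K] {k : ℕ}
    {φ : (Language.ring[[C]]).BoundedFormula Empty k} (hφ : φ.IsQF) (x : Fin k → K)
    (hx : Rz K φ x) :
    ∃ Z : Finset K, Witnesses φ x Z ∧
      ∀ z ∈ Z, z ∈ IntermediateField.adjoin C (Set.range x) := by
  classical
  obtain ⟨P, hP⟩ := exists_polys.{u} hφ
  have hmem : ∀ p : MvPolynomial (Fin k) C, MvPolynomial.aeval x p ∈
      IntermediateField.adjoin C (Set.range x) := by
    intro p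
    refine IntermediateField.algebra_adjoin_le_adjoin _ _ ?_
    rw [Algebra.adjoin_range_eq_range_aeval]
    exact ⟨p, rfl⟩
  refine ⟨Finset.univ.image x ∪ P.image fun p => (MvPolynomial.aeval x p)⁻¹,
    ⟨fun i => Finset.mem_union_left _ (Finset.mem_image_of_mem _ (Finset.mem_univ _)),
      fun L _ _ x' h hh => ?_⟩, ?_⟩
  · rw [← hP K L x x' ?_]
    · exact hx
    intro p hp
    let A := Algebra.adjoin C
      ((Finset.univ.image x ∪ P.image fun p => (MvPolynomial.aeval x p)⁻¹ : Finset K) : Set K)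
    have hxA : ∀ i, x i ∈ A := fun i => Algebra.subset_adjoin (Finset.mem_coe.2
      (Finset.mem_union_left _ (Finset.mem_image_of_mem _ (Finset.mem_univ _))))
    let xA : Fin k → A := fun i => ⟨x i, hxA i⟩
    have h1 : x = fun i => A.val (xA i) := rfl
    have h2 : x' = fun i => h (xA i) := funext fun i => (hh i _).symm
    have h3 : MvPolynomial.aeval x p = A.val (MvPolynomial.aeval xA p) := by
      rw [MvPolynomial.comp_aeval_apply]
      rfl
    have h4 : MvPolynomial.aeval x' p = h (MvPolynomial.aeval xA p) := by
      rw [MvPolynomial.comp_aeval_apply, h2]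
    rw [h4]
    constructor
    · intro h0
      have : MvPolynomial.aeval xA p = 0 := Subtype.ext (h3.symm.trans h0)
      rw [this, map_zero]
    · intro h0
      by_contra hne
      let y : A := ⟨(MvPolynomial.aeval x p)⁻¹, Algebra.subset_adjoin (Finset.mem_coe.2
        (Finset.mem_union_right _ (Finset.mem_image_of_mem _ hp)))⟩
      have : MvPolynomial.aeval xA p * y = 1 := by
        apply Subtype.ext
        change A.val (MvPolynomial.aeval xA p) * (MvPolynomial.aeval x p)⁻¹ = 1
        rw [← h3, mul_inv_cancel₀ hne]
      have h5 := congrArg h this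
      rw [map_mul, h0, zero_mul, map_one] at h5
      exact zero_ne_one h5
  · intro z hz
    rcases Finset.mem_union.1 hz with hz | hz
    · obtain ⟨i, -, rfl⟩ := Finset.mem_image.1 hz
      exact IntermediateField.subset_adjoin _ _ ⟨i, rfl⟩
    · obtain ⟨p, -, rfl⟩ := Finset.mem_image.1 hz
      exact inv_mem (hmem p)

theorem Witnesses.ex {C : Type*} {K : Type u} [Field C] [Field K] [Algebra C K] {k : ℕ}
    {φ : (Language.ring[[C]]).BoundedFormula Empty (k + 1)} {x : Fin k → K} {a : K} {Z : Finset K}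
    (h : Witnesses φ (Fin.snoc x a : Fin (k + 1) → K) Z) : Witnesses φ.ex x Z := by
  refine ⟨fun i => by simpa using h.1 i.castSucc, fun L _ _ x' g hg => ?_⟩
  have ha : a ∈ Algebra.adjoin C (Z : Set K) := Algebra.subset_adjoin (by
    simpa using h.1 (Fin.last k))
  rw [rz_ex]
  refine ⟨g ⟨a, ha⟩, h.2 L _ g fun i => ?_⟩
  refine Fin.lastCases ?_ (fun i => ?_) i
  · intro hi; simp
  · intro hi; simp [← hg i (by simpa using hi)]

/-- An existential witness may be chosen algebraic. -/
theorem exists_algebraic {C : Type*} {K : Type u} [Field C] [Infinite C] [Field K] [Algebra C K]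
    {k : ℕ} {φ : (Language.ring[[C]]).BoundedFormula Empty (k + 1)} (hφ : φ.IsQF) (x : Fin k → K)
    (a : K) (ha : Rz K φ (Fin.snoc x a : Fin (k + 1) → K)) :
    ∃ b, IsAlgebraic (IntermediateField.adjoin C (Set.range x)) b ∧
      Rz K φ (Fin.snoc x b : Fin (k + 1) → K) := by
  classical
  by_cases hal : IsAlgebraic (IntermediateField.adjoin C (Set.range x)) a
  · exact ⟨a, hal, ha⟩
  obtain ⟨P, hP⟩ := exists_polys.{u} hφ
  let k0 := IntermediateField.adjoin C (Set.range x)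
  let x0 : Fin k → k0 := fun i => ⟨x i, IntermediateField.subset_adjoin _ _ ⟨i, rfl⟩⟩
  let Q : MvPolynomial (Fin (k + 1)) C → k0[X] := fun p =>
    MvPolynomial.aeval (Fin.snoc (fun i => Polynomial.C (x0 i)) X : Fin (k + 1) → k0[X]) p
  have hQ : ∀ (p : MvPolynomial (Fin (k + 1)) C) (b : K),
      MvPolynomial.aeval (Fin.snoc x b : Fin (k + 1) → K) p = aeval b (Q p) := by
    intro p b
    have : aeval b (Q p) = ((aeval b : k0[X] →ₐ[k0] K).restrictScalars C) (Q p) := rfl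
    rw [this, MvPolynomial.comp_aeval_apply]
    congr 2
    ext i
    refine Fin.lastCases ?_ (fun i => ?_) i
    · simp
    · simp; rfl
  have hfin : (⋃ p ∈ P, {c : C | Q p ≠ 0 ∧ aeval (algebraMap C K c) (Q p) = 0}).Finite := by
    refine Set.Finite.biUnion P.finite_toSet fun p _ => ?_
    by_cases h0 : Q p = 0
    · simp [h0]
    · refine Set.Finite.subset (((Q p).rootSet_finite K).preimage
        (algebraMap C K).injective.injOn) ?_
      rintro c ⟨-, hc⟩
      exact (mem_rootSet.2 ⟨h0, hc⟩)
  obtain ⟨c, hc⟩ := hfin.exists_notMem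
  refine ⟨algebraMap C K c, ?_, ?_⟩
  · have := isAlgebraic_algebraMap (A := K) (algebraMap C k0 c)
    rwa [← IsScalarTower.algebraMap_apply] at this
  · rw [hP K K _ (Fin.snoc x a : Fin (k + 1) → K) ?_]
    · exact ha
    intro p hp
    rw [hQ, hQ]
    constructor
    · intro h0
      by_contra hne
      refine hc (Set.mem_biUnion hp ⟨fun h => ?_, h0⟩)
      rw [h, map_zero] at hne
      exact hne rfl
    · intro h0
      have : Q p = 0 := by
        by_contra hne
        exact hal ⟨_, hne, h0⟩
      rw [this, map_zero]

theorem exists_witnesses_e1 {C : Type*} {K : Type u} [Field C] [Infinite C] [Field K] [Algebra C K]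
    {k : ℕ} {φ : (Language.ring[[C]]).BoundedFormula Empty k} (hφ : IsE1 φ) (x : Fin k → K)
    (hx : Rz K φ x) :
    ∃ Z : Finset K, Witnesses φ x Z ∧
      ∀ z ∈ Z, IsAlgebraic (IntermediateField.adjoin C (Set.range x)) z := by
  classical
  unfold IsE1 at hφ
  induction hφ with
  | base h =>
    rcases h with h | ⟨ψ, hψ, rfl⟩
    · obtain ⟨Z, hZ, hZ'⟩ := exists_witnesses_qf h x hx
      exact ⟨Z, hZ, fun z hz => isAlgebraic_algebraMap (A := K)
        (⟨z, hZ' z hz⟩ : IntermediateField.adjoin C (Set.range x))⟩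
    · rw [rz_ex] at hx
      obtain ⟨a, ha⟩ := hx
      obtain ⟨b, hb, hb'⟩ := exists_algebraic hψ x a ha
      obtain ⟨Z, hZ, hZ'⟩ := exists_witnesses_qf hψ _ hb'
      refine ⟨Z, hZ.ex, fun z hz => ?_⟩
      have h1 : IntermediateField.adjoin C (Set.range (Fin.snoc x b : Fin (k + 1) → K)) ≤
          (algebraicClosure (IntermediateField.adjoin C (Set.range x)) K).restrictScalars C := by
        rw [IntermediateField.adjoin_le_iff]
        rintro _ ⟨i, rfl⟩
        refine Fin.lastCases ?_ (fun i => ?_) i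
        · simpa [mem_algebraicClosure_iff] using hb
        · have := isAlgebraic_algebraMap (A := K)
            (⟨x i, IntermediateField.subset_adjoin _ _ ⟨i, rfl⟩⟩ :
              IntermediateField.adjoin C (Set.range x))
          simpa [mem_algebraicClosure_iff] using this
      have := h1 (hZ' z hz)
      simpa [mem_algebraicClosure_iff] using this
  | inf _ _ ih ih' =>
    rw [rz_inf] at hx
    obtain ⟨Z, hZ, hZa⟩ := ih hx.1
    obtain ⟨Z', hZ', hZa'⟩ := ih' hx.2
    refine ⟨Z ∪ Z', ⟨fun i => Finset.mem_union_left _ (hZ.1 i), fun L _ _ x' h hh => ?_⟩,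
      fun z hz => (Finset.mem_union.1 hz).elim (hZa z) (hZa' z)⟩
    rw [rz_inf]
    exact ⟨(hZ.mono Finset.subset_union_left).2 L x' h hh,
      (hZ'.mono Finset.subset_union_right).2 L x' h hh⟩
  | sup _ _ ih ih' =>
    rw [rz_sup] at hx
    rcases hx with hx | hx
    · obtain ⟨Z, hZ, hZa⟩ := ih hx
      refine ⟨Z, ⟨hZ.1, fun L _ _ x' h hh => ?_⟩, hZa⟩
      rw [rz_sup]
      exact Or.inl (hZ.2 L x' h hh)
    · obtain ⟨Z, hZ, hZa⟩ := ih' hx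
      refine ⟨Z, ⟨hZ.1, fun L _ _ x' h hh => ?_⟩, hZa⟩
      rw [rz_sup]
      exact Or.inr (hZ.2 L x' h hh)

theorem exists_witnesses {C : Type*} {K : Type u} [Field C] [Infinite C] [Field K] [Algebra C K]
    {n k : ℕ} {φ : (Language.ring[[C]]).BoundedFormula Empty k} (hφ : IsExistsNE1 n φ)
    (x : Fin k → K) (hx : Rz K φ x) :
    ∃ X Z : Finset K, X.card ≤ n ∧ Witnesses φ x Z ∧
      ∀ z ∈ Z, IsAlgebraic (IntermediateField.adjoin C (Set.range x ∪ X)) z := by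
  classical
  induction hφ with
  | e1 h =>
    obtain ⟨Z, hZ, hZ'⟩ := exists_witnesses_e1 h x hx
    exact ⟨∅, Z, by simp, hZ, by
      rwa [Finset.coe_empty, Set.union_empty]⟩
  | ex _ ih =>
    rw [rz_ex] at hx
    obtain ⟨a, ha⟩ := hx
    obtain ⟨X, Z, hX, hZ, hZ'⟩ := ih _ ha
    refine ⟨insert a X, Z, (Finset.card_insert_le _ _).trans (by omega), hZ.ex, ?_⟩
    have : Set.range x ∪ ((insert a X : Finset K) : Set K) =
        Set.range (Fin.snoc x a : Fin _ → K) ∪ X := by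
      rw [Fin.range_snoc]
      ext y; simp; tauto
    rw [this]
    exact hZ'

/-- A true `∃_n∃₁`-sentence is witnessed in a subfield of transcendence degree at most `n`. -/
theorem trLE_adjoin_of_isAlgebraic {C : Type*} {K : Type*} [Field C] [Field K] [Algebra C K] {n : ℕ}
    {X : Finset K} (hX : X.card ≤ n) {Z : Set K}
    (hZ' : ∀ z ∈ Z, IsAlgebraic (IntermediateField.adjoin C (X : Set K)) z) :
    TrLE C n (IntermediateField.adjoin C Z : Set K) := by
  intro y hy hind
  let F := IntermediateField.adjoin C (X : Set K)
  let T := (algebraicClosure F K).restrictScalars C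
  have hZT : IntermediateField.adjoin C Z ≤ T := by
    rw [IntermediateField.adjoin_le_iff]
    intro z hz
    have := hZ' z hz
    simpa [T, mem_algebraicClosure_iff] using this
  let T' := algebraicClosure F K
  let s : Set F := (↑) ⁻¹' (X : Set K)
  have hs : Algebra.IsAlgebraic (Algebra.adjoin C s) F := by
    refine ⟨fun z => ?_⟩
    obtain ⟨r, hr, t, ht, hz⟩ := IntermediateField.mem_adjoin_iff_div.1 z.2
    have himg : Algebra.adjoin C (X : Set K) = (Algebra.adjoin C s).map F.val := by
      rw [AlgHom.map_adjoin]
      congr 1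
      ext y
      constructor
      · intro hy
        exact ⟨⟨y, IntermediateField.subset_adjoin _ _ hy⟩, hy, rfl⟩
      · rintro ⟨y, hy, rfl⟩
        exact hy
    rw [himg] at hr ht
    obtain ⟨r, hr, rfl⟩ := hr
    obtain ⟨t, ht, rfl⟩ := ht
    have : z = r / t := Subtype.ext hz
    rw [this, div_eq_mul_inv]
    exact (isAlgebraic_algebraMap (⟨r, hr⟩ : Algebra.adjoin C s)).mul
      (isAlgebraic_algebraMap (⟨t, ht⟩ : Algebra.adjoin C s)).inv
  have h1 := Algebra.IsAlgebraic.trdeg_le_cardinalMk C s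
  have h2 : Cardinal.mk s ≤ n := by
    have : Cardinal.mk s ≤ Cardinal.mk X :=
      Cardinal.mk_le_of_injective (f := fun y : s => (⟨(y : F), y.2⟩ : X))
        fun a b hab => by
          have h := congrArg Subtype.val hab
          exact Subtype.ext (Subtype.ext h)
    refine this.trans ?_
    rw [Cardinal.mk_coe_finset]
    exact_mod_cast hX
  have hff : FaithfulSMul F T' :=
    (faithfulSMul_iff_algebraMap_injective F T').2 (algebraMap F T').injective
  have h3 : Algebra.trdeg C F + Algebra.trdeg F T' = Algebra.trdeg C T' :=
    trdeg_add_eq C F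
  have h4 : Algebra.trdeg F T' = 0 := trdeg_eq_zero
  rw [h4, add_zero] at h3
  let y' : Fin (n + 1) → T' := fun i => ⟨y i, hZT (hy i)⟩
  have hy' : AlgebraicIndependent C y' :=
    AlgebraicIndependent.of_comp (T'.val.restrictScalars C) hind
  have h5 := hy'.lift_cardinalMk_le_trdeg
  rw [← h3] at h5
  have h6 := h5.trans (Cardinal.lift_le.2 (h1.trans h2))
  simp at h6

theorem exists_witnesses_sentence {C : Type*} {K : Type u} [Field C] [Infinite C] [Field K]
    [Algebra C K] {n : ℕ} {φ : (Language.ring[[C]]).Sentence} (hφ : IsExistsNE1 n φ)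
    (hx : RealizeRing K (algebraMap C K) φ) :
    ∃ Z : Finset K, TrLE C n (IntermediateField.adjoin C (Z : Set K) : Set K) ∧
      ∀ (L : Type u) [Field L] [Algebra C L], Nonempty (Algebra.adjoin C (Z : Set K) →ₐ[C] L) →
        RealizeRing L (algebraMap C L) φ := by
  obtain ⟨X, Z, hX, hZ, hZ'⟩ := exists_witnesses hφ default hx
  refine ⟨Z, trLE_adjoin_of_isAlgebraic hX ?_, fun L _ _ ⟨h⟩ => hZ.2 L default h fun i => i.elim0⟩
  rwa [Set.range_eq_empty, Set.empty_union] at hZ'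

end WitnessSets

section SentencesOfEquations

open Polynomial

theorem IsExistsN.mono {L : Language} {α : Type*} {n k : ℕ} {φ : L.BoundedFormula α k}
    (h : IsExistsN n φ) : ∀ {m : ℕ}, n ≤ m → IsExistsN m φ := by
  induction h with
  | qf h => exact fun _ => .qf h
  | ex _ ih =>
    intro m hm
    obtain _ | m := m
    · omega
    · exact .ex (ih (by omega))

theorem IsExistsNE1.mono {L : Language} {α : Type*} {n k : ℕ} {φ : L.BoundedFormula α k}
    (h : IsExistsNE1 n φ) : ∀ {m : ℕ}, n ≤ m → IsExistsNE1 m φ := by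
  induction h with
  | e1 h => exact fun _ => .e1 h
  | ex _ ih =>
    intro m hm
    obtain _ | m := m
    · omega
    · exact .ex (ih (by omega))

theorem IsExistsN.isExistsNE1 {L : Language} {α : Type*} {n k : ℕ} {φ : L.BoundedFormula α k}
    (h : IsExistsN n φ) : IsExistsNE1 n φ := by
  induction h with
  | qf h => exact .e1 (.base (Or.inl h))
  | ex _ ih => exact .ex ih

theorem IsExistsN.exs {L : Language} {α : Type*} {n k : ℕ} {φ : L.BoundedFormula α k}
    (h : IsExistsN n φ) : IsExistsN (n + k) φ.exs := by
  induction k generalizing n with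
  | zero => exact h
  | succ k ih =>
    have := ih h.ex
    rwa [show n + 1 + k = n + (k + 1) by ring] at this

theorem IsExistsNE1.exs {L : Language} {α : Type*} {n k : ℕ} {φ : L.BoundedFormula α k}
    (h : IsExistsNE1 n φ) : IsExistsNE1 (n + k) φ.exs := by
  induction k generalizing n with
  | zero => exact h
  | succ k ih =>
    have := ih h.ex
    rwa [show n + 1 + k = n + (k + 1) by ring] at this

theorem exists_flat {C : Type*} [Field C] {d : ℕ} (G : (MvPolynomial (Fin d) C)[X]) :
    ∃ p : MvPolynomial (Fin (d + 1)) C, ∀ (L : Type u) [Field L] [Algebra C L] (s : Fin d → L)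
      (b : L), MvPolynomial.aeval (Fin.snoc s b : Fin (d + 1) → L) p = ev s b G := by
  induction G using Polynomial.induction_on' with
  | add G G' h h' =>
    obtain ⟨p, hp⟩ := h
    obtain ⟨p', hp'⟩ := h'
    exact ⟨p + p', fun L _ _ s b => by rw [map_add, map_add, hp, hp']⟩
  | monomial n a =>
    refine ⟨MvPolynomial.rename Fin.castSucc a * MvPolynomial.X (Fin.last d) ^ n,
      fun L _ _ s b => ?_⟩
    rw [← C_mul_X_pow_eq_monomial, map_mul, map_mul, map_pow, map_pow, ev_C, ev_X,
      MvPolynomial.aeval_X, MvPolynomial.aeval_rename]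
    have : (Fin.snoc s b : Fin (d + 1) → L) ∘ Fin.castSucc = s := by ext i; simp
    rw [this, Fin.snoc_last]

/-- Solvability of an equation together with an inequation is expressed by a sentence. -/
theorem exists_sentence {C : Type*} [Field C] {n d : ℕ} (hd : d ≤ n)
    (G H : (MvPolynomial (Fin d) C)[X]) :
    ∃ φ : (Language.ring[[C]]).Sentence, IsExistsNE1 n φ ∧ IsExistsN (n + 1) φ ∧
      ∀ (L : Type u) [Field L] [Algebra C L], RealizeRing L (algebraMap C L) φ ↔
        ∃ (s : Fin d → L) (b : L), ev s b G = 0 ∧ ev s b H ≠ 0 := by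
  obtain ⟨p, hp⟩ := exists_flat.{u} G
  obtain ⟨q, hq⟩ := exists_flat.{u} H
  obtain ⟨t, ht⟩ := exists_term.{u} p
  obtain ⟨t', ht'⟩ := exists_term.{u} q
  obtain ⟨t0, ht0⟩ := exists_term.{u} (0 : MvPolynomial (Fin (d + 1)) C)
  let ψ : (Language.ring[[C]]).BoundedFormula Empty (d + 1) :=
    t.bdEqual t0 ⊓ (t'.bdEqual t0).not
  have hψ : ψ.IsQF :=
    (BoundedFormula.IsAtomic.equal t t0).isQF.inf (BoundedFormula.IsAtomic.equal t' t0).isQF.not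
  have hψ' : ∀ (L : Type u) [Field L] [Algebra C L] (s : Fin d → L) (b : L),
      Rz L ψ (Fin.snoc s b : Fin (d + 1) → L) ↔ ev s b G = 0 ∧ ev s b H ≠ 0 := by
    intro L _ _ s b
    rw [rz_inf, rz_not, rz_equal, rz_equal, ht, ht', ht0, hp, hq, map_zero]
  refine ⟨ψ.ex.exs, ?_, ?_, ?_⟩
  · have : IsExistsNE1 0 ψ.ex := .e1 (.base (Or.inr ⟨ψ, hψ, rfl⟩))
    exact this.exs.mono (by omega)
  · have : IsExistsN 1 ψ.ex := .ex (.qf hψ)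
    exact this.exs.mono (by omega)
  · intro L _ _
    have h1 : RealizeRing L (algebraMap C L) ψ.ex.exs ↔ ∃ s : Fin d → L, Rz L ψ.ex s :=
      letI := ringConStructure (algebraMap C L)
      BoundedFormula.realize_exs
    rw [h1]
    refine exists_congr fun s => ?_
    rw [rz_ex]
    exact exists_congr fun b => hψ' L s b

end SentencesOfEquations

open IsLocalRing

section Unramified

variable {R : Type u} {S : Type v} [CommRing R] [IsLocalRing R] [CommRing S] [IsDomain S]
    [IsLocalRing S]
  [Algebra R S] [IsLocalHom (algebraMap R S)] {π : R}

/-- Residually independent families are independent modulo powers of the uniformizer. -/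
theorem dvd_of_dvd_sum (hR : maximalIdeal R = Ideal.span {π})
    (hS : maximalIdeal S = Ideal.span {algebraMap R S π}) (h0 : algebraMap R S π ≠ 0)
    {ι : Type*} (g : ι → S) (hg : LinearIndependent (ResidueField R) (fun i => residue S (g i)))
    (N : ℕ) (s : Finset ι) (D : ι → R)
    (h : algebraMap R S π ^ N ∣ ∑ i ∈ s, algebraMap R S (D i) * g i) :
    ∀ i ∈ s, π ^ N ∣ D i := by
  induction N generalizing D with
  | zero => simp
  | succ N ih =>
    have h1 : ∀ i ∈ s, residue R (D i) = 0 := by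
      refine linearIndependent_iff'.1 hg s (fun i => residue R (D i)) ?_
      have h2 : residue S (∑ i ∈ s, algebraMap R S (D i) * g i) = 0 := by
        rw [residue_eq_zero_iff, hS, Ideal.mem_span_singleton]
        exact (dvd_pow_self _ (Nat.succ_ne_zero _)).trans h
      rw [map_sum] at h2
      rw [← h2]
      refine Finset.sum_congr rfl fun i _ => ?_
      rw [map_mul, Algebra.smul_def]; rfl
    have h2 : ∀ i, ∃ d, i ∈ s → D i = π * d := by
      intro i
      by_cases hi : i ∈ s
      · have := h1 i hi
        rw [residue_eq_zero_iff, hR, Ideal.mem_span_singleton] at this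
        obtain ⟨d, hd⟩ := this
        exact ⟨d, fun _ => hd⟩
      · exact ⟨0, fun h => (hi h).elim⟩
    choose D' hD' using h2
    have h3 : ∑ i ∈ s, algebraMap R S (D i) * g i =
        algebraMap R S π * ∑ i ∈ s, algebraMap R S (D' i) * g i := by
      rw [Finset.mul_sum]
      refine Finset.sum_congr rfl fun i hi => ?_
      rw [hD' i hi, map_mul, mul_assoc]
    rw [h3, pow_succ', mul_dvd_mul_iff_left h0] at h
    intro i hi
    rw [hD' i hi, pow_succ']
    exact mul_dvd_mul_left _ (ih D' h i hi)

/-- Every element has an expansion with digits in a lift of a residue basis containing `1`. -/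
theorem exists_digits (hS : maximalIdeal S = Ideal.span {algebraMap R S π}) :
    ∃ (ι : Type v) (g : ι → S) (i0 : ι), g i0 = 1 ∧
      LinearIndependent (ResidueField R) (fun i => residue S (g i)) ∧
      ∀ (N : ℕ) (a : S), ∃ D : ι →₀ R,
        algebraMap R S π ^ N ∣ a - Finsupp.linearCombination R g D := by
  classical
  have h1 : LinearIndepOn (ResidueField R) id ({1} : Set (ResidueField S)) :=
    LinearIndepOn.singleton one_ne_zero
  let ι : Type v := h1.extend (Set.subset_univ _)
  let b : Module.Basis ι (ResidueField R) (ResidueField S) := Module.Basis.extend h1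
  have hb : ∀ i, b i = i := fun i => Module.Basis.extend_apply_self h1 i
  choose l hl using residue_surjective (R := S)
  choose σ hσ using residue_surjective (R := R)
  let i0 : ι := ⟨1, Module.Basis.subset_extend h1 rfl⟩
  let g : ι → S := fun i => if i = i0 then 1 else l i
  have hg : ∀ i, residue S (g i) = b i := by
    intro i
    rw [hb]
    by_cases hi : i = i0
    · simp [g, hi, i0]
    · simp [g, hi, hl]
  have hgb : (fun i => residue S (g i)) = b := funext hg
  refine ⟨ι, g, i0, by simp [g], hgb ▸ b.linearIndependent, ?_⟩
  intro N
  induction N with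
  | zero => exact fun a => ⟨0, by simp⟩
  | succ N ih =>
    intro a
    obtain ⟨D, a', ha'⟩ := ih a
    let τ : ResidueField R → R := fun x => if x = 0 then 0 else σ x
    have hτ : ∀ x, residue R (τ x) = x := by
      intro x
      by_cases hx : x = 0
      · simp [τ, hx]
      · simp [τ, hx, hσ]
    let D' : ι →₀ R := (b.repr (residue S a')).mapRange τ (by simp [τ])
    have hD' : residue S (Finsupp.linearCombination R g D') = residue S a' := by
      conv_rhs => rw [← b.linearCombination_repr (residue S a')]
      rw [Finsupp.linearCombination_apply, Finsupp.linearCombination_apply,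
        Finsupp.sum_mapRange_index (by simp), Finsupp.sum, Finsupp.sum, map_sum]
      refine Finset.sum_congr rfl fun i _ => ?_
      rw [Algebra.smul_def, map_mul, hg, Algebra.smul_def]
      congr 1
      rw [← IsLocalRing.ResidueField.algebraMap_residue, hτ]
    obtain ⟨a'', ha''⟩ : algebraMap R S π ∣ a' - Finsupp.linearCombination R g D' := by
      rw [← Ideal.mem_span_singleton, ← hS, ← residue_eq_zero_iff, map_sub, hD', sub_self]
    refine ⟨D + π ^ N • D', a'', ?_⟩
    rw [map_add, map_smul, Algebra.smul_def, map_pow, ← sub_sub, ha', ← mul_sub, ha'']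
    ring

/-- Additive `p`-polynomial equations solvable over `S` modulo `π ^ N` are solvable over `R`. -/
theorem exists_sub_solution (hR : maximalIdeal R = Ideal.span {π})
    (hS : maximalIdeal S = Ideal.span {algebraMap R S π}) (h0 : algebraMap R S π ≠ 0)
    (hsep : Sep (ResidueField R) (ResidueField S)) (p : ℕ) (hp : p.Prime) [CharP R p]
    {m : ℕ} (e : Fin m → R) (c : R) (a : Fin m → S) (N : ℕ)
    (h : algebraMap R S π ^ N ∣ algebraMap R S c + ∑ i, algebraMap R S (e i) * a i ^ p) :
    ∃ a' : Fin m → R, π ^ N ∣ c + ∑ i, e i * a' i ^ p := by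
  classical
  have : Fact p.Prime := ⟨hp⟩
  obtain ⟨ι, g, i0, hg0, hgl, hdig⟩ := exists_digits (R := R) (S := S) hS
  have hpk : (p : ResidueField R) = 0 := by
    rw [← map_natCast (residue R), CharP.cast_eq_zero, map_zero]
  have : CharP (ResidueField R) p := (CharP.charP_iff_prime_eq_zero hp).2 hpk
  have hpS : (p : S) = 0 := by
    rw [← map_natCast (algebraMap R S), CharP.cast_eq_zero, map_zero]
  have : CharP S p := (CharP.charP_iff_prime_eq_zero hp).2 hpS
  choose D hD using fun i => hdig N (a i)
  let s : Finset ι := {i0} ∪ Finset.univ.biUnion fun i => (D i).support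
  have hlc : ∀ i, Finsupp.linearCombination R g (D i) =
      ∑ j ∈ s, algebraMap R S (D i j) * g j := by
    intro i
    rw [Finsupp.linearCombination_apply, Finsupp.sum_of_support_subset (s := s)]
    · exact Finset.sum_congr rfl fun j _ => Algebra.smul_def _ _
    · exact (Finset.subset_biUnion_of_mem (fun i => (D i).support)
        (Finset.mem_univ i)).trans Finset.subset_union_right
    · simp
  have hpow : ∀ i, algebraMap R S π ^ N ∣
      a i ^ p - ∑ j ∈ s, algebraMap R S (D i j ^ p) * g j ^ p := by
    intro i
    have h1 := (hD i).trans (sub_dvd_pow_sub_pow (a i) (Finsupp.linearCombination R g (D i)) p)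
    rw [hlc, sum_pow_char] at h1
    convert h1 using 3
    rw [mul_pow, map_pow]
  have hg' : LinearIndependent (ResidueField R) (fun j : s => residue S (g j ^ p)) := by
    have := hsep.linearIndependent_pow p hp (fun j : s => residue S (g j))
      (hgl.comp _ Subtype.val_injective)
    simpa only [map_pow] using this
  have hi0 : i0 ∈ s := by simp [s]
  have hmain : algebraMap R S π ^ N ∣ ∑ j : s,
      algebraMap R S ((if j = ⟨i0, hi0⟩ then c else 0) + ∑ i, e i * D i j ^ p) * g j ^ p := by
    have h2 : algebraMap R S π ^ N ∣ ∑ i, algebraMap R S (e i) *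
        (a i ^ p - ∑ j ∈ s, algebraMap R S (D i j ^ p) * g j ^ p) :=
      Finset.dvd_sum fun i _ => (hpow i).mul_left _
    have h3 := dvd_sub h h2
    convert h3 using 1
    simp only [map_add, add_mul, Finset.sum_add_distrib, mul_sub, Finset.sum_sub_distrib]
    have h4 : ∑ j : s, algebraMap R S (if j = ⟨i0, hi0⟩ then c else 0) * g j ^ p =
        algebraMap R S c := by
      rw [Finset.sum_eq_single ⟨i0, hi0⟩]
      · simp [hg0]
      · intro j _ hj; simp [hj]
      · simp
    rw [h4]
    have h5 : ∑ j : s, algebraMap R S (∑ i, e i * D i j ^ p) * g j ^ p =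
        ∑ i, algebraMap R S (e i) * ∑ j ∈ s, algebraMap R S (D i j ^ p) * g j ^ p := by
      simp only [Finset.mul_sum, map_sum, Finset.sum_mul]
      rw [Finset.sum_comm]
      refine Finset.sum_congr rfl fun i _ => ?_
      rw [← Finset.sum_coe_sort s]
      refine Finset.sum_congr rfl fun j _ => ?_
      rw [map_mul, mul_assoc]
    rw [h5]; ring
  have h6 := dvd_of_dvd_sum hR hS h0 (fun j : s => g j ^ p) hg' N Finset.univ _ hmain
    ⟨i0, hi0⟩ (Finset.mem_univ _)
  simp only [if_true] at h6
  exact ⟨fun i => D i i0, h6⟩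

end Unramified

section Completion

theorem exists_pow_lt_Zm0 {a b : Zm0} (ha : a < 1) (hb : b ≠ 0) : ∃ N : ℕ, a ^ N < b := by
  obtain ⟨N, hN⟩ := exists_pow_lt₀ ha (Units.mk0 b hb)
  exact ⟨N, hN⟩

/-- If the completion of a discretely valued field is separable, a family independent over
`p`-th powers has no Cauchy sequence of approximate relations. -/
theorem not_approx_cauchy {C : Type u} [Field C] (u : Valuation C Zm0)
    (hexc : ExcellentCompletion C u) (π : C) (hπ : u π < 1) (p : ℕ) (hp : p.Prime) [CharP C p]
    {m : ℕ} (e : Fin m → C) (c : C) (hec : FrobIndep (R := C) p (Fin.snoc e c : Fin (m + 1) → C))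
    (a : ℕ → Fin m → C)
    (hcau : ∀ i (N : ℕ), ∃ N0, ∀ k ≥ N0, ∀ l ≥ N0, u (a k i - a l i) ≤ u π ^ N)
    (happ : ∀ N : ℕ, ∃ N0, ∀ k ≥ N0, u (c + ∑ i, e i * a k i ^ p) ≤ u π ^ N) : False := by
  let : Valued C Zm0 := Valued.mk' u
  let : Field (UniformSpace.Completion C) := UniformSpace.Completion.instField
  let : Algebra C (UniformSpace.Completion C) :=
    (UniformSpace.Completion.coeRingHom : C →+* UniformSpace.Completion C).toAlgebra
  have hS : Sep C (UniformSpace.Completion C) := IsSepExt.sep hexc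
  have hvu : ∀ x, Valued.v x = u x := fun x => rfl
  have hc1 : ∀ i, CauchySeq (fun k => a k i) := by
    intro i
    refine Valued.cauchy_iff.2 ⟨inferInstance, fun γ => ?_⟩
    obtain ⟨N, hN⟩ := exists_pow_lt_Zm0 hπ
      (b := MonoidWithZeroHom.ValueGroup₀.embedding γ.1) (by simp)
    obtain ⟨N0, hN0⟩ := hcau i N
    refine ⟨(fun k => a k i) '' Set.Ici N0, Filter.image_mem_map (Filter.mem_atTop N0), ?_⟩
    rintro _ ⟨k, hk, rfl⟩ _ ⟨l, hl, rfl⟩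
    rw [Valuation.restrict_lt_iff_lt_embedding]
    exact (hN0 l hl k hk).trans_lt hN
  have hc2 : ∀ i, ∃ y : UniformSpace.Completion C,
      Filter.Tendsto (fun k => ((a k i : C) : UniformSpace.Completion C)) Filter.atTop (nhds y) :=
    fun i => cauchySeq_tendsto_of_complete
      ((hc1 i).map (UniformSpace.Completion.uniformContinuous_coe C))
  choose y hy using hc2
  have h0 : Filter.Tendsto (fun k => c + ∑ i, e i * a k i ^ p) Filter.atTop (nhds 0) := by
    intro s hs
    obtain ⟨γ, hγ⟩ := Valued.mem_nhds_zero.1 hs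
    obtain ⟨N, hN⟩ := exists_pow_lt_Zm0 hπ
      (b := MonoidWithZeroHom.ValueGroup₀.embedding γ.1) (by simp)
    obtain ⟨N0, hN0⟩ := happ N
    refine Filter.mem_map.2 (Filter.mem_of_superset (Filter.mem_atTop N0) fun k hk => hγ ?_)
    change (Valued.v (R := C)).restrict _ < _
    rw [Valuation.restrict_lt_iff_lt_embedding]
    exact (hN0 k hk).trans_lt hN
  have h1 : Filter.Tendsto (fun k => ((c + ∑ i, e i * a k i ^ p : C) : UniformSpace.Completion C))
      Filter.atTop (nhds 0) := by
    have := ((UniformSpace.Completion.continuous_coe C).tendsto 0).comp h0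
    rwa [UniformSpace.Completion.coe_zero] at this
  have h2 : Filter.Tendsto (fun k => ((c + ∑ i, e i * a k i ^ p : C) : UniformSpace.Completion C))
      Filter.atTop (nhds ((c : UniformSpace.Completion C) +
        ∑ i, (e i : UniformSpace.Completion C) * y i ^ p)) := by
    have h3 : ∀ k, ((c + ∑ i, e i * a k i ^ p : C) : UniformSpace.Completion C) =
        (c : UniformSpace.Completion C) +
        ∑ i, (e i : UniformSpace.Completion C) * (a k i : UniformSpace.Completion C) ^ p := by
      intro k
      exact (map_add UniformSpace.Completion.coeRingHom _ _).trans
        (congrArg _ ((map_sum UniformSpace.Completion.coeRingHom _ _).trans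
          (Finset.sum_congr rfl fun i _ => by
            rw [map_mul, map_pow]; rfl)))
    simp_rw [h3]
    exact tendsto_const_nhds.add (tendsto_finsetSum _ fun i _ =>
      tendsto_const_nhds.mul ((hy i).pow p))
  have h4 := tendsto_nhds_unique h2 h1
  have h5 := hS p hp inferInstance (m + 1) _ hec (Fin.snoc y 1) (by
    rw [Fin.sum_univ_castSucc]
    simp only [Fin.snoc_castSucc, Fin.snoc_last, one_pow, mul_one]
    rw [add_comm]
    exact h4) (Fin.last m)
  simp at h5

end Completion

section ValuationBasics

variable {K : Type*} [Field K] {Γ : Type*} [LinearOrderedCommGroupWithZero Γ] (v : Valuation K Γ)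

theorem valuationSubring_dvd_iff (x y : v.valuationSubring) : x ∣ y ↔ v (y : K) ≤ v (x : K) := by
  constructor
  · rintro ⟨z, rfl⟩
    have hz : v (z : K) ≤ 1 := z.2
    rw [MulMemClass.coe_mul, map_mul]
    exact mul_le_of_le_one_right' hz
  · intro h
    by_cases hx : (x : K) = 0
    · rw [hx, map_zero, le_zero_iff, map_eq_zero] at h
      have : y = 0 := Subtype.ext h
      rw [this]; exact dvd_zero _
    · refine ⟨⟨y / x, ?_⟩, Subtype.ext ?_⟩
      · rw [Valuation.mem_valuationSubring_iff, map_div₀]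
        exact div_le_one_of_le₀ h zero_le
      · rw [MulMemClass.coe_mul]; field_simp

variable {v} {π : K}

theorem IsUniformizer.ne_zero (h : IsUniformizer v π) : π ≠ 0 := by
  rintro rfl; exact absurd h.1 (by simp)

theorem IsUniformizer.le_one (h : IsUniformizer v π) : v π ≤ 1 := h.2.1.le

theorem IsUniformizer.maximalIdeal_eq (h : IsUniformizer v π) :
    IsLocalRing.maximalIdeal v.valuationSubring =
      Ideal.span {(⟨π, h.le_one⟩ : v.valuationSubring)} := by
  ext x
  rw [mem_maximalIdeal_iff, Ideal.mem_span_singleton, valuationSubring_dvd_iff]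
  exact ⟨fun hx => h.2.2 _ hx, fun hx => lt_of_le_of_lt hx h.2.1⟩

theorem le_one_of_pow_mul_pow_le_one {a b : Γ} (hb : b ≤ 1) {p T : ℕ} (hp : p ≠ 0)
    (h : a ^ p * b ^ T ≤ 1) : a * b ^ T ≤ 1 := by
  by_contra! hlt
  have h1 : 1 < (a * b ^ T) ^ p := one_lt_pow₀ hlt hp
  have h2 : (b ^ T) ^ p ≤ b ^ T := pow_le_of_le_one zero_le (pow_le_one₀ zero_le hb) hp
  rw [mul_pow] at h1
  exact absurd (h1.trans_le (mul_le_mul_right h2 _)) (not_lt.2 h)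

theorem IsUniformizer.exists_pow_le {C : Type*} [Field C] {u : Valuation C Zm0} {π : C}
    (h : IsUniformizer u π) {c : C} (hc : c ≠ 0) : ∃ N : ℕ, u π ^ N ≤ u c := by
  obtain ⟨N, hN⟩ := exists_pow_lt_Zm0 h.2.1 (b := u c) (by simpa using hc)
  exact ⟨N, hN.le⟩

theorem IsUniformizer.exists_pow_mul_le {C : Type*} [Field C] {u : Valuation C Zm0} {π : C}
    (h : IsUniformizer u π) (c : C) : ∃ N : ℕ, u (π ^ N * c) ≤ 1 := by
  by_cases hc : c = 0
  · exact ⟨0, by simp [hc]⟩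
  · obtain ⟨N, hN⟩ := h.exists_pow_le (inv_ne_zero hc)
    refine ⟨N, ?_⟩
    rw [map_mul, map_pow]
    calc u π ^ N * u c ≤ u c⁻¹ * u c := mul_le_mul_left hN _
      _ = 1 := by rw [← map_mul, inv_mul_cancel₀ hc, map_one]

theorem IsUniformizer.exists_pow_mul_le' {C : Type*} [Field C] {u : Valuation C Zm0} {π : C}
    (h : IsUniformizer u π) {ι : Type*} [Finite ι] (c : ι → C) :
    ∃ N : ℕ, ∀ i, u (π ^ N * c i) ≤ 1 := by
  classical
  have := Fintype.ofFinite ι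
  choose N hN using fun i => h.exists_pow_mul_le (c i)
  refine ⟨∑ i, N i, fun i => ?_⟩
  rw [← Finset.sum_erase_add _ _ (Finset.mem_univ i), pow_add, mul_assoc, map_mul, map_pow]
  exact mul_le_one' (pow_le_one₀ zero_le h.le_one) (hN i)

end ValuationBasics

section Extension

variable {C : Type u} [Field C] {Γ₀ : Type x} [LinearOrderedCommGroupWithZero Γ₀]
  {u : Valuation C Γ₀} {K : Type v} [Field K] [Algebra C K]
  {Γ : Type w} [LinearOrderedCommGroupWithZero Γ] {v : Valuation K Γ}

theorem comap_le_one (h : (v.comap (algebraMap C K)).IsEquiv u) {x : C} :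
    v (algebraMap C K x) ≤ 1 ↔ u x ≤ 1 := by
  simpa using h x 1

/-- The inclusion of valuation rings. -/
def valHom (h : (v.comap (algebraMap C K)).IsEquiv u) :
    u.valuationSubring →+* v.valuationSubring where
  toFun x := ⟨algebraMap C K x, (comap_le_one h).2 x.2⟩
  map_one' := Subtype.ext (map_one _)
  map_zero' := Subtype.ext (map_zero _)
  map_mul' _ _ := Subtype.ext (map_mul _ _ _)
  map_add' _ _ := Subtype.ext (map_add _ _ _)

theorem comap_lt_one (h : (v.comap (algebraMap C K)).IsEquiv u) {x : C} :
    v (algebraMap C K x) < 1 ↔ u x < 1 := by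
  have := h 1 x
  simp only [map_one, Valuation.comap_apply] at this
  rw [← not_le, ← not_le, this]

theorem isLocalHom_valHom (h : (v.comap (algebraMap C K)).IsEquiv u) :
    IsLocalHom (valHom h) := by
  refine ⟨fun x hx => ?_⟩
  by_contra hx'
  have h1 : x ∈ IsLocalRing.maximalIdeal u.valuationSubring := hx'
  rw [mem_maximalIdeal_iff, ← comap_lt_one h] at h1
  have h2 : valHom h x ∈ IsLocalRing.maximalIdeal v.valuationSubring :=
    (mem_maximalIdeal_iff v _).2 h1
  exact h2 hx

theorem sep_residueField (h : (v.comap (algebraMap C K)).IsEquiv u) {g : ResF u →+* ResF v}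
    (hg : ResCompat u v g) (hsep : IsSepExtHom g) [Algebra u.valuationSubring v.valuationSubring]
    [IsLocalHom (algebraMap u.valuationSubring v.valuationSubring)]
    (ha : algebraMap u.valuationSubring v.valuationSubring = valHom h) :
    Sep (ResF u) (ResF v) := by
  let A1 : Algebra (ResF u) (ResF v) := g.toAlgebra
  have h1 : @Sep (ResF u) (ResF v) _ _ A1 := @IsSepExt.sep _ _ _ _ A1 hsep
  have h2 : A1 = IsLocalRing.ResidueField.instAlgebra := by
    apply Algebra.algebra_ext
    intro r
    obtain ⟨x, rfl⟩ := IsLocalRing.residue_surjective r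
    refine (hg x ((comap_le_one h).2 x.2)).trans ?_
    change _ = resMap v (algebraMap u.valuationSubring v.valuationSubring x)
    rw [ha]; rfl
  rw [← h2]; exact h1

/-- Elements of `C` solving an additive equation over `K` up to precision. -/
theorem exists_sub_solution_field (h : (v.comap (algebraMap C K)).IsEquiv u) {π : C}
    (hπu : IsUniformizer u π) (hπv : IsUniformizer v (algebraMap C K π)) {g : ResF u →+* ResF v}
    (hg : ResCompat u v g) (hsep : IsSepExtHom g) (p : ℕ) (hp : p.Prime) [CharP C p]
    {m : ℕ} (e : Fin m → C) (c : C) (he : ∀ i, u (e i) ≤ 1) (hc : u c ≤ 1)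
    (a : Fin m → K) (ha : ∀ i, v (a i) ≤ 1) (N : ℕ)
    (hN : v (algebraMap C K c + ∑ i, algebraMap C K (e i) * a i ^ p) ≤
      v (algebraMap C K π) ^ N) :
    ∃ a' : Fin m → C, u (c + ∑ i, e i * a' i ^ p) ≤ u π ^ N := by
  let _ : Algebra u.valuationSubring v.valuationSubring := (valHom h).toAlgebra
  have _ : IsLocalHom (algebraMap u.valuationSubring v.valuationSubring) := isLocalHom_valHom h
  have hsep' : Sep (ResF u) (ResF v) := sep_residueField h hg hsep rfl
  have _ : CharP u.valuationSubring p := by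
    exact (RingHom.charP_iff u.valuationSubring.subtype Subtype.val_injective p).2 inferInstance
  obtain ⟨a', ha'⟩ := exists_sub_solution (R := u.valuationSubring) (S := v.valuationSubring)
    (π := ⟨π, hπu.le_one⟩) hπu.maximalIdeal_eq hπv.maximalIdeal_eq
    (fun h0 => hπv.ne_zero (congrArg Subtype.val h0)) hsep' p hp (fun i => ⟨e i, he i⟩) ⟨c, hc⟩
    (fun i => ⟨a i, ha i⟩) N (by
      rw [valuationSubring_dvd_iff]
      have h3 : ∀ i : Fin m, ((algebraMap u.valuationSubring v.valuationSubring ⟨e i, he i⟩ *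
        (⟨a i, ha i⟩ : v.valuationSubring) ^ p : v.valuationSubring) : K) =
          algebraMap C K (e i) * a i ^ p := fun i => rfl
      rw [AddMemClass.coe_add, AddSubmonoidClass.coe_finsetSum]
      simp only [h3]
      refine hN.trans_eq ?_
      rw [← map_pow]; rfl)
  refine ⟨fun i => a' i, ?_⟩
  rw [valuationSubring_dvd_iff, AddMemClass.coe_add, AddSubmonoidClass.coe_finsetSum,
    SubmonoidClass.coe_pow, map_pow] at ha'
  exact ha'

end Extension

section FrobBound

variable {C : Type u} [Field C] {u : Valuation C Zm0} {K : Type v} [Field K] [Algebra C K]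
  {Γ : Type w} [LinearOrderedCommGroupWithZero Γ] {v : Valuation K Γ}

theorem FrobIndep.comp {F R : Type*} [Field F] [Field R] [Algebra F R] {p : ℕ} (hp : p ≠ 0)
    {m n : ℕ} {e : Fin m → F} (h : FrobIndep (R := R) p e) (σ : Fin n → Fin m)
    (hσ : Function.Injective σ) : FrobIndep (R := R) p (e ∘ σ) := by
  classical
  intro y hy i
  have h1 := h (Function.extend σ y 0) (by
    rw [← hy]
    symm
    refine Finset.sum_of_injOn σ hσ.injOn (by simp) ?_ ?_
    · intro j _ hj
      rw [Function.extend_apply' _ _ _ (by simpa using hj)]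
      simp [hp]
    · intro j _
      rw [hσ.extend_apply]; rfl) (σ i)
  rwa [hσ.extend_apply] at h1

theorem frobBound_last (h : (v.comap (algebraMap C K)).IsEquiv u) {π : C}
    (hπu : IsUniformizer u π) (hπv : IsUniformizer v (algebraMap C K π)) {g : ResF u →+* ResF v}
    (hg : ResCompat u v g) (hsep : IsSepExtHom g) (hexc : ExcellentCompletion C u)
    (p : ℕ) (hp : p.Prime) [CharP C p] {m : ℕ} (e : Fin m → C) (c : C)
    (hec : FrobIndep (R := C) p (Fin.snoc e c : Fin (m + 1) → C)) (N1 : ℕ)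
    (hN1 : ∀ (a : Fin m → K) (i : Fin m), v (a i) ^ p * v (algebraMap C K π) ^ N1 ≤
      v (∑ j, algebraMap C K (e j) * a j ^ p)) :
    ∃ N, ∀ a : Fin m → K, v (algebraMap C K π) ^ N ≤
      v (algebraMap C K c + ∑ j, algebraMap C K (e j) * a j ^ p) := by
  have : Fact p.Prime := ⟨hp⟩
  have : CharP K p := charP_of_injective_algebraMap (algebraMap C K).injective p
  set t := v (algebraMap C K π) with ht
  have ht0 : 0 < t := hπv.1
  have ht1 : t ≤ 1 := hπv.le_one
  have hle : ∀ x y : C, v (algebraMap C K x) ≤ v (algebraMap C K y) ↔ u x ≤ u y := fun x y => h x y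
  by_contra! hcon
  obtain ⟨M, hM⟩ := hπu.exists_pow_mul_le' (Fin.snoc e c : Fin (m + 1) → C)
  have hMc : u (π ^ M * c) ≤ 1 := by simpa using hM (Fin.last m)
  have hMe : ∀ i, u (π ^ M * e i) ≤ 1 := fun i => by simpa using hM i.castSucc
  have hMc' : t ^ M * v (algebraMap C K c) ≤ 1 := by
    have := (comap_le_one h).2 hMc
    simpa only [map_mul, map_pow] using this
  -- approximate solutions in `C`
  have key : ∀ N : ℕ, ∃ a' : Fin m → C, u (c + ∑ i, e i * a' i ^ p) ≤ u π ^ N := by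
    intro N
    obtain ⟨a, ha⟩ := hcon N
    have h1 : ∀ i, v (a i) ^ p * t ^ (N1 + M) ≤ 1 := by
      intro i
      have h2 : t ^ M * v (∑ j, algebraMap C K (e j) * a j ^ p) ≤ 1 := by
        have h3 : ∑ j, algebraMap C K (e j) * a j ^ p =
          (algebraMap C K c + ∑ j, algebraMap C K (e j) * a j ^ p) - algebraMap C K c := by ring
        rw [h3]
        rcases le_max_iff.1 (Valuation.map_sub v (algebraMap C K c + ∑ j, algebraMap C K (e j) *
          a j ^ p) (algebraMap C K c)) with h4 | h4
        · exact mul_le_one' (pow_le_one₀ zero_le ht1)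
            (h4.trans (ha.le.trans (pow_le_one₀ zero_le ht1)))
        · exact (mul_le_mul_right h4 _).trans hMc'
      calc v (a i) ^ p * t ^ (N1 + M) = t ^ M * (v (a i) ^ p * t ^ N1) := by
            rw [pow_add]; ac_rfl
        _ ≤ _ := (mul_le_mul_right (hN1 a i) _)
        _ ≤ 1 := h2
    generalize N1 + M = T at h1
    have hT : ∀ i, v (a i * algebraMap C K π ^ T) ≤ 1 := by
      intro i
      rw [map_mul, map_pow]
      exact le_one_of_pow_mul_pow_le_one ht1 hp.ne_zero (h1 i)
    have hpow1 : ∀ k, u (π ^ k) ≤ 1 := fun k => by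
      rw [map_pow]; exact pow_le_one₀ zero_le hπu.le_one
    obtain ⟨b, hb⟩ := exists_sub_solution_field h hπu hπv hg hsep p hp
      (fun i => π ^ M * e i) (π ^ (p * T) * (π ^ M * c)) hMe
      (by rw [map_mul]; exact mul_le_one' (hpow1 _) hMc)
      (fun i => a i * algebraMap C K π ^ T) hT (N + M + p * T) (by
        have h5 : algebraMap C K (π ^ (p * T) * (π ^ M * c)) +
          ∑ i, algebraMap C K (π ^ M * e i) * (a i * algebraMap C K π ^ T) ^ p =
          algebraMap C K π ^ (M + p * T) *
            (algebraMap C K c + ∑ j, algebraMap C K (e j) * a j ^ p) := by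
          rw [mul_add _ _ (∑ j, _), Finset.mul_sum]
          congr 1
          · simp only [map_mul, map_pow]; ring
          · refine Finset.sum_congr rfl fun i _ => ?_
            simp only [map_mul, map_pow]; ring
        rw [h5, map_mul, map_pow, ← ht, add_assoc, pow_add t N, mul_comm (t ^ N)]
        exact mul_le_mul_right ha.le _)
    have hπ0 := hπu.ne_zero
    refine ⟨fun i => b i / π ^ T, ?_⟩
    have h6 : π ^ (p * T) * (π ^ M * c) + ∑ i, π ^ M * e i * b i ^ p =
        π ^ (M + p * T) * (c + ∑ i, e i * (b i / π ^ T) ^ p) := by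
      rw [mul_add _ _ (∑ j, _), Finset.mul_sum]
      congr 1
      · ring
      · refine Finset.sum_congr rfl fun i _ => ?_
        rw [div_pow, pow_add, ← pow_mul, mul_comm T p]
        field_simp
    rw [h6, map_mul, map_pow, add_assoc, pow_add _ N, mul_comm (u π ^ N)] at hb
    exact le_of_mul_le_mul_left hb (pow_pos hπu.1 _)
  choose a ha using key
  have hanti : ∀ {k l : ℕ}, k ≤ l → u π ^ l ≤ u π ^ k := fun hkl =>
    pow_le_pow_of_le_one zero_le hπu.le_one hkl
  refine not_approx_cauchy u hexc π hπu.2.1 p hp e c hec a ?_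
    (fun N => ⟨N, fun k hk => (ha k).trans (hanti hk)⟩)
  intro i N
  refine ⟨p * N + N1, fun k hk l hl => ?_⟩
  have h7 : ∑ j, e j * (a k j - a l j) ^ p =
      (c + ∑ j, e j * a k j ^ p) - (c + ∑ j, e j * a l j ^ p) := by
    have hcp : CharP C p := inferInstance
    rw [add_sub_add_left_eq_sub, ← Finset.sum_sub_distrib]
    exact Finset.sum_congr rfl fun j _ => by rw [sub_pow_char, mul_sub]
  have h8 : u (∑ j, e j * (a k j - a l j) ^ p) ≤ u π ^ (p * N + N1) := by
    rw [h7]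
    exact Valuation.map_sub_le u ((ha k).trans (hanti hk)) ((ha l).trans (hanti hl))
  have h9 := hN1 (fun j => algebraMap C K (a k j - a l j)) i
  have h10 : ∑ j, algebraMap C K (e j) * algebraMap C K (a k j - a l j) ^ p =
      algebraMap C K (∑ j, e j * (a k j - a l j) ^ p) := by
    simp only [map_sum, map_mul, map_pow]
  have h11 : v (algebraMap C K ((a k i - a l i) ^ p * π ^ N1)) ≤
      v (algebraMap C K (∑ j, e j * (a k j - a l j) ^ p)) := by
    rw [← h10, map_mul, map_mul, map_pow, map_pow, map_pow, map_pow]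
    exact h9
  rw [hle] at h11
  have h12 := h11.trans h8
  rw [map_mul, map_pow, map_pow, pow_add] at h12
  have h13 := le_of_mul_le_mul_right h12 (pow_pos hπu.1 _)
  rw [mul_comm p N, pow_mul] at h13
  exact (pow_le_pow_iff_left₀ zero_le zero_le hp.ne_zero).1 h13

/-- Quantitative separability of `K/C`. -/
theorem frobBound (h : (v.comap (algebraMap C K)).IsEquiv u) {π : C}
    (hπu : IsUniformizer u π) (hπv : IsUniformizer v (algebraMap C K π)) {g : ResF u →+* ResF v}
    (hg : ResCompat u v g) (hsep : IsSepExtHom g) (hexc : ExcellentCompletion C u)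
    (p : ℕ) (hp : p.Prime) [CharP C p] {m : ℕ} (e : Fin m → C) (he : FrobIndep (R := C) p e) :
    ∃ N, ∀ (a : Fin m → K) (i : Fin m), v (a i) ^ p * v (algebraMap C K π) ^ N ≤
      v (∑ j, algebraMap C K (e j) * a j ^ p) := by
  induction m with
  | zero => exact ⟨0, fun a i => i.elim0⟩
  | succ m ih =>
    have h1 : ∀ i : Fin (m + 1), ∃ N, ∀ (a : Fin (m + 1) → K),
        v (a i) ^ p * v (algebraMap C K π) ^ N ≤ v (∑ j, algebraMap C K (e j) * a j ^ p) := by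
      intro i
      let e' : Fin m → C := fun j => e (i.succAbove j)
      have he' : FrobIndep (R := C) p e' := he.comp hp.ne_zero _ Fin.succAbove_right_injective
      obtain ⟨N1, hN1⟩ := ih e' he'
      obtain ⟨N, hN⟩ := frobBound_last h hπu hπv hg hsep hexc p hp e' (e i) (by
        have : (Fin.snoc e' (e i) : Fin (m + 1) → C) = e ∘ Fin.snoc i.succAbove i := by
          ext j
          refine Fin.lastCases ?_ (fun j => ?_) j <;> simp [e']
        rw [this]
        refine he.comp hp.ne_zero _ ?_
        rw [Fin.snoc_injective_iff]
        exact ⟨Fin.succAbove_right_injective, by simp⟩) N1 hN1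
      refine ⟨N, fun a => ?_⟩
      by_cases ha : a i = 0
      · simp [ha, hp.ne_zero]
      · have h2 := hN (fun j => a (i.succAbove j) / a i)
        have h3 : ∑ j, algebraMap C K (e j) * a j ^ p = a i ^ p * (algebraMap C K (e i) +
            ∑ j, algebraMap C K (e' j) * (a (i.succAbove j) / a i) ^ p) := by
          rw [Fin.sum_univ_succAbove _ i, mul_add, Finset.mul_sum]
          congr 1
          · ring
          · refine Finset.sum_congr rfl fun j _ => ?_
            simp only [e']
            rw [div_pow]
            field_simp
        rw [h3, map_mul, map_pow]
        exact mul_le_mul_right h2 _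
    choose N hN using h1
    refine ⟨∑ i, N i, fun a i => le_trans ?_ (hN i a)⟩
    refine mul_le_mul_right (pow_le_pow_of_le_one zero_le hπv.le_one ?_) _
    exact Finset.single_le_sum (fun _ _ => Nat.zero_le _) (Finset.mem_univ i)

theorem sep_of_frobBound (h : (v.comap (algebraMap C K)).IsEquiv u) {π : C}
    (hπu : IsUniformizer u π) (hπv : IsUniformizer v (algebraMap C K π)) {g : ResF u →+* ResF v}
    (hg : ResCompat u v g) (hsep : IsSepExtHom g) (hexc : ExcellentCompletion C u) :
    Sep C K := by
  intro p hp _ m e he y hy i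
  obtain ⟨N, hN⟩ := frobBound h hπu hπv hg hsep hexc p hp e he
  have h1 := hN y i
  rw [hy, map_zero, le_zero_iff, mul_eq_zero] at h1
  rcases h1 with h1 | h1
  · simpa using eq_zero_of_pow_eq_zero h1
  · exact absurd (eq_zero_of_pow_eq_zero h1) hπv.1.ne'

end FrobBound

section FormallySmooth

theorem mem_ker_pow_two_iff (R S : Type u) [CommRing R] [CommRing S] [Algebra R S] :
    Subsingleton (Algebra.H1Cotangent R S) ↔ ∀ f : MvPolynomial S R,
      MvPolynomial.aeval (id : S → S) f = 0 →
      (∀ i, MvPolynomial.aeval (id : S → S) (MvPolynomial.pderiv i f) = 0) →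
      f ∈ (RingHom.ker (MvPolynomial.aeval (R := R) (id : S → S))) ^ 2 := by
  let P : Algebra.Generators R S S := Algebra.Generators.self R S
  have hker : P.toExtension.ker = RingHom.ker (MvPolynomial.aeval (R := R) (id : S → S)) := by
    rfl
  change Subsingleton P.toExtension.H1Cotangent ↔ _
  rw [Algebra.Extension.subsingleton_h1Cotangent, injective_iff_map_eq_zero]
  constructor
  · intro h f hf hd
    rw [← hker]
    have hf' : f ∈ P.toExtension.ker := hf
    have h1 := h (Algebra.Extension.Cotangent.mk ⟨f, hf'⟩) (by
      rw [Algebra.Extension.cotangentComplex_mk]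
      apply P.cotangentSpaceBasis.repr.injective
      ext i
      rw [map_zero, Algebra.Generators.cotangentSpaceBasis_repr_one_tmul]
      exact hd i)
    exact (Algebra.Extension.Cotangent.mk_eq_zero_iff _).1 h1
  · intro h x hx
    obtain ⟨⟨f, hf⟩, rfl⟩ := Algebra.Extension.Cotangent.mk_surjective x
    refine (Algebra.Extension.Cotangent.mk_eq_zero_iff _).2 ?_
    refine h f hf fun i => ?_
    rw [Algebra.Extension.cotangentComplex_mk] at hx
    have := Algebra.Generators.cotangentSpaceBasis_repr_one_tmul (P := P) f i
    refine this.symm.trans ?_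
    refine (congrArg (fun z => P.cotangentSpaceBasis.repr z i) hx).trans ?_
    rw [map_zero, Finsupp.zero_apply]

theorem Sep.formallySmooth {F E : Type u} [Field F] [Field E] [Algebra F E] (h : Sep F E) :
    Algebra.FormallySmooth F E := by
  refine ⟨inferInstance, (mem_ker_pow_two_iff F E).2 fun f hf hd => ?_⟩
  let E' := IntermediateField.adjoin F (f.vars : Set E)
  have hE' : Algebra.FormallySmooth F E' := by
    have h1 : Sep F E' := h.of_algHom E'.val
    have : Algebra.EssFiniteType F E' :=
      IntermediateField.essFiniteType_iff.2 ⟨f.vars, rfl⟩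
    obtain ⟨s, hs, hsep⟩ := h1.exists_separating
    have hr : Set.range (Subtype.val : {z // z ∈ (s : Set E')} → E') = s := Subtype.range_coe
    have : Algebra.IsSeparable
        (IntermediateField.adjoin F
            (Set.range (Subtype.val : {z // z ∈ (s : Set E')} → E'))) E' := by
      rw [hr]; exact hsep
    exact .of_algebraicIndependent_of_isSeparable hs.1
  obtain ⟨q, hq⟩ := MvPolynomial.exists_rename_eq_of_vars_subset_range f
    (Subtype.val : E' → E) Subtype.val_injective (by
      rw [Subtype.range_coe]
      exact IntermediateField.subset_adjoin _ _)
  have hev : ∀ g : MvPolynomial E' F, MvPolynomial.aeval (id : E → E)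
      (MvPolynomial.rename Subtype.val g) = (MvPolynomial.aeval (id : E' → E') g : E') := by
    intro g
    rw [MvPolynomial.aeval_rename]
    have := MvPolynomial.aeval_algebraMap_apply E (id : E' → E') g
    exact this
  have h2 := (mem_ker_pow_two_iff F E').1 hE'.2 q (by
    rw [← hq, hev] at hf
    exact Subtype.ext hf) (fun i => by
    have := hd i
    rw [← hq, MvPolynomial.pderiv_rename Subtype.val_injective, hev] at this
    exact Subtype.ext this)
  rw [← hq]
  have h3 := Ideal.mem_map_of_mem
    (MvPolynomial.rename (R := F) (Subtype.val : E' → E)) h2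
  rw [Ideal.map_pow] at h3
  refine Ideal.pow_right_mono ?_ 2 h3
  rw [Ideal.map_le_iff_le_comap]
  intro g hg
  change MvPolynomial.aeval (id : E → E) (MvPolynomial.rename Subtype.val g) = 0
  rw [hev, (hg : MvPolynomial.aeval (id : E' → E') g = 0)]
  rfl

end FormallySmooth

section AdicLifting

variable {R S : Type u} [CommRing R] [CommRing S] [Algebra R S]

theorem flat_quotient [Module.Flat R S] (I : Ideal R) :
    (Ideal.quotientMap (I.map (algebraMap R S)) (algebraMap R S) Ideal.le_comap_map).Flat := by
  let _ : Algebra (R ⧸ I) (S ⧸ I.map (algebraMap R S)) :=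
    (Ideal.quotientMap (I.map (algebraMap R S)) (algebraMap R S) Ideal.le_comap_map).toAlgebra
  have _ : IsScalarTower R (R ⧸ I) (S ⧸ I.map (algebraMap R S)) :=
    IsScalarTower.of_algebraMap_eq fun r => rfl
  let e := (Algebra.TensorProduct.quotIdealMapEquivTensorQuot S I).toLinearEquiv.restrictScalars R
  let e' : (S ⧸ I.map (algebraMap R S)) ≃ₗ[R] TensorProduct R (R ⧸ I) S :=
    e.trans (TensorProduct.comm R S (R ⧸ I))
  let e'' := e'.extendScalarsOfSurjective (S := R ⧸ I) Ideal.Quotient.mk_surjective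
  exact Module.Flat.of_linearEquiv e''

theorem formallySmooth_quotient_sq [Module.Flat R S] (I : Ideal R)
    (h : (Ideal.quotientMap (I.map (algebraMap R S)) (algebraMap R S)
      Ideal.le_comap_map).FormallySmooth) :
    (Ideal.quotientMap ((I ^ 2).map (algebraMap R S)) (algebraMap R S)
      Ideal.le_comap_map).FormallySmooth := by
  refine RingHom.FormallySmooth.of_flat_of_ker_eq_map_of_square_zero _ (flat_quotient _)
    (Ideal.Quotient.factor (Ideal.pow_le_self two_ne_zero))
    (Ideal.Quotient.factor (Ideal.map_mono (Ideal.pow_le_self two_ne_zero))) _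
    (Ideal.Quotient.factor_surjective _) (Ideal.Quotient.factor_surjective _) ?_ ?_ ?_ h
  · ext x; rfl
  · rw [Ideal.Quotient.factor_ker, ← Ideal.map_pow, Ideal.map_quotient_self]
  · rw [Ideal.Quotient.factor_ker, Ideal.Quotient.factor_ker, Ideal.map_map, Ideal.map_map]
    congr 1

theorem formallySmooth_quotient_pow [Module.Flat R S] (I : Ideal R)
    (h : (Ideal.quotientMap (I.map (algebraMap R S)) (algebraMap R S)
      Ideal.le_comap_map).FormallySmooth) (k : ℕ) :
    (Ideal.quotientMap ((I ^ 2 ^ k).map (algebraMap R S)) (algebraMap R S)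
      Ideal.le_comap_map).FormallySmooth := by
  induction k with
  | zero =>
    have h0 : I ^ 2 ^ 0 = I := by simp
    rw [h0]; exact h
  | succ k ih =>
    have := formallySmooth_quotient_sq (I ^ 2 ^ k) ih
    have h1 : (I ^ 2 ^ k) ^ 2 = I ^ 2 ^ (k + 1) := by rw [← pow_mul, ← pow_succ]
    rw [h1] at this
    exact this

/-- Homomorphisms from `S` lift along nilpotent extensions killed by a power of `I`. -/
theorem exists_lift_of_formallySmooth [Module.Flat R S] (I : Ideal R)
    (h : (Ideal.quotientMap (I.map (algebraMap R S)) (algebraMap R S)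
      Ideal.le_comap_map).FormallySmooth) (k : ℕ) {A B : Type*} [CommRing A] [CommRing B]
    [Algebra R A] [Algebra R B] (hA : ∀ r ∈ I ^ 2 ^ k, algebraMap R A r = 0)
    (q : A →ₐ[R] B) (hq : Function.Surjective q) (hq' : IsNilpotent (RingHom.ker q))
    (f : S →ₐ[R] B) : ∃ g : S →ₐ[R] A, q.comp g = f := by
  let J := I ^ 2 ^ k
  have hB : ∀ r ∈ J, algebraMap R B r = 0 := fun r hr => by
    rw [← q.commutes, hA r hr, map_zero]
  let _ : Algebra (R ⧸ J) (S ⧸ J.map (algebraMap R S)) :=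
    (Ideal.quotientMap (J.map (algebraMap R S)) (algebraMap R S) Ideal.le_comap_map).toAlgebra
  have _ : Algebra.FormallySmooth (R ⧸ J) (S ⧸ J.map (algebraMap R S)) :=
    formallySmooth_quotient_pow I h k
  let _ : Algebra (R ⧸ J) A := (Ideal.Quotient.lift J (algebraMap R A) hA).toAlgebra
  let _ : Algebra (R ⧸ J) B := (Ideal.Quotient.lift J (algebraMap R B) hB).toAlgebra
  let q' : A →ₐ[R ⧸ J] B := { q.toRingHom with
    commutes' := fun r => by
      obtain ⟨r, rfl⟩ := Ideal.Quotient.mk_surjective r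
      exact q.commutes r }
  have hf : ∀ s ∈ J.map (algebraMap R S), f.toRingHom s = 0 := by
    intro s hs
    have : J.map (algebraMap R S) ≤ RingHom.ker f.toRingHom := by
      rw [Ideal.map_le_iff_le_comap]
      intro r hr
      exact (f.commutes r).trans (hB r hr)
    exact this hs
  let f' : (S ⧸ J.map (algebraMap R S)) →ₐ[R ⧸ J] B :=
    { Ideal.Quotient.lift _ f.toRingHom hf with
      commutes' := fun r => by
        obtain ⟨r, rfl⟩ := Ideal.Quotient.mk_surjective r
        exact f.commutes r }
  let g := Algebra.FormallySmooth.liftOfSurjective f' q' hq hq'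
  refine ⟨{ g.toRingHom.comp (Ideal.Quotient.mk _) with
    commutes' := fun r => g.commutes (Ideal.Quotient.mk _ r) }, ?_⟩
  ext s
  exact Algebra.FormallySmooth.liftOfSurjective_apply f' q' hq hq' (Ideal.Quotient.mk _ s)

end AdicLifting

section GermLifting
open Filter IsLocalRing

/-- The map induced on germs by a ring homomorphism. -/
def germMap {ι : Type*} (l : Filter ι) {A B : Type*} [CommRing A] [CommRing B] (f : A →+* B) :
    Germ l A →+* Germ l B where
  toFun := Germ.map f
  map_one' := congrArg (Germ.ofFun (l := l)) (funext fun _ => map_one f)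
  map_zero' := congrArg (Germ.ofFun (l := l)) (funext fun _ => map_zero f)
  map_mul' x y := by
    induction x using Germ.inductionOn
    induction y using Germ.inductionOn
    exact congrArg (Germ.ofFun (l := l)) (funext fun _ => map_mul f _ _)
  map_add' x y := by
    induction x using Germ.inductionOn
    induction y using Germ.inductionOn
    exact congrArg (Germ.ofFun (l := l)) (funext fun _ => map_add f _ _)

/-- The diagonal embedding into germs. -/
def germConst {ι : Type*} (l : Filter ι) (A : Type*) [CommRing A] : A →+* Germ l A :=
  (Germ.coeRingHom l).comp (Pi.constRingHom ι A)

theorem exists_ringHom_germ {k : Type*} {E L : Type*} [Field k] [Field E] [Field L] [Algebra k E]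
    [Algebra k L]
    (h : ∀ S : Finset E, Nonempty (Algebra.adjoin k (S : Set E) →ₐ[k] L)) :
    ∃ f : E →+* Germ (atTop : Filter (Finset E)) L,
      ∀ c, f (algebraMap k E c) = germConst _ L (algebraMap k L c) := by
  classical
  let h' := fun S => (h S).some
  let F : E → Finset E → L := fun x S =>
    if hx : x ∈ Algebra.adjoin k (S : Set E) then h' S ⟨x, hx⟩ else 0
  have hF : ∀ x (S : Finset E) (hx : x ∈ Algebra.adjoin k (S : Set E)), F x S = h' S ⟨x, hx⟩ :=
    fun x S hx => dif_pos hx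
  have hev : ∀ x : E, ∀ᶠ S : Finset E in atTop, x ∈ Algebra.adjoin k (S : Set E) := by
    intro x
    filter_upwards [eventually_ge_atTop {x}] with S hS
    exact Algebra.subset_adjoin (hS (Finset.mem_singleton_self x))
  refine ⟨⟨⟨⟨fun x => (F x : Germ _ L), ?_⟩, ?_⟩, ?_, ?_⟩, fun c => ?_⟩
  · refine Germ.coe_eq.2 (Eventually.of_forall fun S => ?_)
    exact (hF 1 S (one_mem _)).trans (map_one (h' S))
  · intro x y
    refine Germ.coe_eq.2 ?_
    filter_upwards [hev x, hev y] with S hx hy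
    rw [hF _ _ (mul_mem hx hy), hF _ _ hx, hF _ _ hy, ← map_mul]
    rfl
  · refine Germ.coe_eq.2 (Eventually.of_forall fun S => ?_)
    exact (hF 0 S (zero_mem _)).trans (map_zero (h' S))
  · intro x y
    refine Germ.coe_eq.2 ?_
    filter_upwards [hev x, hev y] with S hx hy
    rw [hF _ _ (add_mem hx hy), hF _ _ hx, hF _ _ hy, ← map_add]
    rfl
  · refine Germ.coe_eq.2 (Eventually.of_forall fun S => ?_)
    exact (hF _ S (algebraMap_mem _ c)).trans ((h' S).commutes c)

theorem exists_ringHom_germ_quotient {R S T : Type u} [CommRing R] [CommRing S] [CommRing T]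
    [IsLocalRing R] [IsLocalRing S] [IsLocalRing T] [Algebra R S] [Algebra R T]
    [IsLocalHom (algebraMap R S)] [IsLocalHom (algebraMap R T)] [Module.Flat R S] {ϖ : R}
    (hR : maximalIdeal R = Ideal.span {ϖ}) (hS : maximalIdeal S = Ideal.span {algebraMap R S ϖ})
    (hT : maximalIdeal T = Ideal.span {algebraMap R T ϖ})
    [Algebra.FormallySmooth (ResidueField R) (ResidueField S)]
    (h : ∀ Z : Finset (ResidueField S), Nonempty
      (Algebra.adjoin (ResidueField R)
          (Z : Set (ResidueField S)) →ₐ[ResidueField R] ResidueField T))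
    (k : ℕ) : ∃ g : S →+* Germ (atTop : Filter (Finset (ResidueField S)))
      (T ⧸ Ideal.span {algebraMap R T ϖ ^ 2 ^ k}), ∀ r, g (algebraMap R S r) =
        germConst _ _ (Ideal.Quotient.mk _ (algebraMap R T r)) := by
  let l := (atTop : Filter (Finset (ResidueField S)))
  obtain ⟨f, hf⟩ : ∃ f : ResidueField S →+* Germ l (ResidueField T),
      ∀ c, f (algebraMap (ResidueField R) (ResidueField S) c) =
        germConst _ _ (algebraMap (ResidueField R) (ResidueField T) c) := exists_ringHom_germ h
  let N := 2 ^ k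
  have hN0 : N ≠ 0 := by positivity
  let Q := T ⧸ Ideal.span {algebraMap R T ϖ ^ N}
  let gA : R →+* Germ l Q := (germConst l Q).comp ((Ideal.Quotient.mk _).comp (algebraMap R T))
  let gB : R →+* Germ l (ResidueField T) :=
    (germConst l _).comp ((residue T).comp (algebraMap R T))
  let q0 : Q →+* ResidueField T := Ideal.Quotient.lift _ (residue T) (by
    intro a ha
    rw [residue_eq_zero_iff, hT]
    refine Ideal.span_singleton_le_span_singleton.2 (dvd_pow_self _ hN0) ha)
  let _ : Algebra R (Germ l Q) := gA.toAlgebra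
  let _ : Algebra R (Germ l (ResidueField T)) := gB.toAlgebra
  let q : Germ l Q →ₐ[R] Germ l (ResidueField T) :=
    { germMap l q0 with commutes' := fun r => rfl }
  let f' : S →ₐ[R] Germ l (ResidueField T) :=
    { f.comp (residue S) with
      commutes' := fun r => hf (residue R r) }
  have hsm : (Ideal.quotientMap ((maximalIdeal R).map (algebraMap R S)) (algebraMap R S)
      Ideal.le_comap_map).FormallySmooth := by
    have key : ∀ J : Ideal S, J = maximalIdeal S → ∀ hJ : maximalIdeal R ≤ J.comap (algebraMap R S),
        (Ideal.quotientMap J (algebraMap R S) hJ).FormallySmooth := by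
      rintro J rfl hJ
      have h1 : (algebraMap (ResidueField R) (ResidueField S)).FormallySmooth :=
        RingHom.formallySmooth_algebraMap.2 inferInstance
      have h2 : algebraMap (ResidueField R) (ResidueField S) =
          Ideal.quotientMap (maximalIdeal S) (algebraMap R S) hJ := by
        apply Ideal.Quotient.ringHom_ext
        ext x; rfl
      rw [← h2]; exact h1
    exact key _ (by rw [hR, hS, Ideal.map_span, Set.image_singleton]) _
  have hq0 : Function.Surjective q0 := Ideal.Quotient.lift_surjective_of_surjective _ _
    residue_surjective
  have hq : Function.Surjective q := by
    intro y
    induction y using Germ.inductionOn with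
    | _ y =>
      choose z hz using fun i => hq0 (y i)
      exact ⟨(z : Germ l Q), congrArg (Germ.ofFun (l := l)) (funext hz)⟩
  have hker : IsNilpotent (RingHom.ker q) := by
    refine ⟨N, ?_⟩
    have h1 : RingHom.ker q ≤ Ideal.span {gA ϖ} := by
      intro x hx
      induction x using Germ.inductionOn with
      | _ x =>
        have hx' : ∀ᶠ i in l, q0 (x i) = 0 := Germ.coe_eq.1 hx
        have h2 : ∀ i, ∃ y : Q, q0 (x i) = 0 →
            x i = Ideal.Quotient.mk _ (algebraMap R T ϖ) * y := by
          intro i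
          obtain ⟨t, ht⟩ := Ideal.Quotient.mk_surjective (x i)
          by_cases h0 : q0 (x i) = 0
          · rw [← ht] at h0
            have h3 : residue T t = 0 := h0
            rw [residue_eq_zero_iff, hT, Ideal.mem_span_singleton] at h3
            obtain ⟨y, rfl⟩ := h3
            exact ⟨Ideal.Quotient.mk _ y, fun _ => by rw [← ht, map_mul]⟩
          · exact ⟨0, fun h => absurd h h0⟩
        choose y hy using h2
        rw [Ideal.mem_span_singleton]
        refine ⟨(y : Germ l Q), Germ.coe_eq.2 ?_⟩
        filter_upwards [hx'] with i hi using hy i hi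
    refine le_bot_iff.1 ((Ideal.pow_right_mono h1 N).trans ?_)
    have h4 : (Ideal.Quotient.mk (Ideal.span {algebraMap R T ϖ ^ N})) (algebraMap R T (ϖ ^ N)) =
        0 := by
      rw [Ideal.Quotient.eq_zero_iff_mem, map_pow]
      exact Ideal.mem_span_singleton_self _
    have h5 : gA ϖ ^ N = 0 :=
      (map_pow gA ϖ N).symm.trans ((congrArg (germConst l Q) h4).trans (map_zero _))
    exact (Ideal.span_singleton_pow (gA ϖ) N).le.trans (Ideal.span_singleton_eq_bot.2 h5).le
  obtain ⟨g, -⟩ := exists_lift_of_formallySmooth (maximalIdeal R) hsm k (A := Germ l Q)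
    (fun r hr => by
      rw [hR, Ideal.span_singleton_pow, Ideal.mem_span_singleton] at hr
      have h4 : (Ideal.Quotient.mk (Ideal.span {algebraMap R T ϖ ^ N})) (algebraMap R T r) = 0 := by
        rw [Ideal.Quotient.eq_zero_iff_mem, Ideal.mem_span_singleton, ← map_pow]
        exact map_dvd _ hr
      exact (congrArg (germConst l Q) h4).trans (map_zero _)) q hq hker f'
  exact ⟨g.toRingHom, fun r => g.commutes r⟩

end GermLifting

section Models
open Polynomial

theorem TrLE.mono {C E : Type*} [Field C] [Field E] [Algebra C E] {n : ℕ} {S T : Set E}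
    (h : TrLE C n T) (hST : S ⊆ T) : TrLE C n S := fun x hx => h x fun i => hST (hx i)

theorem exists_hypersurface_adjoin_lift {C : Type u} {E : Type v} [Field C] [Field E]
    [Algebra C E] (hE : Sep C E) (n : ℕ) (Z : Finset E)
    (hn : TrLE C n (IntermediateField.adjoin C (Z : Set E) : Set E)) :
    ∃ (d : ℕ) (_ : d ≤ n) (s : Fin d → E) (b : E) (G H : (MvPolynomial (Fin d) C)[X]),
      ev s b G = 0 ∧ ev s b (derivative G) ≠ 0 ∧ ev s b H ≠ 0 ∧
      (∀ z ∈ Z, ∃ A B : (MvPolynomial (Fin d) C)[X], ev s b B ≠ 0 ∧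
        z * ev s b B = ev s b A) ∧
      ∀ (L : Type w) [Field L] [Algebra C L] (s' : Fin d → L) (b' : L),
        ev s' b' G = 0 → ev s' b' H ≠ 0 → ∃ φ : Algebra.adjoin C (Z : Set E) →ₐ[C] L,
          ∀ (z : Algebra.adjoin C (Z : Set E)) (A B : (MvPolynomial (Fin d) C)[X]),
              ev s' b' B ≠ 0 → (z : E) * ev s b B = ev s b A →
            φ z * ev s' b' B = ev s' b' A := by
  classical
  let F := IntermediateField.adjoin C (Z : Set E)
  have : Algebra.EssFiniteType C F := IntermediateField.essFiniteType_iff.2 ⟨Z, rfl⟩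
  let Z' : Finset F := Z.attach.image fun z =>
    (⟨z.1, IntermediateField.subset_adjoin C _ z.2⟩ : F)
  have hZ' : F.val '' (Z' : Set F) = Z := by
    ext x
    constructor
    · rintro ⟨y, hy, rfl⟩
      obtain ⟨z, -, rfl⟩ := Finset.mem_image.1 (Finset.mem_coe.1 hy)
      exact z.2
    · intro hx
      exact ⟨⟨x, IntermediateField.subset_adjoin C _ hx⟩,
        Finset.mem_coe.2 (Finset.mem_image.2 ⟨⟨x, hx⟩, Finset.mem_attach _ _, rfl⟩), rfl⟩
  have himg : Algebra.adjoin C (Z : Set E) = (Algebra.adjoin C (Z' : Set F)).map F.val := by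
    rw [AlgHom.map_adjoin, hZ']
  obtain ⟨d, hd, s, b, G, H, h1, h2, h3, h5, h4⟩ := exists_hypersurface (C := C) (E := F)
    (hE.of_algHom F.val) n (by
      intro x _ hx
      exact hn (fun i => x i) (fun i => (x i).2)
        (hx.map' (f := F.val) F.val.injective)) Z'
  refine ⟨d, hd, fun i => F.val (s i), F.val b, G, H, ?_, ?_, ?_, ?_, fun L _ _ s' b' hG hH => ?_⟩
  · rw [map_ev, h1, map_zero]
  · rw [map_ev]; simpa using h2
  · rw [map_ev]; simpa using h3
  · intro z hz
    obtain ⟨A, B, hB, hAB⟩ := h5 ⟨z, IntermediateField.subset_adjoin C _ hz⟩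
    refine ⟨A, B, ?_, ?_⟩
    · rw [map_ev]; simpa using hB
    · rw [map_ev, map_ev]; exact congrArg F.val hAB
  · obtain ⟨f, hf⟩ := h4 L s' b' hG hH
    let e := (Algebra.adjoin C (Z' : Set F)).equivMapOfInjective F.val F.val.injective
    refine ⟨(f.comp e.symm.toAlgHom).comp (Subalgebra.inclusion himg.le), fun z A B hB hz => ?_⟩
    refine hf _ A B hB (F.val.injective ((map_mul F.val _ _).trans ?_))
    rw [map_ev, map_ev] at hz
    refine Eq.trans ?_ hz
    congr 1
    exact congrArg Subtype.val (e.apply_symm_apply (Subalgebra.inclusion himg.le z))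

/-- Polynomial presentations of finitely generated subalgebras of separable extensions. -/
theorem exists_hypersurface_adjoin {C : Type u} {E : Type v} [Field C] [Field E] [Algebra C E]
    (hE : Sep C E) (n : ℕ) (Z : Finset E)
    (hn : TrLE C n (IntermediateField.adjoin C (Z : Set E) : Set E)) :
    ∃ (d : ℕ) (_ : d ≤ n) (s : Fin d → E) (b : E) (G H : (MvPolynomial (Fin d) C)[X]),
      ev s b G = 0 ∧ ev s b (derivative G) ≠ 0 ∧ ev s b H ≠ 0 ∧
      ∀ (L : Type w) [Field L] [Algebra C L] (s' : Fin d → L) (b' : L),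
        ev s' b' G = 0 → ev s' b' H ≠ 0 → Nonempty (Algebra.adjoin C (Z : Set E) →ₐ[C] L) := by
  obtain ⟨d, hd, s, b, G, H, h1, h2, h3, -, h4⟩ :=
      exists_hypersurface_adjoin_lift.{u, v, w} hE n Z hn
  exact ⟨d, hd, s, b, G, H, h1, h2, h3, fun L _ _ s' b' hG hH =>
    let ⟨φ, _⟩ := h4 L s' b' hG hH; ⟨φ⟩⟩

/-- If an extension has an equation separable in the last coordinate, its transcendence degree
is at most the number of the other coordinates. -/
theorem trLE_of_ev {C K : Type*} [Field C] [Field K] [Algebra C K] {d : ℕ} (s : Fin d → K) (b : K)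
    (G : (MvPolynomial (Fin d) C)[X]) (h0 : ev s b G = 0) (h1 : ev s b (derivative G) ≠ 0) :
    TrLE C d (IntermediateField.adjoin C (insert b (Set.range s)) : Set K) := by
  classical
  refine trLE_adjoin_of_isAlgebraic (X := Finset.univ.image s)
    (Finset.card_image_le.trans (by simp)) fun z hz => ?_
  rw [Finset.coe_image, Finset.coe_univ, Set.image_univ]
  set F := IntermediateField.adjoin C (Set.range s) with hF
  rcases hz with rfl | hz
  · let s' : Fin d → F := fun i => ⟨s i, IntermediateField.subset_adjoin C _ ⟨i, rfl⟩⟩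
    let g : F[X] := G.map (MvPolynomial.aeval s' : MvPolynomial (Fin d) C →ₐ[C] F).toRingHom
    have hg : ∀ P : (MvPolynomial (Fin d) C)[X], ev s z P = aeval z
        (P.map (MvPolynomial.aeval s' : MvPolynomial (Fin d) C →ₐ[C] F).toRingHom) := by
      intro P
      rw [ev_apply, aeval_def, eval₂_eq_eval_map, Polynomial.map_map]
      congr 2
      ext i
      · simp
      · simp [s']
    refine ⟨g, ?_, by rw [← hg, h0]⟩
    intro hg0
    apply h1
    rw [hg, ← derivative_map]
    change aeval z (derivative g) = 0
    rw [hg0]; simp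
  · exact isAlgebraic_algebraMap (⟨z, IntermediateField.subset_adjoin C _ hz⟩ : F)

end Models

section Residue

variable {C : Type u} [Field C] {Γ₀ : Type*} [LinearOrderedCommGroupWithZero Γ₀]
  {u : Valuation C Γ₀} {K : Type v} [Field K] [Algebra C K]
  {Γ : Type w} [LinearOrderedCommGroupWithZero Γ] {v : Valuation K Γ}

/-- Lifts of algebraically independent residues are algebraically independent. -/
theorem algebraicIndependent_of_residue {ι : Type*} [Algebra u.valuationSubring v.valuationSubring]
    [IsLocalHom (algebraMap u.valuationSubring v.valuationSubring)]
    (hcomp : ∀ c : u.valuationSubring,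
      ((algebraMap u.valuationSubring v.valuationSubring c : v.valuationSubring) : K) =
        algebraMap C K c)
    (x : ι → v.valuationSubring)
    (hx : AlgebraicIndependent (ResF u) fun i => resMap v (x i)) :
    AlgebraicIndependent C fun i => (x i : K) := by
  classical
  rw [algebraicIndependent_iff]
  intro P hP
  by_contra hP0
  obtain ⟨m0, hm0, hmax⟩ := P.support.exists_max_image (fun m => u (P.coeff m))
    (MvPolynomial.support_nonempty.2 hP0)
  set c := P.coeff m0
  have hc0 : c ≠ 0 := MvPolynomial.mem_support_iff.1 hm0
  have hle : ∀ m, u (c⁻¹ * P.coeff m) ≤ 1 := by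
    intro m
    rw [map_mul, map_inv₀]
    by_cases hm : m ∈ P.support
    · exact inv_mul_le_one_of_le₀ (hmax m hm) zero_le
    · rw [MvPolynomial.notMem_support_iff.1 hm]; simp
  let P0 : MvPolynomial ι u.valuationSubring :=
    ∑ m ∈ P.support, MvPolynomial.monomial m ⟨c⁻¹ * P.coeff m, hle m⟩
  have hP0c : P0.map (algebraMap u.valuationSubring C) = MvPolynomial.C c⁻¹ * P := by
    conv_rhs => rw [P.as_sum]
    rw [map_sum, Finset.mul_sum]
    refine Finset.sum_congr rfl fun m _ => ?_
    rw [MvPolynomial.map_monomial, MvPolynomial.C_mul_monomial]; rfl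
  have hcoeff : P0.coeff m0 = 1 := by
    have : algebraMap u.valuationSubring C (P0.coeff m0) = 1 := by
      rw [← MvPolynomial.coeff_map, hP0c, MvPolynomial.coeff_C_mul]
      exact inv_mul_cancel₀ hc0
    exact Subtype.ext this
  have hev : MvPolynomial.aeval x P0 = 0 := by
    apply Subtype.ext
    have h1 : ((MvPolynomial.aeval x P0 : v.valuationSubring) : K) =
        MvPolynomial.aeval (fun i => (x i : K)) (P0.map (algebraMap u.valuationSubring C)) := by
      rw [MvPolynomial.aeval_map_algebraMap]
      rw [MvPolynomial.aeval_def, MvPolynomial.aeval_def]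
      have h2 := MvPolynomial.hom_eval₂ P0 (algebraMap u.valuationSubring v.valuationSubring)
        v.valuationSubring.subtype x
      refine h2.trans ?_
      congr 1
      ext r
      exact hcomp r
    rw [h1, hP0c, map_mul, hP, mul_zero]; rfl
  have hres : MvPolynomial.aeval (fun i => resMap v (x i)) (P0.map (resMap u)) = 0 := by
    have h3 := congrArg (resMap v) hev
    rw [map_zero, MvPolynomial.aeval_def, MvPolynomial.hom_eval₂] at h3
    rw [MvPolynomial.aeval_def, MvPolynomial.eval₂_map]
    exact h3
  have h4 := (algebraicIndependent_iff.1 hx) _ hres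
  have h5 := congrArg (MvPolynomial.coeff m0) h4
  rw [MvPolynomial.coeff_map, hcoeff, map_one, MvPolynomial.coeff_zero] at h5
  exact one_ne_zero h5

end Residue

section Evr
open Polynomial

/-- Evaluation of a polynomial in `d + 1` variables along a ring homomorphism. -/
noncomputable def evr {R A : Type*} [CommRing R] [CommRing A] (φ : R →+* A) {d : ℕ}
    (s : Fin d → A) (b : A) : (MvPolynomial (Fin d) R)[X] →+* A :=
  eval₂RingHom (MvPolynomial.eval₂Hom φ s) b

theorem map_evr {R A B : Type*} [CommRing R] [CommRing A] [CommRing B] (φ : R →+* A) (f : A →+* B)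
    {d : ℕ} (s : Fin d → A) (b : A) (P : (MvPolynomial (Fin d) R)[X]) :
    f (evr φ s b P) = evr (f.comp φ) (fun i => f (s i)) (f b) P := by
  have : f.comp (evr φ s b) = evr (f.comp φ) (fun i => f (s i)) (f b) := by
    ext <;> simp [evr]
  exact congrArg (fun h => h P) this

theorem evr_eq_eval {R A : Type*} [CommRing R] [CommRing A] (φ : R →+* A) {d : ℕ}
    (s : Fin d → A) (b : A) (P : (MvPolynomial (Fin d) R)[X]) :
    evr φ s b P = (P.map (MvPolynomial.eval₂Hom φ s)).eval b := by
  rw [eval_map]; rfl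

theorem ev_map_eq_evr {R C L : Type*} [CommRing R] [Field C] [Field L] [Algebra C L]
    (φ : R →+* C) {d : ℕ} (s : Fin d → L) (b : L) (P : (MvPolynomial (Fin d) R)[X]) :
    ev s b (P.map (MvPolynomial.map φ)) = evr ((algebraMap C L).comp φ) s b P := by
  have : (ev s b).toRingHom.comp (mapRingHom (MvPolynomial.map φ)) =
      evr ((algebraMap C L).comp φ) s b := by
    ext <;> simp [evr, ev_X, ev_C]
  exact congrArg (fun h => h P) this

end Evr

section Newton
open Polynomial

/-- Approximate solutions in a henselian valuation ring can be corrected. -/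
theorem exists_root_of_approx {L : Type*} [Field L] {Γ : Type*} [LinearOrderedCommGroupWithZero Γ]
    {w : Valuation L Γ} (hw : IsHenselian w) {R : Type*} [CommRing R]
    (φ : R →+* w.valuationSubring) {d : ℕ} (G H : (MvPolynomial (Fin d) R)[X])
    (s : Fin d → w.valuationSubring) (b z z' ϖ : w.valuationSubring) (hϖ : w (ϖ : L) < 1)
    (hϖ0 : ϖ ≠ 0) {e N : ℕ} (hN : 2 * e < N) (h0 : ϖ ^ N ∣ evr φ s b G)
    (h1 : ϖ ^ N ∣ evr φ s b (derivative G) * z - ϖ ^ e)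
    (h2 : ϖ ^ N ∣ evr φ s b H * z' - ϖ ^ e) :
    ∃ b' : w.valuationSubring, evr φ s b' G = 0 ∧ evr φ s b' H ≠ 0 := by
  have hϖ1 : 0 < w (ϖ : L) := by
    rw [zero_lt_iff, Valuation.ne_zero_iff]
    exact fun h => hϖ0 (Subtype.ext h)
  have key : ∀ x y : w.valuationSubring, ϖ ^ N ∣ x * y - ϖ ^ e → x ∣ ϖ ^ e := by
    intro x y h
    obtain ⟨t, ht⟩ := h
    have hunit : IsUnit (1 + ϖ ^ (N - e) * t) := by
      have h3 : ϖ ^ (N - e) * t ∈ IsLocalRing.maximalIdeal w.valuationSubring := by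
        refine Ideal.mul_mem_right _ _ ?_
        refine Ideal.pow_mem_of_mem _ ?_ _ (by omega)
        exact (mem_maximalIdeal_iff w _).2 hϖ
      by_contra h4
      have h5 : 1 + ϖ ^ (N - e) * t ∈ IsLocalRing.maximalIdeal w.valuationSubring := h4
      have h6 := Ideal.sub_mem _ h5 h3
      rw [add_sub_cancel_right] at h6
      exact (Ideal.ne_top_iff_one _).1 (IsLocalRing.maximalIdeal.isMaximal _).ne_top h6
    have h7 : x * y = ϖ ^ e * (1 + ϖ ^ (N - e) * t) := by
      have : N = e + (N - e) := by omega
      rw [mul_add, mul_one, ← mul_assoc, ← pow_add, ← this, ← ht]; ring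
    exact hunit.dvd_mul_right.1 (h7 ▸ dvd_mul_right x y)
  set f0 : w.valuationSubring[X] := G.map (MvPolynomial.eval₂Hom φ s) with hf0
  let ι := w.valuationSubring.subtype
  let f : L[X] := f0.map ι
  have hfe : ∀ c : w.valuationSubring, f.eval (c : L) = (evr φ s c G : w.valuationSubring) := by
    intro c
    rw [evr_eq_eval]
    exact eval_map_apply (f := ι) c
  have hfd : f.derivative.eval (b : L) = (evr φ s b (derivative G) : w.valuationSubring) := by
    rw [evr_eq_eval, ← derivative_map, derivative_map f0 ι]
    exact eval_map_apply (f := ι) b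
  have hd1 : w (ϖ : L) ^ e ≤ w (f.derivative.eval (b : L)) := by
    rw [hfd, ← map_pow, ← SubmonoidClass.coe_pow, ← valuationSubring_dvd_iff]
    exact key _ _ h1
  have hd0 : w (f.eval (b : L)) ≤ w (ϖ : L) ^ N := by
    rw [hfe, ← map_pow, ← SubmonoidClass.coe_pow, ← valuationSubring_dvd_iff]
    exact h0
  have hlt : w (ϖ : L) ^ N < (w (ϖ : L) ^ e) ^ 2 := by
    rw [← pow_mul]
    exact pow_lt_pow_right_of_lt_one₀ hϖ1 hϖ (by omega)
  obtain ⟨b', hb', hbb⟩ := hensel_newton_integral w hw f b (fun i => by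
      rw [coeff_map]; exact (f0.coeff i).2) b.2
    (hd0.trans_lt (hlt.trans_le (pow_le_pow_left₀ zero_le hd1 2)))
  have hdiff : w (b' - b) * w (ϖ : L) ^ e ≤ w (ϖ : L) ^ N :=
    (mul_le_mul_right hd1 _).trans (hbb.trans hd0)
  have hdiff' : w (b' - b) < w (ϖ : L) ^ e := by
    by_contra! hle
    have := (mul_le_mul_left hle (w (ϖ : L) ^ e)).trans hdiff
    rw [← sq] at this
    exact absurd this (not_le.2 hlt)
  have hb'1 : w b' ≤ 1 := by
    have : b' = (b' - b) + b := by ring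
    rw [this]
    refine w.map_add_le (hdiff'.le.trans (pow_le_one₀ zero_le hϖ.le)) b.2
  refine ⟨⟨b', hb'1⟩, ?_, fun hH => ?_⟩
  · exact Subtype.ext ((hfe ⟨b', hb'1⟩).symm.trans hb')
  · have h8 : (⟨b', hb'1⟩ - b : w.valuationSubring) ∣ evr φ s ⟨b', hb'1⟩ H - evr φ s b H := by
      rw [evr_eq_eval, evr_eq_eval]
      exact sub_dvd_eval_sub _ _ _
    rw [hH, zero_sub, dvd_neg] at h8
    have h9 := h8.trans (key _ _ h2)
    rw [valuationSubring_dvd_iff, SubmonoidClass.coe_pow, map_pow] at h9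
    exact absurd (h9.trans_lt hdiff') (lt_irrefl _)

end Newton

section Transfer
open Polynomial IsLocalRing

theorem flat_valuationSubring {C K : Type*} [Field C] [Field K] [Algebra C K] {Γ₀ Γ : Type*}
    [LinearOrderedCommGroupWithZero Γ₀] [LinearOrderedCommGroupWithZero Γ] {u : Valuation C Γ₀}
    {v : Valuation K Γ} [Algebra u.valuationSubring v.valuationSubring]
    (hinj : Function.Injective (algebraMap u.valuationSubring v.valuationSubring)) :
    Module.Flat u.valuationSubring v.valuationSubring := by
  rw [Module.Flat.flat_iff_torsion_eq_bot_of_isBezout,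
    ← Submodule.isTorsionFree_iff_torsion_eq_bot, Module.isTorsionFree_iff_smul_eq_zero]
  intro r m h
  rw [Algebra.smul_def, mul_eq_zero] at h
  exact h.imp_left fun h => hinj (h.trans (map_zero _).symm)

/-- An approximate solution in `L` of the equations satisfied by integral elements of `K`. -/
theorem exists_solution_transfer {n : ℕ} {C : Type u} [Field C] {u : Valuation C Zm0} {π : C}
    (hπu : IsUniformizer u π) {K : Type u} [Field K] [Algebra C K] {ΓK : Type u}
    [LinearOrderedCommGroupWithZero ΓK] {v : Valuation K ΓK}
    (hKC : (v.comap (algebraMap C K)).IsEquiv u) (hπv : IsUniformizer v (algebraMap C K π))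
    {L : Type u} [Field L] [Algebra C L] {ΓL : Type u} [LinearOrderedCommGroupWithZero ΓL]
    {w : Valuation L ΓL} (hLC : (w.comap (algebraMap C L)).IsEquiv u) (hL : IsHenselian w)
    (hπw : IsUniformizer w (algebraMap C L π)) {gK : ResF u →+* ResF v} (hgK : ResCompat u v gK)
    (hsepK : IsSepExtHom gK) {gL : ResF u →+* ResF w} (hgL : ResCompat u w gL)
    (hres : ThRingSub (fun {_} φ => IsExistsNE1 n φ) (ResF v) gK (ResF w) gL)
    {d : ℕ} (hd : d ≤ n) (G H : (MvPolynomial (Fin d) u.valuationSubring)[X])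
    (s : Fin d → v.valuationSubring) (b : v.valuationSubring) (e : ℕ)
    (h0 : evr (valHom hKC) s b G = 0)
    (h1 : evr (valHom hKC) s b (derivative G) ∣ valHom hKC ⟨π, hπu.le_one⟩ ^ e)
    (h2 : evr (valHom hKC) s b H ∣ valHom hKC ⟨π, hπu.le_one⟩ ^ e) :
    ∃ (s' : Fin d → w.valuationSubring) (b' : w.valuationSubring),
      evr (valHom hLC) s' b' G = 0 ∧ evr (valHom hLC) s' b' H ≠ 0 := by
  let R := u.valuationSubring
  let V := v.valuationSubring
  let T := w.valuationSubring
  let ϖ : R := ⟨π, hπu.le_one⟩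
  let E := IntermediateField.adjoin C (insert (b : K) (Set.range fun i => (s i : K)))
  let vE : Valuation E ΓK := v.comap (algebraMap E K)
  have hE : (vE.comap (algebraMap C E)).IsEquiv u := fun x y => hKC x y
  have hEK : (v.comap (algebraMap E K)).IsEquiv vE := fun x y => Iff.rfl
  have hπE : IsUniformizer vE (algebraMap C E π) :=
    ⟨hπv.1, hπv.2.1, fun x hx => hπv.2.2 x hx⟩
  let S := vE.valuationSubring
  let _ : Algebra R S := (valHom hE).toAlgebra
  let _ : Algebra R V := (valHom hKC).toAlgebra
  let _ : Algebra R T := (valHom hLC).toAlgebra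
  let _ : Algebra S V := (valHom hEK).toAlgebra
  have _ : IsLocalHom (algebraMap R S) := isLocalHom_valHom hE
  have _ : IsLocalHom (algebraMap R V) := isLocalHom_valHom hKC
  have _ : IsLocalHom (algebraMap R T) := isLocalHom_valHom hLC
  have _ : IsLocalHom (algebraMap S V) := isLocalHom_valHom hEK
  have hsepV : Sep (ResF u) (ResF v) := sep_residueField hKC hgK hsepK rfl
  let i0 : ResF vE →+* ResF v := ResidueField.map (algebraMap S V)
  let i : ResF vE →ₐ[ResF u] ResF v :=
    { i0 with
      commutes' := fun r => by
        obtain ⟨r, rfl⟩ := residue_surjective r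
        exact ResidueField.map_residue (algebraMap S V) _ }
  have hsepE : Sep (ResF u) (ResF vE) := hsepV.of_algHom i
  have hsm : Algebra.FormallySmooth (ResF u) (ResF vE) := hsepE.formallySmooth
  have hflat : Module.Flat R S := by
    refine flat_valuationSubring fun x y hxy => ?_
    exact Subtype.ext ((algebraMap C E).injective (congrArg Subtype.val hxy))
  have hgK' : gK = algebraMap (ResF u) (ResF v) := by
    refine RingHom.ext fun r => ?_
    obtain ⟨r, rfl⟩ := residue_surjective r
    exact hgK r _
  have hgL' : gL = algebraMap (ResF u) (ResF w) := by
    refine RingHom.ext fun r => ?_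
    obtain ⟨r, rfl⟩ := residue_surjective r
    exact hgL r _
  have htrE : TrLE C d (IntermediateField.adjoin C
      (insert (b : K) (Set.range fun i => (s i : K))) : Set K) := by
    have hcoe : ∀ P : (MvPolynomial (Fin d) u.valuationSubring)[X],
        ev (fun i => (s i : K)) (b : K) (P.map (MvPolynomial.map u.valuationSubring.subtype)) =
          (evr (valHom hKC) s b P : V) := by
      intro P
      rw [ev_map_eq_evr]
      exact (map_evr (valHom hKC) v.valuationSubring.subtype s b P).symm
    refine trLE_of_ev _ _ (G.map (MvPolynomial.map u.valuationSubring.subtype)) ?_ ?_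
    · rw [hcoe, h0]; rfl
    · rw [derivative_map, hcoe]
      intro h3
      have h4 : evr (valHom hKC) s b (derivative G) = 0 := Subtype.ext h3
      rw [h4, zero_dvd_iff] at h1
      refine pow_ne_zero e (fun h5 => hπv.ne_zero ?_) h1
      exact congrArg Subtype.val h5
  have htr : TrLE (ResF u) n (Set.univ : Set (ResF vE)) := by
    intro x _ hx
    choose x' hx' using fun j => residue_surjective (R := S) (x j)
    have hx1 : AlgebraicIndependent (ResF u) fun j => resMap vE (x' j) := by
      rw [show (fun j => resMap vE (x' j)) = x from funext hx']
      exact hx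
    have hx2 := algebraicIndependent_of_residue (u := u) (v := vE) (fun c => rfl) x' hx1
    have hx3 : AlgebraicIndependent C fun j => ((x' j : E) : K) :=
      hx2.map' (f := E.val) E.val.injective
    have hx4 := hx3.comp (Fin.castLE (by omega : d + 1 ≤ n + 1)) (Fin.castLE_injective _)
    exact htrE _ (fun j => (x' _ : E).2) hx4
  have hhom : ∀ Z : Finset (ResF vE), Nonempty
      (Algebra.adjoin (ResF u) (Z : Set (ResF vE)) →ₐ[ResF u] ResF w) := by
    intro Z
    obtain ⟨d', hd', t, c, G', H', h3, -, h4, h5⟩ := exists_hypersurface_adjoin.{u, u, u} hsepE n Z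
      (htr.mono (Set.subset_univ _))
    obtain ⟨φ, hφ, -, hφ'⟩ := exists_sentence.{u} hd' G' H'
    have h6 : RealizeRing (ResF v) gK φ := by
      rw [hgK', hφ']
      refine ⟨fun j => i (t j), i c, ?_, ?_⟩
      · rw [map_ev, h3, map_zero]
      · rw [map_ev]
        exact fun h => h4 ((map_eq_zero_iff i i.toRingHom.injective).1 h)
    have h7 := hres φ (.base hφ) h6
    rw [hgL', hφ'] at h7
    obtain ⟨t', c', h8, h9⟩ := h7
    exact h5 _ t' c' h8 h9
  obtain ⟨g, hg⟩ := exists_ringHom_germ_quotient (R := R) (S := S) (T := T) (ϖ := ϖ)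
    hπu.maximalIdeal_eq hπE.maximalIdeal_eq hπw.maximalIdeal_eq hhom (2 * e + 1)
  let N := 2 ^ (2 * e + 1)
  have hN : 2 * e < N := (Nat.lt_succ_self _).trans Nat.lt_two_pow_self
  let ι := Finset (ResF vE)
  let l : Filter ι := Filter.atTop
  let Q := T ⧸ Ideal.span {algebraMap R T ϖ ^ N}
  let mkQ : T →+* Q := Ideal.Quotient.mk _
  let ψ : (ι → T) →+* Filter.Germ l Q :=
    (Filter.Germ.coeRingHom l).comp (RingHom.pi fun j => mkQ.comp (Pi.evalRingHom _ j))
  have hψ : Function.Surjective ψ := by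
    intro y
    induction y using Filter.Germ.inductionOn with
    | _ y =>
      choose z hz using fun j => Ideal.Quotient.mk_surjective (y j)
      exact ⟨z, congrArg (Filter.Germ.ofFun (l := l)) (funext hz)⟩
  have hψ0 : ∀ x, ψ x = 0 → ∀ᶠ j in l, algebraMap R T ϖ ^ N ∣ x j := by
    intro x hx
    have hx' : ∀ᶠ j in l, mkQ (x j) = 0 := Filter.Germ.coe_eq.1 hx
    filter_upwards [hx'] with j hj
    exact Ideal.mem_span_singleton.1 (Ideal.Quotient.eq_zero_iff_mem.1 hj)
  let φ : R →+* (ι → T) := (Pi.constRingHom ι T).comp (algebraMap R T)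
  have hφ : ψ.comp φ = g.comp (algebraMap R S) := RingHom.ext fun r => (hg r).symm
  have hsE : ∀ j, (s j : K) ∈ E := fun j =>
    IntermediateField.subset_adjoin C _ (Set.mem_insert_of_mem _ ⟨j, rfl⟩)
  have hbE : (b : K) ∈ E := IntermediateField.subset_adjoin C _ (Set.mem_insert _ _)
  let sS : Fin d → S := fun j => ⟨⟨s j, hsE j⟩, (s j).2⟩
  let bS : S := ⟨⟨b, hbE⟩, b.2⟩
  have hinj : Function.Injective (algebraMap S V) := fun x y hxy =>
    Subtype.ext (Subtype.ext (congrArg (fun z : V => (z : K)) hxy))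
  have hSV : ∀ P, algebraMap S V (evr (algebraMap R S) sS bS P) = evr (valHom hKC) s b P :=
    fun P => map_evr (algebraMap R S) (algebraMap S V) sS bS P
  have hdvd : ∀ x : S, algebraMap S V x ∣ algebraMap R V ϖ ^ e → x ∣ algebraMap R S ϖ ^ e := by
    intro x hx
    rw [valuationSubring_dvd_iff] at hx ⊢
    exact hx
  have e0 : evr (algebraMap R S) sS bS G = 0 := hinj (by rw [hSV, h0, map_zero])
  obtain ⟨z, hz⟩ := hdvd (evr (algebraMap R S) sS bS (derivative G)) (by rw [hSV]; exact h1)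
  obtain ⟨z', hz'⟩ := hdvd (evr (algebraMap R S) sS bS H) (by rw [hSV]; exact h2)
  choose sA hsA using fun j => hψ (g (sS j))
  obtain ⟨bA, hbA⟩ := hψ (g bS)
  obtain ⟨zA, hzA⟩ := hψ (g z)
  obtain ⟨zA', hzA'⟩ := hψ (g z')
  have hψe : ∀ P, ψ (evr φ sA bA P) = g (evr (algebraMap R S) sS bS P) := by
    intro P
    rw [map_evr, map_evr, hφ, hbA]
    simp only [hsA]
  have hψπ : ψ (φ ϖ) = g (algebraMap R S ϖ) := congrArg (fun f => f ϖ) hφ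
  have f0 := hψ0 (evr φ sA bA G) (by rw [hψe, e0, map_zero])
  have f1 := hψ0 (evr φ sA bA (derivative G) * zA - φ ϖ ^ e) (by
    rw [map_sub, map_mul, map_pow, hψe, hzA, hψπ]
    exact sub_eq_zero.2 ((map_mul g _ _).symm.trans ((congrArg g hz.symm).trans (map_pow g _ _))))
  have f2 := hψ0 (evr φ sA bA H * zA' - φ ϖ ^ e) (by
    rw [map_sub, map_mul, map_pow, hψe, hzA', hψπ]
    exact sub_eq_zero.2 ((map_mul g _ _).symm.trans ((congrArg g hz'.symm).trans (map_pow g _ _))))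
  obtain ⟨j, ⟨g0, g1⟩, g2⟩ := ((f0.and f1).and f2).exists
  have hj : ∀ P, evr φ sA bA P j = evr (algebraMap R T) (fun k => sA k j) (bA j) P :=
    fun P => map_evr φ (Pi.evalRingHom _ j) sA bA P
  rw [hj] at g0
  rw [Pi.sub_apply, Pi.mul_apply, hj] at g1 g2
  obtain ⟨b', hb', hb''⟩ := exists_root_of_approx hL (algebraMap R T) G H (fun k => sA k j) (bA j)
    (zA j) (zA' j) (algebraMap R T ϖ) hπw.2.1
    (fun h => hπw.ne_zero (congrArg Subtype.val h)) hN g0 g1 g2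
  exact ⟨fun k => sA k j, b', hb', hb''⟩

end Transfer

section Ultrapower
open Filter Polynomial

/-- `(M, vM)` is the countable ultrapower of `(K, v)` along the hyperfilter on `ℕ`. -/
structure IsUltrapower {K M : Type*} [Field K] [Field M] {Γ Γ' : Type*}
    [LinearOrderedCommGroupWithZero Γ] [LinearOrderedCommGroupWithZero Γ'] (v : Valuation K Γ)
    (vM : Valuation M Γ') (mk : (ℕ → K) →+* M) : Prop where
  surjective : Function.Surjective mk
  le_iff : ∀ a b, vM (mk a) ≤ vM (mk b) ↔
    ∀ᶠ i in (hyperfilter ℕ : Filter ℕ), v (a i) ≤ v (b i)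

theorem exists_isUltrapower {K : Type u} [Field K] {Γ : Type u} [LinearOrderedCommGroupWithZero Γ]
    (v : Valuation K Γ) : ∃ (M : Type u) (_ : Field M) (Γ' : Type u)
      (_ : LinearOrderedCommGroupWithZero Γ') (vM : Valuation M Γ') (mk : (ℕ → K) →+* M),
      IsUltrapower v vM mk := by
  let l : Filter ℕ := (hyperfilter ℕ : Filter ℕ)
  let M := l.Germ K
  let mk : (ℕ → K) →+* M := Germ.coeRingHom l
  have hmk : Function.Surjective mk := fun y => by
    induction y using Germ.inductionOn with
    | _ y => exact ⟨y, rfl⟩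
  let A : Subring M := (Subring.mk' {a : ℕ → K | ∀ᶠ i in l, v (a i) ≤ 1}
    (Submonoid.mk ⟨{a : ℕ → K | ∀ᶠ i in l, v (a i) ≤ 1}, fun {a b} ha hb => by
      filter_upwards [ha, hb] with i ha hb
      exact (map_mul v _ _).trans_le (mul_le_one' ha hb)⟩ (by simp))
    (AddSubgroup.mk ⟨⟨{a : ℕ → K | ∀ᶠ i in l, v (a i) ≤ 1}, fun {a b} ha hb => by
      filter_upwards [ha, hb] with i ha hb
      exact v.map_add_le ha hb⟩, by simp⟩ fun {a} ha => by
      filter_upwards [ha] with i ha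
      simpa using ha) rfl rfl).map mk
  have hA : ∀ a, mk a ∈ A ↔ ∀ᶠ i in l, v (a i) ≤ 1 := by
    intro a
    constructor
    · rintro ⟨b, hb, hab⟩
      have hab' : ∀ᶠ i in l, b i = a i := Germ.coe_eq.1 hab
      filter_upwards [hab', show ∀ᶠ i in l, v (b i) ≤ 1 from hb] with i h1 h2
      rwa [← h1]
    · exact fun ha => ⟨a, ha, rfl⟩
  let O : ValuationSubring M :=
    { A with
      mem_or_inv_mem' := fun x => by
        obtain ⟨a, rfl⟩ := hmk x
        have : (∀ᶠ i in l, v (a i) ≤ 1) ∨ ∀ᶠ i in l, v (a i)⁻¹ ≤ 1 := by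
          refine Ultrafilter.eventually_or.1 (Eventually.of_forall fun i => ?_)
          have h1 := v.valuationSubring.mem_or_inv_mem (a i)
          rwa [v.mem_valuationSubring_iff, v.mem_valuationSubring_iff] at h1
        refine this.imp (hA a).2 fun h => ?_
        refine (hA (fun i => (a i)⁻¹)).2 ?_
        exact h }
  have hO : ∀ a, O.valuation (mk a) ≤ 1 ↔ ∀ᶠ i in l, v (a i) ≤ 1 := fun a =>
    (O.valuation_le_one_iff _).trans (hA a)
  have h0 : ∀ a, mk a = 0 ↔ ∀ᶠ i in l, a i = 0 := fun a => Germ.coe_eq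
  refine ⟨M, inferInstance, O.ValueGroup, inferInstance, O.valuation, mk, hmk, fun a b => ?_⟩
  by_cases hb : mk b = 0
  · have hb' := (h0 b).1 hb
    rw [hb, map_zero, le_zero_iff, Valuation.zero_iff, h0]
    refine eventually_congr ?_
    filter_upwards [hb'] with i hi
    rw [hi, map_zero, le_zero_iff, Valuation.zero_iff]
  · have hb' : ∀ᶠ i in l, b i ≠ 0 := Ultrafilter.eventually_not.2 fun h => hb ((h0 b).2 h)
    have h1 : mk (fun i => a i / b i) * mk b = mk a := by
      rw [← map_mul]
      refine Germ.coe_eq.2 ?_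
      filter_upwards [hb'] with i hi
      exact div_mul_cancel₀ _ hi
    rw [← h1, map_mul, mul_le_iff_le_one_left (zero_lt_iff.2 (by simpa using hb)), hO]
    refine eventually_congr ?_
    filter_upwards [hb'] with i hi
    rw [map_div₀, div_le_one₀ (zero_lt_iff.2 (by simpa using hi))]

namespace IsUltrapower
variable {K M : Type*} [Field K] [Field M] {Γ Γ' : Type*}
    [LinearOrderedCommGroupWithZero Γ] [LinearOrderedCommGroupWithZero Γ'] {v : Valuation K Γ}
    {vM : Valuation M Γ'} {mk : (ℕ → K) →+* M}

theorem lt_iff (h : IsUltrapower v vM mk) (a b : ℕ → K) : vM (mk a) < vM (mk b) ↔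
    ∀ᶠ i in (hyperfilter ℕ : Filter ℕ), v (a i) < v (b i) := by
  rw [← not_le, h.le_iff, ← Ultrafilter.eventually_not]
  simp only [not_le]

theorem eq_zero_iff (h : IsUltrapower v vM mk) (a : ℕ → K) : mk a = 0 ↔
    ∀ᶠ i in (hyperfilter ℕ : Filter ℕ), a i = 0 := by
  have h1 := h.le_iff a 0
  rw [map_zero, map_zero, le_zero_iff, Valuation.zero_iff] at h1
  simpa using h1

theorem le_one_iff (h : IsUltrapower v vM mk) (a : ℕ → K) : vM (mk a) ≤ 1 ↔
    ∀ᶠ i in (hyperfilter ℕ : Filter ℕ), v (a i) ≤ 1 := by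
  have h1 := h.le_iff a 1
  rw [map_one, map_one] at h1
  simpa using h1

theorem lt_one_iff (h : IsUltrapower v vM mk) (a : ℕ → K) : vM (mk a) < 1 ↔
    ∀ᶠ i in (hyperfilter ℕ : Filter ℕ), v (a i) < 1 := by
  have h1 := h.lt_iff a 1
  rw [map_one, map_one] at h1
  simpa using h1

/-- The diagonal embedding. -/
abbrev diag (_ : IsUltrapower v vM mk) : K →+* M := mk.comp (Pi.constRingHom ℕ K)

theorem le_diag (h : IsUltrapower v vM mk) (a b : K) :
    vM (h.diag a) ≤ vM (h.diag b) ↔ v a ≤ v b :=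
  (h.le_iff _ _).trans (eventually_const (f := (hyperfilter ℕ : Filter ℕ)) (p := v a ≤ v b))

theorem isUniformizer (h : IsUltrapower v vM mk) {π : K} (hπ : IsUniformizer v π) :
    IsUniformizer vM (h.diag π) := by
  refine ⟨?_, ?_, fun x hx => ?_⟩
  · rw [zero_lt_iff, Valuation.ne_zero_iff, _root_.map_ne_zero]
    exact hπ.ne_zero
  · exact (h.lt_one_iff _).2 (Eventually.of_forall fun _ => hπ.2.1)
  · obtain ⟨a, rfl⟩ := h.surjective x
    refine (h.le_iff _ _).2 ?_
    filter_upwards [(h.lt_one_iff _).1 hx] with i hi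
    exact hπ.2.2 _ hi

theorem isHenselian (h : IsUltrapower v vM mk) (hv : IsHenselian v) : IsHenselian vM := by
  refine HenselianLocalRing.mk fun f _ a₀ h0 h1 => ?_
  obtain ⟨F, hF⟩ := Polynomial.map_surjective mk h.surjective
    (f.map vM.valuationSubring.subtype)
  obtain ⟨a, ha⟩ := h.surjective (a₀ : M)
  have heval : ∀ (P : vM.valuationSubring[X]) (Q : (ℕ → K)[X]),
      Q.map mk = P.map vM.valuationSubring.subtype → ∀ (x : vM.valuationSubring) (y : ℕ → K),
      mk y = x → ((P.eval x : vM.valuationSubring) : M) =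
        mk fun i => (Q.map (Pi.evalRingHom (fun _ => K) i)).eval (y i) := by
    intro P Q hPQ x y hxy
    have e1 : ((P.eval x : vM.valuationSubring) : M) =
        (P.map vM.valuationSubring.subtype).eval (x : M) :=
      (Polynomial.eval_map_apply vM.valuationSubring.subtype x).symm
    have e2 : (fun i => (Q.map (Pi.evalRingHom (fun _ => K) i)).eval (y i)) = Q.eval y :=
      funext fun i => Polynomial.eval_map_apply (Pi.evalRingHom (fun _ => K) i) y
    rw [e1, e2, ← hPQ, ← hxy, Polynomial.eval_map_apply]
  have hFd : (derivative F).map mk = (derivative f).map vM.valuationSubring.subtype := by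
    rw [← derivative_map, hF, derivative_map]
  rw [mem_maximalIdeal_iff, heval f F hF a₀ a ha, h.lt_one_iff] at h0
  have h1' : vM ((derivative f).eval a₀ : vM.valuationSubring) = 1 :=
    le_antisymm ((derivative f).eval a₀).2 (not_lt.1 fun hlt =>
      IsLocalRing.notMem_maximalIdeal.2 h1 ((mem_maximalIdeal_iff vM _).2 hlt))
  rw [heval _ _ hFd a₀ a ha] at h1'
  have h2 : ∀ᶠ i in (hyperfilter ℕ : Filter ℕ), 1 ≤ v (((derivative F).map
      (Pi.evalRingHom (fun _ => K) i)).eval (a i)) := by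
    have := (h.le_iff 1 _).1 ((map_one mk).symm ▸ (map_one vM).symm ▸ h1'.ge)
    simpa using this
  have h3 : ∀ᶠ i in (hyperfilter ℕ : Filter ℕ), ∀ k, v ((F.coeff k) i) ≤ 1 := by
    have : ∀ᶠ i in (hyperfilter ℕ : Filter ℕ), ∀ k ∈ F.support, v ((F.coeff k) i) ≤ 1 := by
      rw [Finset.eventually_all]
      intro k _
      rw [← h.le_one_iff, ← coeff_map, hF, coeff_map]
      exact (f.coeff k).2
    filter_upwards [this] with i hi k
    by_cases hk : k ∈ F.support
    · exact hi k hk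
    · rw [notMem_support_iff.1 hk]; simp
  have h4 : ∀ᶠ i in (hyperfilter ℕ : Filter ℕ), v (a i) ≤ 1 := by
    rw [← h.le_one_iff, ha]
    exact a₀.2
  have h5 : ∀ᶠ i in (hyperfilter ℕ : Filter ℕ), ∃ b,
      (F.map (Pi.evalRingHom (fun _ => K) i)).eval b = 0 ∧ v (b - a i) < 1 := by
    filter_upwards [h0, h2, h3, h4] with i h0 h2 h3 h4
    obtain ⟨b, hb, hb'⟩ := hensel_newton_integral v hv (F.map (Pi.evalRingHom (fun _ => K) i)) (a i)
      (fun k => by rw [coeff_map]; exact h3 k) h4 (h0.trans_le (by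
        rw [derivative_map]; exact one_le_pow₀ h2))
    refine ⟨b, hb, ?_⟩
    rw [derivative_map] at hb'
    exact ((le_mul_of_one_le_right' h2).trans hb').trans_lt h0
  choose! b hb using fun i (hi : ∃ b, (F.map (Pi.evalRingHom (fun _ => K) i)).eval b = 0 ∧
    v (b - a i) < 1) => hi
  have hb1 : vM (mk b - a₀) < 1 := by
    rw [← ha, ← map_sub, h.lt_one_iff]
    filter_upwards [h5] with i hi
    exact (hb i hi).2
  have hb2 : vM (mk b) ≤ 1 := by
    have := vM.map_add_le hb1.le a₀.2
    rwa [sub_add_cancel] at this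
  refine ⟨⟨mk b, hb2⟩, Subtype.ext ?_, ?_⟩
  · rw [heval f F hF ⟨mk b, hb2⟩ b rfl]
    refine (h.eq_zero_iff _).2 ?_
    filter_upwards [h5] with i hi
    exact (hb i hi).1
  · rw [mem_maximalIdeal_iff]
    exact hb1

/-- Countable saturation for valuation inequalities between polynomials. -/
theorem saturated (h : IsUltrapower v vM mk) (P Q : ℕ → MvPolynomial ℕ M)
    (hPQ : ∀ n, ∃ x : ℕ → M, ∀ k < n,
      vM (MvPolynomial.eval x (P k)) ≤ vM (MvPolynomial.eval x (Q k))) :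
    ∃ x : ℕ → M, ∀ k, vM (MvPolynomial.eval x (P k)) ≤ vM (MvPolynomial.eval x (Q k)) := by
  classical
  choose p hp using fun k => MvPolynomial.map_surjective mk h.surjective (P k)
  choose q hq using fun k => MvPolynomial.map_surjective mk h.surjective (Q k)
  choose x hx using hPQ
  choose ξ hξ using fun n j => h.surjective (x n j)
  let e : ℕ → (ℕ → ℕ → K) → MvPolynomial ℕ (ℕ → K) → K := fun i y r =>
    MvPolynomial.eval (fun j => y j i) (MvPolynomial.map (Pi.evalRingHom (fun _ => K) i) r)
  have he : ∀ (y : ℕ → ℕ → K) (r : MvPolynomial ℕ (ℕ → K)),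
      MvPolynomial.eval (fun j => mk (y j)) (MvPolynomial.map mk r) = mk fun i => e i y r := by
    intro y r
    have : (fun i => e i y r) = MvPolynomial.eval y r := by
      funext i
      change MvPolynomial.eval _ (MvPolynomial.map _ r) = _
      rw [MvPolynomial.eval_map]
      exact (MvPolynomial.eval₂_comp_left (Pi.evalRingHom (fun _ => K) i) (RingHom.id _) y r).symm
    rw [this, MvPolynomial.eval_map]
    exact (MvPolynomial.eval₂_comp_left mk (RingHom.id _) y r).symm
  let A : ℕ → ℕ → Prop := fun n i => ∀ k < n, v (e i (ξ n) (p k)) ≤ v (e i (ξ n) (q k))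
  have hA : ∀ n, ∀ᶠ i in (hyperfilter ℕ : Filter ℕ), A n i := by
    intro n
    have : ∀ᶠ i in (hyperfilter ℕ : Filter ℕ), ∀ k ∈ Finset.range n,
        v (e i (ξ n) (p k)) ≤ v (e i (ξ n) (q k)) := by
      rw [Finset.eventually_all]
      intro k hk
      rw [← h.le_iff, ← he, ← he, hp, hq, funext (hξ n)]
      exact hx n k (Finset.mem_range.1 hk)
    filter_upwards [this] with i hi k hk
    exact hi k (Finset.mem_range.2 hk)
  let N : ℕ → ℕ := fun i => Nat.findGreatest (fun n => A n i) i
  have hN : ∀ i, A (N i) i := fun i =>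
    Nat.findGreatest_spec (P := fun n => A n i) (Nat.zero_le i) fun k hk => absurd hk (by simp)
  refine ⟨fun j => mk fun i => ξ (N i) j i, fun k => ?_⟩
  rw [← hp, ← hq, he, he, h.le_iff]
  filter_upwards [hA (k + 1), Nat.hyperfilter_le_atTop (eventually_ge_atTop (k + 1))] with i hi hk
  exact hN i k (Nat.le_findGreatest hk hi)

end IsUltrapower
end Ultrapower

section SepClosure

theorem exists_finsupp_of_mem_adjoin_pow {D E R : Type*} [Field D] [Field E] [Field R]
    [Algebra D R] [Algebra E R] (p : ℕ) {t : R}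
    (ht : t ∈ Algebra.adjoin D (Set.range fun y : E => algebraMap E R y ^ p)) :
    ∃ c : E →₀ D, t = c.sum fun z a => algebraMap D R a * algebraMap E R z ^ p := by
  have h1 : (Submonoid.closure (Set.range fun y : E => algebraMap E R y ^ p) : Set R) =
      Set.range fun y : E => algebraMap E R y ^ p := by
    have := Submonoid.closure_eq (MonoidHom.mrange
        ((powMonoidHom p).comp (algebraMap E R : E →* R)))
    exact congrArg SetLike.coe this
  rw [← Subalgebra.mem_toSubmodule, Algebra.adjoin_eq_span, h1,
    Finsupp.mem_span_range_iff_exists_finsupp] at ht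
  obtain ⟨c, rfl⟩ := ht
  exact ⟨c, Finsupp.sum_congr fun z _ => Algebra.smul_def _ _⟩

theorem sep_of_span {D E R : Type*} [Field D] [Field E] [Field R] [Algebra D E] [Algebra E R]
    [Algebra D R] [IsScalarTower D E R] (p : ℕ) (hp : p.Prime) [CharP D p] {q : ℕ}
    (h : Fin q → E)
    (hspan : ∀ r : E, ∃ t : Fin q → R,
      (∀ k, t k ∈ Algebra.adjoin D (Set.range fun y : E => algebraMap E R y ^ p)) ∧
      algebraMap E R r = ∑ k, algebraMap E R (h k) * t k)
    (hind : ∀ (m : ℕ) (g : Fin m → D), FrobIndep (R := R) p g → ∀ y : Fin q → Fin m → R,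
      ∑ k, ∑ j, algebraMap E R (h k) * (algebraMap D R (g j) * y k j ^ p) = 0 → ∀ k j, y k j = 0)
    (hsep : Sep D R) : Sep E R := by
  classical
  intro p' hp' hp'c m e he y hy
  have hpc : CharP E p := charP_of_injective_algebraMap (algebraMap D E).injective p
  have : CharP R p := charP_of_injective_algebraMap (algebraMap D R).injective p
  obtain rfl : p' = p := CharP.eq E hp'c hpc
  have : Fact p'.Prime := ⟨hp⟩
  choose t ht he' using fun i => hspan (e i)
  choose c hc using fun i k => exists_finsupp_of_mem_adjoin_pow p' (ht i k)
  let S : Finset E := Finset.univ.biUnion fun i => Finset.univ.biUnion fun k => (c i k).support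
  have hS : ∀ i k, (c i k).support ⊆ S := fun i k z hz =>
    Finset.mem_biUnion.2 ⟨i, Finset.mem_univ _, Finset.mem_biUnion.2 ⟨k, Finset.mem_univ _, hz⟩⟩
  obtain ⟨r, g, d, hg, hd⟩ := exists_frobIndep p' hp
    (fun x : Fin m × Fin q × S => c x.1 x.2.1 x.2.2)
  let a : Fin m → Fin q → Fin r → E := fun i k j =>
    ∑ z : S, algebraMap D E (d (i, k, z) j) * z
  have key : ∀ i, algebraMap E R (e i) = ∑ k, ∑ j, algebraMap E R (h k) *
      (algebraMap D R (g j) * algebraMap E R (a i k j) ^ p') := by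
    intro i
    rw [he' i]
    refine Finset.sum_congr rfl fun k _ => ?_
    rw [← Finset.mul_sum, hc i k, Finsupp.sum_of_support_subset _ (hS i k) _ (by simp),
      ← Finset.sum_coe_sort S]
    congr 1
    simp only [a, map_sum, map_mul, sum_pow_char, mul_pow, Finset.mul_sum]
    rw [Finset.sum_comm]
    refine Finset.sum_congr rfl fun z _ => ?_
    rw [show c i k z = _ from hd (i, k, z), map_sum, Finset.sum_mul]
    refine Finset.sum_congr rfl fun j _ => ?_
    rw [← IsScalarTower.algebraMap_apply, map_mul, map_pow]
    ring
  have key2 : ∀ y : Fin m → R, ∑ i, algebraMap E R (e i) * y i ^ p' = ∑ k, ∑ j,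
      algebraMap E R (h k) * (algebraMap D R (g j) *
        (∑ i, algebraMap E R (a i k j) * y i) ^ p') := by
    intro y
    simp only [key, sum_pow_char, Finset.mul_sum, Finset.sum_mul, mul_pow]
    rw [Finset.sum_comm]
    refine Finset.sum_congr rfl fun k _ => ?_
    rw [Finset.sum_comm]
    refine Finset.sum_congr rfl fun j _ => Finset.sum_congr rfl fun i _ => ?_
    ring
  have hker : ∀ z : Fin m → E, (∀ k j, ∑ i, a i k j * z i = 0) → ∀ i, z i = 0 := by
    intro z hz
    refine he z ?_
    apply (algebraMap E R).injective
    have := key2 fun i => algebraMap E R (z i)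
    simp only [← map_mul, ← map_sum, hz, map_zero, zero_pow hp.ne_zero, mul_zero,
      Finset.sum_const_zero] at this
    simpa using this
  rw [key2] at hy
  have hy' := hind r g (hsep p' hp inferInstance r g hg) _ hy
  intro i
  rw [← Module.forall_dual_apply_eq_zero_iff E]
  intro f
  refine hker (fun i => f (y i)) (fun k j => ?_) i
  have := congrArg f (hy' k j)
  simpa [← Algebra.smul_def] using this

theorem mem_adjoin_pow_of_generators {D R : Type*} [Field D] [Field R] [Algebra D R] (p : ℕ)
    (hp : p.Prime) (S : Set R)
    (hS : ∀ x ∈ S, x ∈ Algebra.adjoin D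
      (Set.range fun y : IntermediateField.adjoin D S => algebraMap _ R y ^ p))
    (r : IntermediateField.adjoin D S) : (r : R) ∈ Algebra.adjoin D
      (Set.range fun y : IntermediateField.adjoin D S => algebraMap _ R y ^ p) := by
  obtain ⟨r, hr⟩ := r
  induction hr using IntermediateField.adjoin_induction with
  | mem x hx => exact hS x hx
  | algebraMap x => exact Subalgebra.algebraMap_mem _ x
  | add x y hx hy h1 h2 => exact add_mem h1 h2
  | mul x y hx hy h1 h2 => exact mul_mem h1 h2
  | inv x hx h1 =>
    have : x⁻¹ = x ^ (p - 1) * x⁻¹ ^ p := by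
      by_cases h0 : x = 0
      · simp [h0, hp.ne_zero]
      · have : x ^ p = x ^ (p - 1) * x := by
          rw [← pow_succ, Nat.sub_add_cancel hp.one_le]
        rw [inv_pow, this]
        field_simp
    change x⁻¹ ∈ _
    rw [this]
    exact mul_mem (pow_mem h1 _) (Algebra.subset_adjoin ⟨⟨x⁻¹, inv_mem hx⟩, rfl⟩)

theorem sep_adjoin_of_mem_adjoin_pow {D R : Type*} [Field D] [Field R] [Algebra D R] (p : ℕ)
    (hp : p.Prime) [CharP D p] (S : Set R)
    (hS : ∀ x ∈ S, x ∈ Algebra.adjoin D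
      (Set.range fun y : IntermediateField.adjoin D S => algebraMap _ R y ^ p))
    (hsep : Sep D R) : Sep (IntermediateField.adjoin D S) R := by
  refine sep_of_span p hp (q := 1) (fun _ => 1) (fun r => ⟨fun _ => r, fun _ =>
    mem_adjoin_pow_of_generators p hp S hS r, by simp [IntermediateField.algebraMap_apply]⟩)
    (fun m g hg y hy k j => ?_) hsep
  obtain rfl : k = 0 := Subsingleton.elim _ _
  exact hg (y 0) (by simpa using hy) j

theorem sep_adjoin_of_notMem_adjoin_pow {D R : Type*} [Field D] [Field R] [Algebra D R] (p : ℕ)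
    (hp : p.Prime) [CharP D p] (x : R)
    (hx : x ∉ Algebra.adjoin D (Set.range fun y : R => y ^ p))
    (hsep : Sep D R) : Sep (IntermediateField.adjoin D {x}) R := by
  have : Fact p.Prime := ⟨hp⟩
  have : CharP R p := charP_of_injective_algebraMap (algebraMap D R).injective p
  have hxE : x ∈ IntermediateField.adjoin D {x} := IntermediateField.mem_adjoin_simple_self D x
  set E := IntermediateField.adjoin D {x} with hE
  set P := Algebra.adjoin D (Set.range fun y : E => algebraMap E R y ^ p) with hP
  have hpP : ∀ z ∈ E, z ^ p ∈ P := fun z hz => Algebra.subset_adjoin ⟨⟨z, hz⟩, rfl⟩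
  have hpoly : ∀ f : Polynomial D, ∃ t : Fin p → R, (∀ k, t k ∈ P) ∧
      Polynomial.aeval x f = ∑ k : Fin p, x ^ (k : ℕ) * t k := by
    intro f
    induction f using Polynomial.induction_on' with
    | add f g hf hg =>
      obtain ⟨t, ht, h1⟩ := hf
      obtain ⟨t', ht', h2⟩ := hg
      refine ⟨fun k => t k + t' k, fun k => add_mem (ht k) (ht' k), ?_⟩
      simp only [map_add, h1, h2, mul_add, Finset.sum_add_distrib]
    | monomial n a =>
      classical
      refine ⟨fun k => if k = ⟨n % p, Nat.mod_lt _ hp.pos⟩ then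
        algebraMap D R a * (x ^ (n / p)) ^ p else 0, fun k => ?_, ?_⟩
      · dsimp only
        split_ifs
        · exact mul_mem (Subalgebra.algebraMap_mem _ a) (hpP _ (pow_mem hxE _))
        · exact zero_mem _
      · simp only [mul_ite, mul_zero, Finset.sum_ite_eq', Finset.mem_univ, if_true,
          Polynomial.aeval_monomial]
        rw [mul_left_comm, ← pow_mul, ← pow_add, Nat.mod_add_div']
  refine sep_of_span p hp (q := p) (fun k => ⟨x, hxE⟩ ^ (k : ℕ)) (fun r => ?_)
    (fun m g hg y hy => ?_) hsep
  · obtain ⟨r, hr⟩ := r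
    obtain ⟨f, g, rfl⟩ := (IntermediateField.mem_adjoin_simple_iff D r).1 hr
    obtain ⟨t, ht, h1⟩ := hpoly (f * g ^ (p - 1))
    have hg : (Polynomial.aeval x g)⁻¹ ∈ E := by
      refine inv_mem ?_
      rw [hE]
      exact IntermediateField.algebra_adjoin_le_adjoin D {x}
        (Polynomial.aeval_mem_adjoin_singleton D x)
    refine ⟨fun k => t k * (Polynomial.aeval x g)⁻¹ ^ p, fun k => mul_mem (ht k) (hpP _ hg), ?_⟩
    simp only [map_pow, ← mul_assoc, ← Finset.sum_mul]
    change _ / _ = (∑ k : Fin p, x ^ (k : ℕ) * t k) * _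
    rw [← h1, map_mul, map_pow]
    by_cases h0 : Polynomial.aeval x g = 0
    · simp [h0, hp.ne_zero]
    · have : Polynomial.aeval x g ^ p = Polynomial.aeval x g ^ (p - 1) * Polynomial.aeval x g := by
        rw [← pow_succ, Nat.sub_add_cancel hp.one_le]
      rw [inv_pow, this]
      field_simp
  · let W : IntermediateField D R :=
      (Algebra.adjoin D (Set.range fun y : R => y ^ p)).toIntermediateField fun z hz => by
        have : z⁻¹ = z ^ (p - 1) * z⁻¹ ^ p := by
          by_cases h0 : z = 0
          · simp [h0, hp.ne_zero]
          · have : z ^ p = z ^ (p - 1) * z := by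
              rw [← pow_succ, Nat.sub_add_cancel hp.one_le]
            rw [inv_pow, this]
            field_simp
        rw [this]
        exact mul_mem (pow_mem hz _) (Algebra.subset_adjoin ⟨z⁻¹, rfl⟩)
    have hpW : ∀ z : R, z ^ p ∈ W := fun z => Algebra.subset_adjoin ⟨z, rfl⟩
    have hirr : Irreducible (Polynomial.X ^ p - Polynomial.C (⟨x ^ p, hpW x⟩ : W)) := by
      refine X_pow_sub_C_irreducible_of_prime hp fun b hb => hx ?_
      have : (b : R) ^ p = x ^ p := congrArg Subtype.val hb
      rw [← frobenius_inj R p this]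
      exact b.2
    have hmin : minpoly W x = Polynomial.X ^ p - Polynomial.C (⟨x ^ p, hpW x⟩ : W) := by
      refine (minpoly.eq_of_irreducible_of_monic hirr ?_
        (Polynomial.monic_X_pow_sub_C _ hp.ne_zero)).symm
      simp [IntermediateField.algebraMap_apply]
    have hli := linearIndependent_pow (K := W) x
    rw [hmin, Polynomial.natDegree_X_pow_sub_C, Fintype.linearIndependent_iff] at hli
    intro k j
    refine hg (y k) ?_ j
    have := hli (fun k => ⟨∑ j, algebraMap D R (g j) * y k j ^ p,
      sum_mem fun j _ => mul_mem (W.algebraMap_mem _) (hpW _)⟩) (by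
        rw [← hy]
        refine Finset.sum_congr rfl fun k _ => ?_
        rw [← Finset.mul_sum, map_pow, mul_comm]
        rfl) k
    exact congrArg Subtype.val this

/-- A proper separable extension `R/D` has a countably generated, proper subextension over which
`R` is still separable. -/
theorem exists_sep_adjoin_range {D R : Type*} [Field D] [Field R] [Algebra D R]
    (hsep : Sep D R) (hns : ¬ Function.Surjective (algebraMap D R)) :
    ∃ X : ℕ → R, Sep (IntermediateField.adjoin D (Set.range X)) R ∧
      ∃ i, X i ∉ Set.range (algebraMap D R) := by
  rw [Function.Surjective] at hns
  push Not at hns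
  obtain ⟨x, hx⟩ := hns
  have hx' : x ∉ Set.range (algebraMap D R) := fun ⟨y, hy⟩ => hx y hy
  by_cases hch : ∃ p : ℕ, p.Prime ∧ CharP D p
  · obtain ⟨p, hp, _⟩ := hch
    by_cases hA : ∃ x : R, x ∉ Algebra.adjoin D (Set.range fun y : R => y ^ p)
    · obtain ⟨x, hx⟩ := hA
      refine ⟨fun _ => x, ?_, 0, fun ⟨a, ha⟩ => hx ?_⟩
      swap
      · rw [← show _ = x from ha]
        exact Subalgebra.algebraMap_mem _ a
      rw [Set.range_const]
      exact sep_adjoin_of_notMem_adjoin_pow p hp x hx hsep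
    · push Not at hA
      choose c hc using fun r : R => exists_finsupp_of_mem_adjoin_pow (E := R) p (hA r)
      let f : List ℕ → R := fun l => l.rec x fun j _ y => (c y).support.toList.getD j 0
      obtain ⟨e, he⟩ := exists_surjective_nat (List ℕ)
      have hf : ∀ l, ∀ z ∈ (c (f l)).support, z ∈ Set.range (f ∘ e) := by
        intro l z hz
        obtain ⟨j, hj, rfl⟩ := List.getElem_of_mem (Finset.mem_toList.2 hz)
        obtain ⟨i, hi⟩ := he (j :: l)
        refine ⟨i, ?_⟩
        simp only [Function.comp_apply, hi]
        change (c (f l)).support.toList.getD j 0 = _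
        exact List.getD_eq_getElem _ _ hj
      refine ⟨f ∘ e, sep_adjoin_of_mem_adjoin_pow p hp _ ?_ hsep, ?_⟩
      · rintro _ ⟨i, rfl⟩
        rw [hc ((f ∘ e) i)]
        refine sum_mem fun z hz => mul_mem (Subalgebra.algebraMap_mem _ _)
          (Algebra.subset_adjoin ⟨⟨z, IntermediateField.subset_adjoin _ _ (hf _ z hz)⟩, rfl⟩)
      · obtain ⟨i, hi⟩ := he []
        exact ⟨i, by simpa only [Function.comp_apply, hi] using hx'⟩
  · refine ⟨fun _ => x, fun p hp hpc => ?_, 0, hx'⟩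
    refine absurd ⟨p, hp, ?_⟩ hch
    exact (RingHom.charP_iff (algebraMap D _) (algebraMap D _).injective p).2 hpc

end SepClosure

section CoefficientField
open IsLocalRing

variable {M : Type*} [Field M] (O : ValuationSubring M)

/-- A subfield of `M` contained in the valuation ring `O` over which the residue field is
separable. -/
def GoodSub (F : Subfield M) : Prop :=
  (∀ x ∈ F, x ∈ O) ∧ ∀ p : ℕ, p.Prime → CharP M p → ∀ (m : ℕ) (e : Fin m → O),
    (∀ i, (e i : M) ∈ F) →
    (∀ y : Fin m → O, (∀ i, (y i : M) ∈ F) → ∑ i, e i * y i ^ p = 0 → ∀ i, y i = 0) →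
    ∀ y : Fin m → ResidueField O, ∑ i, residue O (e i) * y i ^ p = 0 → ∀ i, y i = 0

/-- The inclusion of a subfield contained in the valuation ring. -/
def inclHom {F : Subfield M} (hF : ∀ x ∈ F, x ∈ O) : F →+* O :=
  F.subtype.codRestrict O.toSubring fun x => hF x x.2

theorem GoodSub.sep {O} {F : Subfield M} (h : GoodSub O F) [Algebra F (ResidueField O)]
    (ha : algebraMap F (ResidueField O) = (residue O).comp (inclHom O h.1)) :
    Sep F (ResidueField O) := by
  intro p hp hpc m e he y hy
  have : CharP M p := (RingHom.charP_iff F.subtype F.subtype.injective p).1 hpc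
  refine h.2 p hp this m (fun i => inclHom O h.1 (e i)) (fun i => (e i).2) (fun y hyF hy i => ?_) y
    (by rw [ha] at hy; exact hy)
  have := he (fun i => ⟨y i, hyF i⟩) (by
    have := congrArg Subtype.val hy
    apply Subtype.ext
    push_cast at this ⊢
    exact this) i
  have h1 : ((y i : O) : M) = 0 := congrArg Subtype.val this
  exact Subtype.ext h1

theorem GoodSub.sSup {O} {S : Set (Subfield M)} (hS : ∀ F ∈ S, GoodSub O F)
    (hd : DirectedOn (· ≤ ·) S) (hne : S.Nonempty) : GoodSub O (sSup S) := by
  have hmem := fun x => Subfield.mem_sSup_of_directedOn (x := x) hne hd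
  refine ⟨fun x hx => ?_, fun p hp hpc m e he hi y hy => ?_⟩
  · obtain ⟨F, hF, hxF⟩ := (hmem x).1 hx
    exact (hS F hF).1 x hxF
  · have : ∃ F ∈ S, ∀ i, (e i : M) ∈ F := by
      clear hi hy
      induction m with
      | zero => exact ⟨hne.choose, hne.choose_spec, fun i => i.elim0⟩
      | succ m ih =>
        obtain ⟨F, hF, h1⟩ := ih (fun i => e i.castSucc) (fun i => he _) (fun i => y i.castSucc)
        obtain ⟨F', hF', h2⟩ := (hmem _).1 (he (Fin.last m))
        obtain ⟨F'', hF'', h3, h4⟩ := hd F hF F' hF'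
        refine ⟨F'', hF'', fun i => ?_⟩
        induction i using Fin.lastCases with
        | last => exact h4 h2
        | cast i => exact h3 (h1 i)
    obtain ⟨F, hF, heF⟩ := this
    exact (hS F hF).2 p hp hpc m e heF (fun y hyF => hi y fun i => (hmem _).2 ⟨F, hF, hyF i⟩) y hy

theorem mem_of_mem_closure_of_relations {F : Subfield M} (hF : ∀ x ∈ F, x ∈ O)
    {X : ℕ → ResidueField O} {x : ℕ → O} (hx : ∀ i, residue O (x i) = X i)
    (hrel : ∀ P : MvPolynomial ℕ F,
      MvPolynomial.eval₂ ((residue O).comp (inclHom O hF)) X P = 0 →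
      MvPolynomial.eval₂ (inclHom O hF) x P = 0) {z : M}
    (hz : z ∈ Subfield.closure ((F : Set M) ∪ Set.range fun i => (x i : M))) : z ∈ O := by
  have hsub : Subring.closure ((F : Set M) ∪ Set.range fun i => (x i : M)) ≤
      (MvPolynomial.eval₂Hom (inclHom O hF) x).range.map O.subtype := by
    rw [Subring.closure_le]
    rintro _ (hz | ⟨i, rfl⟩)
    · exact ⟨_, ⟨MvPolynomial.C ⟨_, hz⟩, rfl⟩, by simp; rfl⟩
    · exact ⟨_, ⟨MvPolynomial.X i, rfl⟩, by simp⟩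
  rw [Subfield.mem_closure_iff] at hz
  obtain ⟨a, ha, b, hb, rfl⟩ := hz
  obtain ⟨a, -, rfl⟩ := hsub ha
  obtain ⟨_, ⟨P, rfl⟩, rfl⟩ := hsub hb
  by_cases h0 : MvPolynomial.eval₂ (inclHom O hF) x P = 0
  · simp [h0]
  have hu : IsUnit (MvPolynomial.eval₂ (inclHom O hF) x P) := by
    by_contra hu
    refine h0 (hrel P ?_)
    rw [← mem_nonunits_iff, ← mem_maximalIdeal, ← residue_eq_zero_iff] at hu
    rw [← hu, ← MvPolynomial.coe_eval₂Hom (inclHom O hF), ← RingHom.comp_apply,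
      MvPolynomial.comp_eval₂Hom, MvPolynomial.coe_eval₂Hom]
    congr 1
    exact funext fun i => (hx i).symm
  obtain ⟨c, hc⟩ := hu
  have : O.subtype a / O.subtype (MvPolynomial.eval₂ (inclHom O hF) x P) =
      ((a * (c⁻¹ : Oˣ) : O) : M) := by
    have h1 : (c : O) * (c⁻¹ : Oˣ) = 1 := by simp
    have h2 : O.subtype (c : O) * ((c⁻¹ : Oˣ) : O) = 1 := congrArg Subtype.val h1
    rw [← hc, div_eq_iff (fun h => by simp_all)]
    push_cast
    rw [mul_assoc, mul_comm ((c⁻¹ : Oˣ) : M), h2, mul_one]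
    rfl
  exact this ▸ (a * (c⁻¹ : Oˣ) : O).2

theorem GoodSub.closure {O} {F : Subfield M} (h : GoodSub O F) [Algebra F (ResidueField O)]
    (ha : algebraMap F (ResidueField O) = (residue O).comp (inclHom O h.1))
    {X : ℕ → ResidueField O} {x : ℕ → O} (hx : ∀ i, residue O (x i) = X i)
    (hrel : ∀ P : MvPolynomial ℕ F,
      MvPolynomial.eval₂ ((residue O).comp (inclHom O h.1)) X P = 0 →
      MvPolynomial.eval₂ (inclHom O h.1) x P = 0)
    (hsep : Sep (IntermediateField.adjoin F (Set.range X)) (ResidueField O)) :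
    GoodSub O (Subfield.closure ((F : Set M) ∪ Set.range fun i => (x i : M))) := by
  set F' := Subfield.closure ((F : Set M) ∪ Set.range fun i => (x i : M)) with hF'
  set E := IntermediateField.adjoin F (Set.range X) with hE
  have hO : ∀ z ∈ F', z ∈ O := fun z hz => mem_of_mem_closure_of_relations O h.1 hx hrel hz
  have hFF' : ∀ z ∈ F, z ∈ F' := fun z hz => Subfield.subset_closure (Or.inl hz)
  have hxF' : ∀ i, (x i : M) ∈ F' := fun i => Subfield.subset_closure (Or.inr ⟨i, rfl⟩)
  let ρ : F' →+* ResidueField O := (residue O).comp (inclHom O hO)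
  have hρE : ∀ z : F', ρ z ∈ E := by
    rintro ⟨z, hz⟩
    induction hz using Subfield.closure_induction with
    | mem z hz =>
      obtain hz | ⟨i, rfl⟩ := hz
      · have := E.algebraMap_mem ⟨z, hz⟩
        rw [ha] at this
        exact this
      · have := IntermediateField.subset_adjoin F _ (Set.mem_range_self (f := X) i)
        rw [← hx] at this
        exact this
    | one => exact (map_one ρ).symm ▸ one_mem E
    | add a b hma hmb h1 h2 =>
      have := add_mem h1 h2
      rwa [← map_add] at this
    | neg a hma h1 =>
      have := neg_mem h1
      rwa [← map_neg] at this
    | inv a hma h1 =>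
      have := inv_mem h1
      rwa [← map_inv₀] at this
    | mul a b hma hmb h1 h2 =>
      have := mul_mem h1 h2
      rwa [← map_mul] at this
  have hEρ : ∀ z ∈ E, z ∈ ρ.fieldRange := by
    intro z hz
    induction hz using IntermediateField.adjoin_induction with
    | mem z hz =>
      obtain ⟨i, rfl⟩ := hz
      exact ⟨⟨x i, hxF' i⟩, hx i⟩
    | algebraMap z => exact ⟨⟨z, hFF' z z.2⟩, by rw [ha]; rfl⟩
    | add a b hma hmb h1 h2 => exact add_mem h1 h2
    | inv a hma h1 => exact inv_mem h1
    | mul a b hma hmb h1 h2 => exact mul_mem h1 h2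
  refine ⟨hO, fun p hp hpc m e he hi y hy => ?_⟩
  have hpF : CharP F p := (RingHom.charP_iff F.subtype F.subtype.injective p).2 hpc
  have hpE : CharP E p := charP_of_injective_algebraMap (algebraMap F E).injective p
  refine hsep p hp hpE m (fun i => ⟨residue O (e i), hρE ⟨e i, he i⟩⟩) (fun y hy i => ?_) y hy
  choose y' hy' using fun i => hEρ (y i) (y i).2
  have h1 : ρ (∑ i, ⟨e i, he i⟩ * y' i ^ p) = 0 := by
    rw [map_sum]
    have := congrArg Subtype.val hy
    rw [ZeroMemClass.coe_zero, AddSubmonoidClass.coe_finsetSum] at this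
    rw [← this]
    refine Finset.sum_congr rfl fun i _ => ?_
    rw [map_mul, map_pow, hy']
    rfl
  rw [map_eq_zero_iff ρ ρ.injective] at h1
  have h2 := hi (fun i => inclHom O hO (y' i)) (fun i => (y' i).2) (by
    rw [← map_zero (inclHom O hO), ← h1, map_sum]
    refine Finset.sum_congr rfl fun i _ => ?_
    rw [map_mul, map_pow]
    rfl) i
  apply Subtype.ext
  rw [← hy']
  change residue O (inclHom O hO (y' i)) = 0
  rw [h2, map_zero]

/-- If generators of the residue field can be lifted together with their algebraic relations, then
every good subfield extends to a field of representatives. -/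
theorem exists_coefficient_field (F₀ : Subfield M) (h0 : GoodSub O F₀)
    (hlift : ∀ (F : Subfield M) (hF : GoodSub O F) (X : ℕ → ResidueField O),
      ∃ x : ℕ → O, (∀ i, residue O (x i) = X i) ∧ ∀ P : MvPolynomial ℕ F,
        MvPolynomial.eval₂ ((residue O).comp (inclHom O hF.1)) X P = 0 →
        MvPolynomial.eval₂ (inclHom O hF.1) x P = 0) :
    ∃ (F : Subfield M) (hF : GoodSub O F), F₀ ≤ F ∧
      Function.Surjective ((residue O).comp (inclHom O hF.1)) := by
  obtain ⟨F, hF0, hF⟩ := zorn_le_nonempty₀ {F | GoodSub O F}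
    (fun S hS hc F hF => ⟨sSup S, GoodSub.sSup hS hc.directedOn ⟨F, hF⟩,
      fun F' hF' => le_sSup hF'⟩) F₀ h0
  refine ⟨F, hF.1, hF0, ?_⟩
  have hg : GoodSub O F := hF.1
  let : Algebra F (ResidueField O) := ((residue O).comp (inclHom O hg.1)).toAlgebra
  by_contra hns
  obtain ⟨X, hX, i, hi⟩ := exists_sep_adjoin_range (hg.sep rfl) hns
  obtain ⟨x, hx, hrel⟩ := hlift F hg X
  have hmax := hF.2 (hg.closure rfl hx hrel hX) fun z hz => Subfield.subset_closure (Or.inl hz)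
  have : (x i : M) ∈ F := hmax (Subfield.subset_closure (Or.inr ⟨i, rfl⟩))
  exact hi ⟨⟨x i, this⟩, hx i⟩

end CoefficientField

section Coarsening
open IsLocalRing Polynomial

variable {M : Type*} [Field M] {Γ : Type*} [LinearOrderedCommGroupWithZero Γ]
  {v : Valuation M Γ} {π : M}

/-- The coarsening of a valuation ring obtained by inverting the uniformizer. -/
def coarse (hπ : IsUniformizer v π) : ValuationSubring M where
  carrier := {x | ∃ N : ℕ, v π ^ N * v x ≤ 1}
  mul_mem' := by
    rintro x y ⟨N, hN⟩ ⟨N', hN'⟩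
    refine ⟨N + N', ?_⟩
    rw [map_mul, pow_add, mul_mul_mul_comm]
    exact mul_le_one' hN hN'
  one_mem' := ⟨0, by simp⟩
  add_mem' := by
    rintro x y ⟨N, hN⟩ ⟨N', hN'⟩
    refine ⟨N + N', ?_⟩
    obtain h | h := le_max_iff.1 (v.map_add x y)
    · refine (mul_le_mul_right h _).trans ?_
      rw [pow_add, mul_right_comm]
      exact mul_le_one' hN (pow_le_one' hπ.2.1.le _)
    · refine (mul_le_mul_right h _).trans ?_
      rw [pow_add, mul_assoc]
      exact mul_le_one' (pow_le_one' hπ.2.1.le _) hN'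
  zero_mem' := ⟨0, by simp⟩
  neg_mem' := by
    rintro x ⟨N, hN⟩
    exact ⟨N, by rwa [Valuation.map_neg]⟩
  mem_or_inv_mem' := fun x => by
    obtain h | h := v.valuationSubring.mem_or_inv_mem x
    · exact Or.inl ⟨0, by simpa using h⟩
    · exact Or.inr ⟨0, by rwa [pow_zero, one_mul]⟩

theorem residue_coarse_eq_zero_iff (hπ : IsUniformizer v π) (x : coarse hπ) :
    residue (coarse hπ) x = 0 ↔ ∀ N : ℕ, v (x : M) ≤ v π ^ N := by
  rw [residue_eq_zero_iff, mem_maximalIdeal, mem_nonunits_iff]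
  constructor
  · intro hx N
    by_contra! hlt
    have hx0 : (x : M) ≠ 0 := fun h => by simp [h] at hlt
    have hv0 : 0 < v (x : M) := zero_lt_iff.2 ((Valuation.ne_zero_iff v).2 hx0)
    have hinv : (x : M)⁻¹ ∈ coarse hπ := by
      refine ⟨N, ?_⟩
      rw [map_inv₀, ← div_eq_mul_inv]
      exact (div_le_one₀ hv0).2 hlt.le
    exact hx (IsUnit.of_mul_eq_one ⟨_, hinv⟩ (Subtype.ext (mul_inv_cancel₀ hx0)))
  · rintro hx ⟨c, rfl⟩
    obtain ⟨N, hN⟩ := ((c⁻¹ : (coarse hπ)ˣ) : coarse hπ).2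
    have h1 : ((c : coarse hπ) : M) * ((c⁻¹ : (coarse hπ)ˣ) : coarse hπ) = 1 :=
      congrArg Subtype.val c.mul_inv
    have h2 := congrArg v h1
    rw [map_mul, map_one] at h2
    refine absurd h2 (ne_of_lt ?_)
    calc _ ≤ v π ^ (N + 1) * v (((c⁻¹ : (coarse hπ)ˣ) : coarse hπ) : M) :=
          mul_le_mul_left (hx _) _
      _ = v π * (v π ^ N * v (((c⁻¹ : (coarse hπ)ˣ) : coarse hπ) : M)) := by
          rw [pow_succ, mul_comm (v π ^ N), mul_assoc]
      _ ≤ v π * 1 := mul_le_mul_right hN _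
      _ < 1 := by rw [mul_one]; exact hπ.2.1

theorem coarse_hensel (hπ : IsUniformizer v π) (hv : IsHenselian v) (f : (coarse hπ)[X])
    (a : coarse hπ) (h0 : residue _ (f.eval a) = 0) (h1 : residue _ (f.derivative.eval a) ≠ 0) :
    ∃ b : coarse hπ, f.eval b = 0 ∧ residue _ b = residue _ a := by
  let ι := (coarse hπ).subtype
  have hev : ∀ (g : (coarse hπ)[X]) (c : coarse hπ), (g.map ι).eval (c : M) =
      (g.eval c : coarse hπ) :=
    fun g c => eval_map_apply (f := ι) c
  have hco : ∀ i, (taylor (a : M) (f.map ι)).coeff i = ((taylor a f).coeff i : coarse hπ) := by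
    intro i
    rw [show (a : M) = ι a from rfl, ← map_taylor, coeff_map]
    rfl
  rw [residue_coarse_eq_zero_iff] at h0
  rw [Ne, residue_coarse_eq_zero_iff] at h1
  push Not at h1
  obtain ⟨N, hN⟩ := h1
  have hπ0 : ∀ k : ℕ, 0 < v π ^ k := fun k => pow_pos hπ.1 k
  obtain ⟨b, hb, hb'⟩ := hensel_newton v hv (f.map ι) a (fun i _ => by
    rw [hco, hco, hco, taylor_coeff_zero, taylor_coeff_one]
    obtain ⟨k, hk⟩ := ((taylor a f).coeff i).2
    calc _ ≤ v π ^ (N + N + k) * v (((taylor a f).coeff i : coarse hπ) : M) :=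
          mul_le_mul_left (h0 _) _
      _ = v π ^ N * v π ^ N * (v π ^ k * v (((taylor a f).coeff i : coarse hπ) : M)) := by
          rw [pow_add, pow_add, mul_assoc]
      _ ≤ v π ^ N * v π ^ N * 1 := mul_le_mul_right hk _
      _ = (v π ^ N) ^ 2 := by rw [mul_one, sq]
      _ < _ := pow_lt_pow_left₀ hN zero_le two_ne_zero)
  rw [derivative_map, hev, hev] at hb'
  have hsm : ∀ k : ℕ, v (b - a) ≤ v π ^ k := by
    intro k
    have : v (b - a) * v π ^ N ≤ v π ^ k * v π ^ N :=
      ((mul_le_mul_right hN.le _).trans hb').trans ((h0 (k + N)).trans_eq (pow_add _ _ _))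
    exact le_of_mul_le_mul_right this (hπ0 N)
  have hba : b - a ∈ coarse hπ := ⟨0, by simpa using hsm 0⟩
  have hbm : b ∈ coarse hπ := by simpa using add_mem hba a.2
  refine ⟨⟨b, hbm⟩, Subtype.ext ((hev f ⟨b, hbm⟩).symm.trans hb), ?_⟩
  rw [← sub_eq_zero, ← map_sub, residue_coarse_eq_zero_iff]
  exact hsm

end Coarsening

section Lifting
open IsLocalRing Polynomial

theorem ev_eq_evr {C L : Type*} [Field C] [Field L] [Algebra C L] {d : ℕ} (s : Fin d → L) (b : L)
    (P : (MvPolynomial (Fin d) C)[X]) : ev s b P = evr (algebraMap C L) s b P := rfl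

variable {M : Type*} [Field M] {Γ : Type*} [LinearOrderedCommGroupWithZero Γ]
  {v : Valuation M Γ} {π : M}

/-- Finitely generated subalgebras of the residue field lift. -/
theorem exists_lift_adjoin (hπ : IsUniformizer v π) (hv : IsHenselian v) {F : Subfield M}
    (hF : GoodSub (coarse hπ) F) [Algebra F (ResidueField (coarse hπ))]
    (ha : algebraMap F (ResidueField (coarse hπ)) = (residue _).comp (inclHom _ hF.1))
    (Z : Finset (ResidueField (coarse hπ))) :
    ∃ φ : Algebra.adjoin F (Z : Set (ResidueField (coarse hπ))) →ₐ[F] M, ∀ z : Z,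
      ∃ y : coarse hπ, (y : M) = φ ⟨z, Algebra.subset_adjoin z.2⟩ ∧ residue _ y = z := by
  let ι := inclHom _ hF.1
  have htr : TrLE F Z.card (IntermediateField.adjoin F (Z : Set (ResidueField (coarse hπ))) :
      Set (ResidueField (coarse hπ))) := by
    refine trLE_adjoin_of_isAlgebraic (X := Z) le_rfl fun z hz => ?_
    exact isAlgebraic_algebraMap (⟨z, IntermediateField.subset_adjoin _ _ hz⟩ :
          IntermediateField.adjoin F (Z : Set (ResidueField (coarse hπ))))
  have hsep : Sep F (ResidueField (coarse hπ)) := hF.sep ha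
  have key := exists_hypersurface_adjoin_lift hsep Z.card Z htr
  obtain ⟨d, -, s, b, G, H, hG, hG', hH, hZ, hlift⟩ := key
  choose s' hs' using fun i => residue_surjective (R := coarse hπ) (s i)
  obtain ⟨b₀, hb₀⟩ := residue_surjective (R := coarse hπ) b
  have hres : ∀ (c : coarse hπ), residue _ c = b → ∀ P : (MvPolynomial (Fin d) F)[X],
      residue _ (evr ι s' c P) = ev s b P := by
    intro c hc P
    rw [map_evr, hc, ev_eq_evr, ha]
    simp only [hs']
    rfl
  have hM : ∀ (c : coarse hπ) (P : (MvPolynomial (Fin d) F)[X]),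
      ((evr ι s' c P : coarse hπ) : M) = ev (fun i => (s' i : M)) (c : M) P :=
    fun c P => map_evr ι (coarse hπ).subtype s' c P
  obtain ⟨c, hc0, hcb⟩ := coarse_hensel hπ hv (G.map (MvPolynomial.eval₂Hom ι s')) b₀
    (by rw [← evr_eq_eval, hres b₀ hb₀, hG])
    (by rw [derivative_map, ← evr_eq_eval, hres b₀ hb₀]; exact hG')
  rw [hb₀] at hcb
  rw [← evr_eq_eval] at hc0
  have hne : ∀ P : (MvPolynomial (Fin d) F)[X], ev s b P ≠ 0 → IsUnit (evr ι s' c P) := by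
    intro P hP
    by_contra hu
    rw [← mem_nonunits_iff, ← mem_maximalIdeal, ← residue_eq_zero_iff, hres c hcb] at hu
    exact hP hu
  have hne' : ∀ P : (MvPolynomial (Fin d) F)[X], ev s b P ≠ 0 →
      ev (fun i => (s' i : M)) (c : M) P ≠ 0 := by
    intro P hP h0
    rw [← hM] at h0
    exact (hne P hP).ne_zero (Subtype.ext h0)
  obtain ⟨φ, hφ⟩ := hlift M (fun i => (s' i : M)) (c : M)
    (by rw [← hM, hc0]; rfl) (hne' H hH)
  refine ⟨φ, fun z => ?_⟩
  obtain ⟨A, B, hB, hAB⟩ := hZ z z.2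
  have h1 := hφ ⟨z, Algebra.subset_adjoin z.2⟩ A B (hne' B hB) hAB
  obtain ⟨β, hβ⟩ := hne B hB
  refine ⟨evr ι s' c A * (β⁻¹ : (coarse hπ)ˣ), ?_, ?_⟩
  · apply mul_right_cancel₀ (hne' B hB)
    rw [h1, ← hM, ← hM, ← hβ]
    push_cast
    rw [mul_assoc]
    have : ((β⁻¹ : (coarse hπ)ˣ) : coarse hπ) * (β : coarse hπ) = 1 := β.inv_mul
    have := congrArg (fun x : coarse hπ => (x : M)) this
    simp only [MulMemClass.coe_mul, OneMemClass.coe_one] at this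
    rw [this, mul_one]
  · apply mul_right_cancel₀ hB
    rw [hAB, ← hres c hcb, ← hres c hcb, ← map_mul, ← hβ, mul_assoc, β.inv_mul, mul_one]

end Lifting

section CountableLifting
open IsLocalRing

/-- Ideals of polynomial rings in countably many variables over a field are countably generated. -/
theorem exists_countable_span {F : Type*} [Field F] (I : Ideal (MvPolynomial ℕ F)) :
    ∃ T : Set (MvPolynomial ℕ F), T.Countable ∧ Ideal.span T = I := by
  classical
  let r : ∀ s : Finset ℕ, MvPolynomial s F →ₐ[F] MvPolynomial ℕ F :=
    fun s => MvPolynomial.rename (↑)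
  have hfg : ∀ s : Finset ℕ, ∃ t : Finset (MvPolynomial s F),
      Ideal.span (t : Set (MvPolynomial s F)) = I.comap (r s) := fun s =>
    (isNoetherianRing_iff_ideal_fg _).1 inferInstance _
  choose t ht using hfg
  refine ⟨⋃ s, r s '' (t s : Set _), Set.countable_iUnion fun s => (t s).countable_toSet.image _,
    le_antisymm ?_ ?_⟩
  · rw [Ideal.span_le]
    intro P hP
    obtain ⟨s, Q, hQ, rfl⟩ := Set.mem_iUnion.1 hP
    have : Q ∈ I.comap (r s) := ht s ▸ Ideal.subset_span hQ
    exact this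
  · intro P hP
    obtain ⟨s, Q, rfl⟩ := MvPolynomial.exists_finset_rename P
    have h1 : Q ∈ Ideal.span (t s : Set (MvPolynomial s F)) := by
      rw [ht s]; exact hP
    have h2 := Ideal.mem_map_of_mem (r s) h1
    rw [Ideal.map_span] at h2
    have h3 : r s '' (t s : Set (MvPolynomial s F)) ⊆
        ⋃ s : Finset ℕ, r s '' (t s : Set (MvPolynomial s F)) :=
      fun Q hQ => Set.mem_iUnion.2 ⟨s, hQ⟩
    exact Ideal.span_mono h3 h2

variable {M : Type*} [Field M] {Γ : Type*} [LinearOrderedCommGroupWithZero Γ]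
  {v : Valuation M Γ} {π : M}

/-- In a saturated henselian field, countably many residues lift together with all their algebraic
relations over a good subfield. -/
theorem exists_lift_of_saturated (hπ : IsUniformizer v π) (hv : IsHenselian v)
    (hsat : ∀ P Q : ℕ → MvPolynomial ℕ M, (∀ n, ∃ x : ℕ → M, ∀ k < n,
        v (MvPolynomial.eval x (P k)) ≤ v (MvPolynomial.eval x (Q k))) →
      ∃ x : ℕ → M, ∀ k, v (MvPolynomial.eval x (P k)) ≤ v (MvPolynomial.eval x (Q k)))
    {F : Subfield M} (hF : GoodSub (coarse hπ) F) (X : ℕ → ResidueField (coarse hπ)) :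
    ∃ x : ℕ → coarse hπ, (∀ i, residue _ (x i) = X i) ∧ ∀ P : MvPolynomial ℕ F,
      MvPolynomial.eval₂ ((residue _).comp (inclHom _ hF.1)) X P = 0 →
      MvPolynomial.eval₂ (inclHom _ hF.1) x P = 0 := by
  classical
  let ι := inclHom _ hF.1
  let : Algebra F (ResidueField (coarse hπ)) := ((residue _).comp ι).toAlgebra
  obtain ⟨T, hT, hTI⟩ := exists_countable_span
    (RingHom.ker (MvPolynomial.eval₂Hom ((residue _).comp ι) X))
  choose a ha using fun i => residue_surjective (R := coarse hπ) (X i)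
  let S : Set (MvPolynomial ℕ M × MvPolynomial ℕ M) :=
    (fun P => (MvPolynomial.map F.subtype P, 0)) '' T ∪ Set.range (fun iN : ℕ × ℕ =>
      (MvPolynomial.X iN.1 - MvPolynomial.C (a iN.1 : M), MvPolynomial.C (π ^ iN.2)))
  have hS : S.Countable := (hT.image _).union (Set.countable_range _)
  have hSne : S.Nonempty := ⟨_, Or.inr ⟨(0, 0), rfl⟩⟩
  obtain ⟨f, hf⟩ := hS.exists_eq_range hSne
  have hfin : ∀ n, ∃ x : ℕ → M, ∀ k < n,
      v (MvPolynomial.eval x (f k).1) ≤ v (MvPolynomial.eval x (f k).2) := by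
    intro n
    let V : Finset ℕ := (Finset.range n).biUnion fun k => (f k).1.vars
    obtain ⟨φ, hφ⟩ := exists_lift_adjoin hπ hv hF rfl (V.image X)
    have hφ' : ∀ i (hi : X i ∈ V.image X), ∃ y : coarse hπ,
        (y : M) = φ ⟨X i, Algebra.subset_adjoin hi⟩ ∧ residue _ y = X i := fun i hi => hφ ⟨X i, hi⟩
    refine ⟨fun i => if hi : X i ∈ V.image X then φ ⟨X i, Algebra.subset_adjoin hi⟩ else a i,
      fun k hk => ?_⟩
    have hk' : f k ∈ S := hf ▸ Set.mem_range_self k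
    obtain ⟨P, hP, hPk⟩ | ⟨⟨i, N⟩, hiN⟩ := hk'
    · rw [← hPk]
      suffices h : MvPolynomial.eval (fun i => if hi : X i ∈ V.image X then
          φ ⟨X i, Algebra.subset_adjoin hi⟩ else (a i : M)) (MvPolynomial.map F.subtype P) = 0 by
        rw [h, map_zero]; exact zero_le
      let A := Algebra.adjoin F ((V.image X : Finset _) : Set (ResidueField (coarse hπ)))
      let x' : ℕ → A := fun i => if hi : X i ∈ V.image X then ⟨X i, Algebra.subset_adjoin hi⟩ else 0
      have hvars : ∀ i ∈ P.vars, X i ∈ V.image X := by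
        intro i hi
        refine Finset.mem_image_of_mem _ (Finset.mem_biUnion.2 ⟨k, Finset.mem_range.2 hk, ?_⟩)
        rw [← hPk]
        exact (MvPolynomial.vars_map_of_injective P F.subtype.injective).symm ▸ hi
      have h1 : MvPolynomial.aeval x' P = 0 := by
        apply Subtype.ext
        have h3 : MvPolynomial.eval₂Hom ((residue _).comp ι) X P = 0 :=
          (RingHom.mem_ker).1 (hTI ▸ Ideal.subset_span hP)
        rw [ZeroMemClass.coe_zero, ← h3]
        rw [show ((MvPolynomial.aeval x' P : A) : ResidueField (coarse hπ)) =
          A.val (MvPolynomial.aeval x' P) from rfl, MvPolynomial.comp_aeval_apply]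
        refine MvPolynomial.eval₂Hom_congr' rfl (fun i hi _ => ?_) rfl
        simp only [x', dif_pos (hvars i hi)]
        rfl
      have h2 := congrArg φ h1
      rw [MvPolynomial.comp_aeval_apply, map_zero] at h2
      rw [← h2, MvPolynomial.eval_map]
      refine MvPolynomial.eval₂Hom_congr' rfl (fun i hi _ => ?_) rfl
      simp only [x', dif_pos (hvars i hi)]
    · rw [← hiN]
      simp only [map_sub, MvPolynomial.eval_X, MvPolynomial.eval_C]
      split_ifs with hi
      · obtain ⟨y, hy, hyr⟩ := hφ' i hi
        rw [← hy, map_pow]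
        refine (residue_coarse_eq_zero_iff hπ (y - a i)).1 ?_ N
        rw [map_sub, hyr, ha, sub_self]
      · simp
  obtain ⟨x, hx⟩ := hsat _ _ hfin
  have hxS : ∀ q ∈ S, v (MvPolynomial.eval x q.1) ≤ v (MvPolynomial.eval x q.2) := by
    intro q hq
    rw [hf] at hq
    obtain ⟨k, rfl⟩ := hq
    exact hx k
  have hxa : ∀ i N, v (x i - a i) ≤ v π ^ N := by
    intro i N
    simpa using hxS _ (Or.inr ⟨(i, N), rfl⟩)
  have hsub : ∀ i, x i - a i ∈ coarse hπ := fun i => ⟨0, by simpa using hxa i 0⟩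
  have hxO : ∀ i, x i ∈ coarse hπ := fun i => by simpa using add_mem (hsub i) (a i).2
  refine ⟨fun i => ⟨x i, hxO i⟩, fun i => ?_, fun P hP => ?_⟩
  · rw [← ha i, ← sub_eq_zero, ← map_sub, residue_coarse_eq_zero_iff]
    exact hxa i
  · have hle : Ideal.span T ≤ RingHom.ker (MvPolynomial.eval₂Hom F.subtype x) := by
      rw [Ideal.span_le]
      intro Q hQ
      have := hxS _ (Or.inl ⟨Q, hQ, rfl⟩)
      rw [map_zero, map_zero, le_zero_iff, Valuation.zero_iff, MvPolynomial.eval_map] at this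
      exact this
    have h1 : MvPolynomial.eval₂Hom F.subtype x P = 0 := hle (hTI.symm ▸ hP)
    apply Subtype.ext
    rw [ZeroMemClass.coe_zero, ← h1]
    exact RingHom.congr_fun (MvPolynomial.comp_eval₂Hom ι
      (fun i => (⟨x i, hxO i⟩ : coarse hπ)) (coarse hπ).subtype) P

end CountableLifting

section UltrapowerTransfer
open Filter Polynomial

theorem IsUltrapower.ev_mk {C K M : Type*} [Field C] [Field K] [Field M] {Γ Γ' : Type*}
    [LinearOrderedCommGroupWithZero Γ] [LinearOrderedCommGroupWithZero Γ'] {v : Valuation K Γ}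
    {vM : Valuation M Γ'} {mk : (ℕ → K) →+* M} (h : IsUltrapower v vM mk) [Algebra C K]
    [Algebra C M] (ha : algebraMap C M = h.diag.comp (algebraMap C K)) {d : ℕ}
    (s : Fin d → ℕ → K) (b : ℕ → K) (P : (MvPolynomial (Fin d) C)[X]) :
    ev (fun i => mk (s i)) (mk b) P = mk fun k => ev (fun i => s i k) (b k) P := by
  let ι : C →+* (ℕ → K) := (Pi.constRingHom ℕ K).comp (algebraMap C K)
  have h1 : ev (fun i => mk (s i)) (mk b) P = mk (evr ι s b P) := by
    rw [map_evr, ev_eq_evr, ha]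
    rfl
  rw [h1]
  congr 1
  funext k
  exact map_evr ι (Pi.evalRingHom (fun _ => K) k) s b P

theorem IsUltrapower.exists_ev {C K M : Type*} [Field C] [Field K] [Field M] {Γ Γ' : Type*}
    [LinearOrderedCommGroupWithZero Γ] [LinearOrderedCommGroupWithZero Γ'] {v : Valuation K Γ}
    {vM : Valuation M Γ'} {mk : (ℕ → K) →+* M} (h : IsUltrapower v vM mk) [Algebra C K]
    [Algebra C M] (ha : algebraMap C M = h.diag.comp (algebraMap C K)) {d : ℕ}
    (G H : (MvPolynomial (Fin d) C)[X]) (s : Fin d → M) (b : M) (h0 : ev s b G = 0)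
    (h1 : ev s b H ≠ 0) : ∃ (s' : Fin d → K) (b' : K), ev s' b' G = 0 ∧ ev s' b' H ≠ 0 := by
  choose s' hs using fun i => h.surjective (s i)
  obtain ⟨b', rfl⟩ := h.surjective b
  obtain rfl := funext hs
  rw [h.ev_mk ha, h.eq_zero_iff] at h0
  rw [h.ev_mk ha, Ne, h.eq_zero_iff, ← Ultrafilter.eventually_not] at h1
  obtain ⟨k, hk0, hk1⟩ := (h0.and h1).exists
  exact ⟨_, _, hk0, hk1⟩

end UltrapowerTransfer

section NewtonNonvanishing
open Polynomial

/-- Newton approximation producing a root of `f` at which `h` does not vanish. -/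
theorem hensel_newton_ne_zero {K : Type*} [Field K] {Γ : Type*} [LinearOrderedCommGroupWithZero Γ]
    (v : Valuation K Γ) (hv : IsHenselian v) (f h : K[X]) (a : K)
    (hf : ∀ i, 1 ≤ i → v ((taylor a f).coeff 0) * v ((taylor a f).coeff i)
      < v ((taylor a f).coeff 1) ^ 2)
    (hh : ∀ i, 1 ≤ i → v ((taylor a h).coeff i) * v ((taylor a f).coeff 0) ^ i
      < v ((taylor a h).coeff 0) * v ((taylor a f).coeff 1) ^ i) :
    ∃ b, f.eval b = 0 ∧ h.eval b ≠ 0 := by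
  obtain ⟨b, hb, hba⟩ := hensel_newton v hv f a hf
  rw [← taylor_coeff_one, ← taylor_coeff_zero] at hba
  refine ⟨b, hb, fun hb0 => ?_⟩
  have hsum : h.eval b = ∑ i ∈ Finset.range (h.natDegree + 1),
      (taylor a h).coeff i * (b - a) ^ i := by
    have : h.eval b = (taylor a h).eval (b - a) := by simp [taylor_eval]
    rw [this, eval_eq_sum_range, natDegree_taylor]
  rw [hb0, Finset.sum_range_succ', pow_zero, mul_one] at hsum
  have h0 : (taylor a h).coeff 0 ≠ 0 := by
    intro h0
    have := hh 1 le_rfl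
    simp [h0] at this
  have hlt : v (∑ i ∈ Finset.range h.natDegree, (taylor a h).coeff (i + 1) * (b - a) ^ (i + 1)) <
      v ((taylor a h).coeff 0) := by
    refine Valuation.map_sum_lt _ (by simpa using h0) fun i _ => ?_
    have h1 := hh (i + 1) (Nat.le_add_left 1 i)
    have h2 : v ((taylor a h).coeff (i + 1) * (b - a) ^ (i + 1)) *
        v ((taylor a f).coeff 1) ^ (i + 1) ≤
        v ((taylor a h).coeff (i + 1)) * v ((taylor a f).coeff 0) ^ (i + 1) := by
      rw [map_mul, map_pow, mul_assoc, ← mul_pow]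
      exact mul_le_mul_right (pow_le_pow_left₀ zero_le hba _) _
    exact lt_of_mul_lt_mul_right' (h2.trans_lt h1)
  rw [eq_comm, add_eq_zero_iff_eq_neg] at hsum
  rw [hsum, Valuation.map_neg] at hlt
  exact lt_irrefl _ hlt

end NewtonNonvanishing

section Hasse
open Polynomial

theorem hasseDeriv_map' {R S : Type*} [CommRing R] [CommRing S] (f : R →+* S) (P : R[X]) (i : ℕ) :
    hasseDeriv i (P.map f) = (hasseDeriv i P).map f := by
  ext n
  simp [hasseDeriv_coeff]

theorem taylor_coeff_ev {C L : Type*} [Field C] [Field L] [Algebra C L] {d : ℕ} (s : Fin d → L)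
    (b : L) (P : (MvPolynomial (Fin d) C)[X]) (i : ℕ) :
    (taylor b (P.map (MvPolynomial.aeval s).toRingHom)).coeff i = ev s b (hasseDeriv i P) := by
  rw [taylor_coeff, hasseDeriv_map', ev_apply]

/-- Newton approximation in terms of Hasse derivatives. -/
theorem exists_ev_of_hasse {C L : Type*} [Field C] [Field L] [Algebra C L]
    {Γ : Type*} [LinearOrderedCommGroupWithZero Γ]
    (v : Valuation L Γ) (hv : IsHenselian v) {d : ℕ} (s : Fin d → L) (b : L)
    (G H : (MvPolynomial (Fin d) C)[X]) (hG1 : ev s b (hasseDeriv 1 G) ≠ 0)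
    (hH0 : ev s b (hasseDeriv 0 H) ≠ 0)
    (hG : ∀ i, 1 ≤ i → i ≤ max G.natDegree H.natDegree → v (ev s b (hasseDeriv 0 G) *
      ev s b (hasseDeriv i G) / ev s b (hasseDeriv 1 G) ^ 2) < 1)
    (hH : ∀ i, 1 ≤ i → i ≤ max G.natDegree H.natDegree →
      v (ev s b (hasseDeriv i H) * ev s b (hasseDeriv 0 G) ^ i /
        (ev s b (hasseDeriv 0 H) * ev s b (hasseDeriv 1 G) ^ i)) < 1) :
    ∃ b', ev s b' G = 0 ∧ ev s b' H ≠ 0 := by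
  have hz : ∀ (P : (MvPolynomial (Fin d) C)[X]) i, ¬ i ≤ max G.natDegree H.natDegree →
      P.natDegree ≤ max G.natDegree H.natDegree → ev s b (hasseDeriv i P) = 0 := by
    intro P i hi hP
    rw [hasseDeriv_eq_zero_of_lt_natDegree _ _ (by omega), map_zero]
  have key := hensel_newton_ne_zero v hv (G.map (MvPolynomial.aeval s).toRingHom)
    (H.map (MvPolynomial.aeval s).toRingHom) b
  simp only [taylor_coeff_ev] at key
  have h1 : 0 < v (ev s b (hasseDeriv 1 G)) := zero_lt_iff.2 (by simpa using hG1)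
  have h0 : 0 < v (ev s b (hasseDeriv 0 H)) := zero_lt_iff.2 (by simpa using hH0)
  obtain ⟨b', hb', hb''⟩ := key (fun i hi => by
    by_cases hid : i ≤ max G.natDegree H.natDegree
    · have := hG i hi hid
      rwa [map_div₀, map_mul, map_pow, div_lt_one₀ (pow_pos h1 _)] at this
    · rw [hz G i hid (le_max_left _ _), map_zero, mul_zero]
      exact pow_pos h1 _) (fun i hi => by
    by_cases hid : i ≤ max G.natDegree H.natDegree
    · have := hH i hi hid
      rwa [map_div₀, map_mul, map_mul, map_pow, map_pow,
        div_lt_one₀ (mul_pos h0 (pow_pos h1 _))] at this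
    · rw [hz H i hid (le_max_right _ _), map_zero, zero_mul]
      exact mul_pos h0 (pow_pos h1 _))
  exact ⟨b', by rwa [ev_apply], by rwa [ev_apply]⟩

end Hasse

section SepLaurent

theorem sep_powerSeries_aux {F : Type*} [Field F] {p : ℕ} {m : ℕ} {e : Fin m → F}
    (he : FrobIndep (R := F) p e) (N : ℕ) (y : Fin m → PowerSeries F)
    (hy : ∑ i, PowerSeries.C (e i) * y i ^ p = 0) (i : Fin m) : PowerSeries.X ^ N ∣ y i := by
  induction N generalizing y i with
  | zero => simp
  | succ N ih =>
    have h0 : ∀ i, PowerSeries.X ∣ y i := by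
      have h1 := congrArg PowerSeries.constantCoeff hy
      simp only [map_sum, map_mul, map_pow, PowerSeries.constantCoeff_C, map_zero] at h1
      exact fun i => PowerSeries.X_dvd_iff.2 (he _ h1 i)
    choose z hz using h0
    have h2 : ∑ i, PowerSeries.C (e i) * z i ^ p = 0 := by
      have h3 : PowerSeries.X ^ p * ∑ i, PowerSeries.C (e i) * z i ^ p = 0 := by
        rw [← hy, Finset.mul_sum]
        refine Finset.sum_congr rfl fun i _ => ?_
        rw [hz i]
        ring
      exact (mul_eq_zero.1 h3).resolve_left (pow_ne_zero _ PowerSeries.X_ne_zero)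
    rw [hz i, pow_succ']
    exact mul_dvd_mul_left _ (ih z h2 i)

theorem sep_laurentSeries (F : Type*) [Field F] : Sep F (LaurentSeries F) := by
  intro p _ _ m e he y hy
  obtain ⟨⟨c, hc⟩, hcy⟩ := IsLocalization.exist_integer_multiples_of_finite
    (nonZeroDivisors (PowerSeries F)) y
  have hc0 : c ≠ 0 := nonZeroDivisors.ne_zero hc
  choose z hz using hcy
  have hinj : Function.Injective (algebraMap (PowerSeries F) (LaurentSeries F)) :=
    IsFractionRing.injective _ _
  have hz' : ∀ i, algebraMap (PowerSeries F) (LaurentSeries F) (z i) =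
      algebraMap (PowerSeries F) (LaurentSeries F) c * y i := fun i => by
    rw [hz i]
    exact Algebra.smul_def c (y i)
  have hsum : ∑ i, PowerSeries.C (e i) * z i ^ p = 0 := by
    refine hinj ?_
    rw [map_zero, map_sum]
    have h1 : algebraMap (PowerSeries F) (LaurentSeries F) c ^ p *
        ∑ i, algebraMap F (LaurentSeries F) (e i) * y i ^ p = 0 := by rw [hy, mul_zero]
    rw [← h1, Finset.mul_sum]
    refine Finset.sum_congr rfl fun i _ => ?_
    have h2 : algebraMap (PowerSeries F) (LaurentSeries F) (PowerSeries.C (e i)) =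
        algebraMap F (LaurentSeries F) (e i) := by
      rw [LaurentSeries.algebraMap_apply]
      exact PowerSeries.coe_C _
    rw [map_mul, map_pow, hz', h2]
    ring
  intro i
  have hzi : z i = 0 := by
    ext n
    exact (PowerSeries.X_pow_dvd_iff.1 (sep_powerSeries_aux he (n + 1) z hsum i)) n (by omega)
  have h1 := hz' i
  rw [hzi, map_zero, eq_comm, mul_eq_zero] at h1
  exact h1.resolve_left fun h => hc0 (hinj (by rw [h, map_zero]))

end SepLaurent

section Density
open Polynomial
open scoped RatFunc

theorem continuous_ev {C L : Type*} [Field C] [Field L] [Algebra C L] [TopologicalSpace L]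
    [IsTopologicalRing L] {d : ℕ} (P : (MvPolynomial (Fin d) C)[X]) :
    Continuous fun x : (Fin d → L) × L => ev x.1 x.2 P := by
  induction P using Polynomial.induction_on' with
  | add p q hp hq => simp only [map_add]; exact hp.add hq
  | monomial n a =>
    simp only [← C_mul_X_pow_eq_monomial, map_mul, map_pow, ev_X, ev_C]
    refine Continuous.mul ?_ (continuous_snd.pow n)
    induction a using MvPolynomial.induction_on with
    | C a => simpa using continuous_const
    | add p q hp hq => simp only [map_add]; exact hp.add hq
    | mul_X p i hp =>
      simp only [map_mul, MvPolynomial.aeval_X]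
      exact hp.mul ((continuous_apply i).comp continuous_fst)

theorem exists_ratFunc_approx {F : Type*} [Field F] {d : ℕ} (G H : (MvPolynomial (Fin d) F)[X])
    (s : Fin d → LaurentSeries F) (b : LaurentSeries F) (h0 : ev s b G = 0)
    (h1 : ev s b (derivative G) ≠ 0) (h2 : ev s b H ≠ 0) (N : ℕ) :
    ∃ (s' : Fin d → RatFunc F) (b' : RatFunc F), ev s' b' (hasseDeriv 1 G) ≠ 0 ∧
      ev s' b' (hasseDeriv 0 H) ≠ 0 ∧
      (∀ i, 1 ≤ i → i ≤ N → (Polynomial.idealX F).valuation (RatFunc F)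
        (ev s' b' (hasseDeriv 0 G) * ev s' b' (hasseDeriv i G) /
          ev s' b' (hasseDeriv 1 G) ^ 2) < 1) ∧
      (∀ i, 1 ≤ i → i ≤ N → (Polynomial.idealX F).valuation (RatFunc F)
        (ev s' b' (hasseDeriv i H) * ev s' b' (hasseDeriv 0 G) ^ i /
          (ev s' b' (hasseDeriv 0 H) * ev s' b' (hasseDeriv 1 G) ^ i)) < 1) := by
  let x₀ : (Fin d → LaurentSeries F) × LaurentSeries F := (s, b)
  have hc : ∀ i (P : (MvPolynomial (Fin d) F)[X]),
      ContinuousAt (fun x : (Fin d → LaurentSeries F) × LaurentSeries F => ev x.1 x.2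
          (hasseDeriv i P)) x₀ :=
    fun i P => (continuous_ev _).continuousAt
  have hnhds : {x : LaurentSeries F | Valued.v x < 1} ∈ nhds (0 : LaurentSeries F) := by
    have := (Valued.isOpen_ball (LaurentSeries F) 1).mem_nhds (x := 0) (by simp)
    simpa only [Valuation.restrict_lt_one_iff] using this
  have h0' : ev x₀.1 x₀.2 (hasseDeriv 0 G) = 0 := by rwa [hasseDeriv_zero']
  have h1' : ev x₀.1 x₀.2 (hasseDeriv 1 G) ≠ 0 := by rwa [hasseDeriv_one']
  have h2' : ev x₀.1 x₀.2 (hasseDeriv 0 H) ≠ 0 := by rwa [hasseDeriv_zero']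
  have e1 : ∀ i ∈ Finset.Icc 1 N, ∀ᶠ x in nhds x₀,
      Valued.v (ev x.1 x.2 (hasseDeriv 0 G) * ev x.1 x.2 (hasseDeriv i G) /
          ev x.1 x.2 (hasseDeriv 1 G) ^ 2) < 1 := by
    intro i _
    have hcont : ContinuousAt (fun x : (Fin d → LaurentSeries F) × LaurentSeries F =>
        ev x.1 x.2 (hasseDeriv 0 G) * ev x.1 x.2 (hasseDeriv i G) /
          ev x.1 x.2 (hasseDeriv 1 G) ^ 2) x₀ :=
              ((hc 0 G).mul (hc i G)).div₀ ((hc 1 G).pow 2) (pow_ne_zero 2 h1')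
    have h3 : ev x₀.1 x₀.2 (hasseDeriv 0 G) * ev x₀.1 x₀.2 (hasseDeriv i G) /
          ev x₀.1 x₀.2 (hasseDeriv 1 G) ^ 2 = 0 := by rw [h0', zero_mul, zero_div]
    exact hcont.eventually (p := fun y => Valued.v y < 1) (by beta_reduce; rw [h3]; exact hnhds)
  have e2 : ∀ i ∈ Finset.Icc 1 N, ∀ᶠ x in nhds x₀,
      Valued.v (ev x.1 x.2 (hasseDeriv i H) * ev x.1 x.2 (hasseDeriv 0 G) ^ i /
          (ev x.1 x.2 (hasseDeriv 0 H) * ev x.1 x.2 (hasseDeriv 1 G) ^ i)) < 1 := by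
    intro i hi
    have hi0 : i ≠ 0 := by have := (Finset.mem_Icc.1 hi).1; omega
    have hcont : ContinuousAt (fun x : (Fin d → LaurentSeries F) × LaurentSeries F =>
        ev x.1 x.2 (hasseDeriv i H) * ev x.1 x.2 (hasseDeriv 0 G) ^ i /
          (ev x.1 x.2 (hasseDeriv 0 H) * ev x.1 x.2 (hasseDeriv 1 G) ^ i)) x₀ :=
              ((hc i H).mul ((hc 0 G).pow i)).div₀ ((hc 0 H).mul ((hc 1 G).pow i))
      (mul_ne_zero h2' (pow_ne_zero i h1'))
    have h3 : ev x₀.1 x₀.2 (hasseDeriv i H) * ev x₀.1 x₀.2 (hasseDeriv 0 G) ^ i /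
          (ev x₀.1 x₀.2 (hasseDeriv 0 H) * ev x₀.1 x₀.2 (hasseDeriv 1 G) ^ i) = 0 := by
      rw [h0', zero_pow hi0, mul_zero, zero_div]
    exact hcont.eventually (p := fun y => Valued.v y < 1) (by beta_reduce; rw [h3]; exact hnhds)
  have e3 := (hc 1 G).eventually_ne h1'
  have e4 := (hc 0 H).eventually_ne h2'
  have hev := (((Finset.eventually_all _).2 e1).and ((Finset.eventually_all _).2 e2)).and
    (e3.and e4)
  have hdense : DenseRange (Prod.map
      (Pi.map fun (_ : Fin d) => algebraMap (RatFunc F) (LaurentSeries F))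
      (algebraMap (RatFunc F) (LaurentSeries F))) :=
    (DenseRange.piMap fun _ => LaurentSeries.coe_range_dense).prodMap LaurentSeries.coe_range_dense
  obtain ⟨⟨s', b'⟩, hsb⟩ := hdense.exists_mem_open isOpen_interior
    ⟨x₀, mem_interior_iff_mem_nhds.2 hev⟩
  obtain ⟨⟨f1, f2⟩, f3, f4⟩ := interior_subset hsb
  have hFψ : ∀ c : F, algebraMap (RatFunc F) (LaurentSeries F) (algebraMap F (RatFunc F) c) =
      algebraMap F (LaurentSeries F) c := fun c => by
    rw [LaurentSeries.algebraMap_apply, IsScalarTower.algebraMap_apply F F[X] (RatFunc F),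
      ← IsScalarTower.algebraMap_apply F[X] (RatFunc F) (LaurentSeries F)]
    simp
  let ψ : RatFunc F →ₐ[F] LaurentSeries F :=
    { algebraMap (RatFunc F) (LaurentSeries F) with commutes' := hFψ }
  have hψ : ∀ P : (MvPolynomial (Fin d) F)[X],
      ev (fun i => algebraMap (RatFunc F) (LaurentSeries F) (s' i))
          (algebraMap (RatFunc F) (LaurentSeries F) b') P =
        algebraMap (RatFunc F) (LaurentSeries F) (ev s' b' P) := fun P => map_ev ψ s' b' P
  have hv : ∀ f : RatFunc F, Valued.v (algebraMap (RatFunc F) (LaurentSeries F) f) =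
    (Polynomial.idealX F).valuation (RatFunc F) f := fun f =>
      (LaurentSeries.valuation_coe_ratFunc F f)
  refine ⟨s', b', fun h => f3 ?_, fun h => f4 ?_, fun i hi hi' => ?_, fun i hi hi' => ?_⟩
  · exact (hψ _).trans (by rw [h, map_zero])
  · exact (hψ _).trans (by rw [h, map_zero])
  · have := f1 i (Finset.mem_Icc.2 ⟨hi, hi'⟩)
    rw [← hv, map_div₀, map_mul, map_pow, ← hψ, ← hψ, ← hψ]
    exact this
  · have := f2 i (Finset.mem_Icc.2 ⟨hi, hi'⟩)
    rw [← hv, map_div₀, map_mul, map_mul, map_pow, map_pow, ← hψ, ← hψ, ← hψ, ← hψ]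
    exact this

end Density

section RatFuncHom
open Polynomial
open scoped RatFunc

theorem exists_ratFunc_hom {F E : Type*} [Field F] [Field E] (ι : F →+* E) {Γ : Type*}
    [LinearOrderedCommGroupWithZero Γ] (vE : Valuation E Γ) (τ : E) (hτ0 : τ ≠ 0)
    (hτ : ∀ c : F, c ≠ 0 → vE τ < vE (ι c)) :
    ∃ θ : RatFunc F →+* E, (∀ c, θ (algebraMap F (RatFunc F) c) = ι c) ∧
      ∀ f, (Polynomial.idealX F).valuation (RatFunc F) f < 1 → vE (θ f) < 1 := by
  let θ₀ : F[X] →+* E := eval₂RingHom ι τ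
  have hbd : ∀ q : F[X], ∃ c : F, c ≠ 0 ∧ vE (θ₀ q) ≤ vE (ι c) := by
    intro q
    induction q using Polynomial.induction_on' with
    | add p q hp hq =>
      obtain ⟨c, hc, hpc⟩ := hp
      obtain ⟨c', hc', hqc⟩ := hq
      rw [map_add]
      rcases le_total (vE (ι c)) (vE (ι c')) with h | h
      · exact ⟨c', hc', vE.map_add_le (hpc.trans h) hqc⟩
      · exact ⟨c, hc, vE.map_add_le hpc (hqc.trans h)⟩
    | monomial n a =>
      have h1 : vE (θ₀ (monomial n a)) ≤ vE (ι a) := by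
        have : θ₀ (monomial n a) = ι a * τ ^ n := eval₂_monomial _ _
        rw [this, map_mul, map_pow]
        refine mul_le_of_le_one_right' (pow_le_one' ?_ _)
        have := hτ 1 one_ne_zero
        rw [map_one, map_one] at this
        exact this.le
      rcases eq_or_ne a 0 with rfl | ha
      · exact ⟨1, one_ne_zero, h1.trans (by simp)⟩
      · exact ⟨a, ha, h1⟩
  have hsmall : ∀ q : F[X], ∀ c : F, c ≠ 0 → vE (θ₀ (X * q)) < vE (ι c) := by
    intro q c hc
    obtain ⟨c', hc', hq⟩ := hbd q
    have h1 := hτ (c / c') (div_ne_zero hc hc')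
    have hpos : 0 < vE (ι c') := zero_lt_iff.2 (by simpa using hc')
    rw [map_div₀, map_div₀, lt_div_iff₀ hpos] at h1
    rw [map_mul, map_mul]
    refine lt_of_le_of_lt (mul_le_mul_right hq _) ?_
    simpa [θ₀] using h1
  have hunit : ∀ q : F[X], ¬ X ∣ q → vE (θ₀ q) = vE (ι (q.coeff 0)) ∧ q.coeff 0 ≠ 0 := by
    intro q hq
    rw [X_dvd_iff] at hq
    refine ⟨?_, hq⟩
    conv_lhs => rw [← X_mul_divX_add q, map_add]
    have h1 : θ₀ (C (q.coeff 0)) = ι (q.coeff 0) := eval₂_C _ _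
    rw [h1]
    exact Valuation.map_add_eq_of_lt_right _ (hsmall _ _ hq)
  have hinj : ∀ q : F[X], q ≠ 0 → θ₀ q ≠ 0 := by
    intro q hq
    obtain ⟨q', hq', hnd⟩ := exists_eq_pow_rootMultiplicity_mul_and_not_dvd q hq 0
    rw [map_zero, sub_zero] at hq' hnd
    rw [hq', map_mul, map_pow]
    refine mul_ne_zero (pow_ne_zero _ (by simpa [θ₀] using hτ0)) fun h => ?_
    obtain ⟨h1, h2⟩ := hunit q' hnd
    rw [h, map_zero, eq_comm, Valuation.zero_iff, _root_.map_eq_zero] at h1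
    exact h2 h1
  let θ : RatFunc F →+* E := IsFractionRing.lift (A := F[X]) (g := θ₀)
    ((injective_iff_map_eq_zero θ₀).2 fun q hq => by_contra fun h => hinj q h hq)
  have hθ : ∀ q : F[X], θ (algebraMap F[X] (RatFunc F) q) = θ₀ q := fun q =>
    IsFractionRing.lift_algebraMap _ q
  refine ⟨θ, fun c => ?_, fun f hf => ?_⟩
  · rw [IsScalarTower.algebraMap_apply F F[X] (RatFunc F), hθ]
    exact eval₂_C _ _
  · have hd : vE (θ₀ f.denom) ≠ 0 := by
      rw [Valuation.ne_zero_iff]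
      exact hinj _ f.denom_ne_zero
    have hle : ∀ q : F[X], (Polynomial.idealX F).valuation (RatFunc F)
        (algebraMap F[X] (RatFunc F) q) ≤ 1 := fun q =>
      IsDedekindDomain.HeightOneSpectrum.valuation_le_one _ q
    have hlt : ∀ q : F[X], (Polynomial.idealX F).valuation (RatFunc F)
        (algebraMap F[X] (RatFunc F) q) < 1 ↔ X ∣ q := fun q => by
      rw [IsDedekindDomain.HeightOneSpectrum.valuation_lt_one_iff_mem, Polynomial.idealX_span,
        Ideal.mem_span_singleton]
    have hd0 : 0 < (Polynomial.idealX F).valuation (RatFunc F)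
        (algebraMap F[X] (RatFunc F) f.denom) := zero_lt_iff.2 (by simp [f.denom_ne_zero])
    rw [← RatFunc.num_div_denom f, map_div₀, div_lt_one₀ hd0] at hf
    obtain ⟨q, hq⟩ := (hlt f.num).1 (hf.trans_le (hle _))
    have hnd : ¬ X ∣ f.denom := fun h => not_isUnit_X
      (f.isCoprime_num_denom.isUnit_of_dvd' ⟨q, hq⟩ h)
    obtain ⟨h1, h2⟩ := hunit _ hnd
    rw [← RatFunc.num_div_denom f, map_div₀, hθ, hθ, map_div₀, div_lt_one₀ (zero_lt_iff.2 hd), h1,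
      hq]
    exact hsmall _ _ h2

/-- A henselian field with a nontrivial rank one valuation is large. -/
theorem largeField_of_isHenselian {F : Type u} [Field F] [Infinite F] {Γ : Type u}
    [LinearOrderedCommGroupWithZero Γ] (v : Valuation F Γ) (hv : IsHenselian v) (π : F)
    (hπ0 : π ≠ 0) (hπ : ∀ c : F, c ≠ 0 → ∃ N : ℕ, ∀ k, N ≤ k → v π ^ k < v c) :
    LargeField F := by
  rintro φ ⟨m, hφ⟩ hx
  obtain ⟨Z, -, hZ⟩ := exists_witnesses_sentence hφ.isExistsNE1 hx
  refine hZ F ?_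
  have htr : TrLE F Z.card (IntermediateField.adjoin F (Z : Set (LaurentSeries F)) :
      Set (LaurentSeries F)) := by
    refine trLE_adjoin_of_isAlgebraic (X := Z) le_rfl fun z hz => ?_
    exact isAlgebraic_algebraMap (⟨z, IntermediateField.subset_adjoin _ _ hz⟩ :
          IntermediateField.adjoin F (Z : Set (LaurentSeries F)))
  obtain ⟨d, -, s, b, G, H, h0, h1, h2, hhom⟩ :=
    exists_hypersurface_adjoin.{u, u, u} (sep_laurentSeries F) Z.card Z htr
  suffices hs : ∃ (s' : Fin d → F) (b' : F), ev s' b' G = 0 ∧ ev s' b' H ≠ 0 by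
    obtain ⟨s', b', hs1, hs2⟩ := hs
    exact hhom F s' b' hs1 hs2
  obtain ⟨s₁, b₁, g1, g2, g3, g4⟩ := exists_ratFunc_approx G H s b h0 h1 h2
    (max G.natDegree H.natDegree)
  obtain ⟨E, _, Γ', _, vE, mk, hE⟩ := exists_isUltrapower v
  let : Algebra F E := hE.diag.toAlgebra
  have ha : algebraMap F E = hE.diag.comp (algebraMap F F) := rfl
  obtain ⟨θ, hθ, hθv⟩ := exists_ratFunc_hom hE.diag vE (mk fun k => π ^ k) (by
    rw [Ne, hE.eq_zero_iff, ← Ultrafilter.eventually_not]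
    exact Filter.Eventually.of_forall fun k => pow_ne_zero k hπ0) (fun c hc => by
    obtain ⟨N, hN⟩ := hπ c hc
    refine (hE.lt_iff _ _).2 (Nat.hyperfilter_le_atTop ?_)
    filter_upwards [Filter.eventually_ge_atTop N] with k hk
    rw [map_pow]
    exact hN k hk)
  let Θ : RatFunc F →ₐ[F] E := { θ with commutes' := hθ }
  have hΘ : ∀ P : (MvPolynomial (Fin d) F)[X], ev (fun i => θ (s₁ i)) (θ b₁) P = θ (ev s₁ b₁ P) :=
    fun P => map_ev Θ s₁ b₁ P
  obtain ⟨b₂, hb0, hb1⟩ := exists_ev_of_hasse vE (hE.isHenselian hv) (fun i => θ (s₁ i)) (θ b₁) G H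
    (by rw [hΘ]; exact (_root_.map_ne_zero θ).2 g1) (by rw [hΘ]; exact (_root_.map_ne_zero θ).2 g2)
    (fun i hi hi' => by
      have := hθv _ (g3 i hi hi')
      rw [map_div₀, map_mul, map_pow, ← hΘ, ← hΘ, ← hΘ] at this
      exact this)
    (fun i hi hi' => by
      have := hθv _ (g4 i hi hi')
      rw [map_div₀, map_mul, map_mul, map_pow, map_pow, ← hΘ, ← hΘ, ← hΘ, ← hΘ] at this
      exact this)
  exact hE.exists_ev ha G H _ b₂ hb0 hb1

end RatFuncHom

section CoefficientFieldHenselian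
open IsLocalRing Polynomial

variable {M : Type*} [Field M] {Γ : Type*} [LinearOrderedCommGroupWithZero Γ]
  {v : Valuation M Γ} {π : M}

/-- A field of representatives for the coarsening is henselian. -/
theorem isHenselian_coefficientField (hπ : IsUniformizer v π) (hv : IsHenselian v)
    {F : Subfield M} (hF : ∀ x ∈ F, x ∈ coarse hπ)
    (hsurj : Function.Surjective ((residue (coarse hπ)).comp (inclHom _ hF))) :
    IsHenselian (v.comap F.subtype) := by
  let vF := v.comap F.subtype
  let j : vF.valuationSubring →+* v.valuationSubring :=
    { toFun := fun x => ⟨(x : F), x.2⟩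
      map_one' := rfl
      map_zero' := rfl
      map_mul' := fun _ _ => rfl
      map_add' := fun _ _ => rfl }
  have hj : ∀ x, x ∈ maximalIdeal vF.valuationSubring ↔ j x ∈ maximalIdeal v.valuationSubring :=
    fun x => (mem_maximalIdeal_iff vF x).trans (mem_maximalIdeal_iff v (j x)).symm
  refine HenselianLocalRing.mk fun f hmonic a₀ h0 h1 => ?_
  obtain ⟨b, hb, hba⟩ := HenselianLocalRing.is_henselian (f.map j) (hmonic.map j) (j a₀)
    (by rw [eval_map_apply]; exact (hj _).1 h0)
    (by
      rw [derivative_map, eval_map_apply]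
      exact h1.map j)
  have hbc : (b : M) ∈ coarse hπ := ⟨0, by rw [pow_zero, one_mul]; exact b.2⟩
  obtain ⟨c, hc⟩ := hsurj (residue _ ⟨b, hbc⟩)
  have hcb : v ((c : M) - b) ≤ v π := by
    have h2 : residue (coarse hπ) (inclHom _ hF c - ⟨b, hbc⟩) = 0 := by
      rw [map_sub, sub_eq_zero]; exact hc
    have h3 := (residue_coarse_eq_zero_iff hπ _).1 h2 1
    rwa [pow_one] at h3
  have hcb1 : v ((c : M) - b) < 1 := hcb.trans_lt hπ.2.1
  have hc1 : vF c ≤ 1 := by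
    have h2 : (c : M) = (c - b) + b := by ring
    change v (c : M) ≤ 1
    rw [h2]
    exact v.map_add_le hcb1.le b.2
  refine ⟨⟨c, hc1⟩, ?_, ?_⟩
  · let ψ : F →+* ResidueField (coarse hπ) := (residue (coarse hπ)).comp (inclHom _ hF)
    let jF : vF.valuationSubring →+* F := vF.valuationSubring.subtype
    have h2 : (f.map jF).eval c = 0 := by
      apply ψ.injective
      have h3 : ((f.map jF).map (inclHom _ hF)).eval (⟨b, hbc⟩ : coarse hπ) = 0 := by
        apply (coarse hπ).subtype_injective
        rw [map_zero, ← eval_map_apply, map_map, map_map]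
        have h4 := congrArg v.valuationSubring.subtype hb
        rw [map_zero, ← eval_map_apply, map_map] at h4
        exact h4
      have h5 := congrArg (residue (coarse hπ)) h3
      rw [map_zero, ← eval_map_apply, map_map, ← hc] at h5
      rw [map_zero, ← eval_map_apply]
      exact h5
    apply Subtype.ext
    exact (eval_map_apply (f := jF) (p := f) (⟨c, hc1⟩ : vF.valuationSubring)).symm.trans h2
  · rw [hj, map_sub, mem_maximalIdeal_iff]
    rw [mem_maximalIdeal_iff] at hba
    have h2 : (c : M) - (j a₀ : M) = ((c : M) - b) + (b - j a₀) := by ring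
    change v ((c : M) - (j a₀ : M)) < 1
    rw [h2]
    exact v.map_add_lt hcb1 hba

/-- A uniform bound on `p`-th power combinations makes the image of `C` a good subfield. -/
theorem goodSub_of_frobBound {C : Type*} [Field C] (hπ : IsUniformizer v π) (ι : C →+* M)
    (hfin : ∀ c, ι c ∈ coarse hπ)
    (hb : ∀ p : ℕ, p.Prime → CharP C p → ∀ (m : ℕ) (e : Fin m → C), FrobIndep (R := C) p e →
      ∃ N : ℕ, ∀ (a : Fin m → M) (i : Fin m), v (a i) ^ p * v π ^ N ≤
        v (∑ j, ι (e j) * a j ^ p)) :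
    GoodSub (coarse hπ) ι.fieldRange := by
  refine ⟨?_, fun p hp hchar m e he hind y hy i => ?_⟩
  · rintro x ⟨c, rfl⟩
    exact hfin c
  have hchar' : CharP C p := (RingHom.charP_iff ι ι.injective p).2 hchar
  choose e' he' using he
  have hind' : FrobIndep (R := C) p e' := by
    intro z hz i
    have h1 := hind (fun i => ⟨ι (z i), hfin _⟩) (fun i => ⟨z i, rfl⟩) (by
      apply (coarse hπ).subtype_injective
      rw [map_sum, map_zero, ← map_zero ι, ← hz, map_sum]
      refine Finset.sum_congr rfl fun j _ => ?_
      rw [map_mul, map_pow, map_mul, map_pow]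
      change (e j : M) * _ = _
      rw [← he' j]
      rfl) i
    have h2 := congrArg (coarse hπ).subtype h1
    exact (map_eq_zero ι).1 h2
  obtain ⟨N, hN⟩ := hb p hp hchar' m e' hind'
  choose Y hY using fun i => residue_surjective (y i)
  have h1 : residue (coarse hπ) (∑ i, e i * Y i ^ p) = 0 := by
    rw [← hy, map_sum]
    exact Finset.sum_congr rfl fun j _ => by rw [map_mul, map_pow, hY]
  rw [residue_coarse_eq_zero_iff] at h1
  have h2 : ((∑ i, e i * Y i ^ p : coarse hπ) : M) = ∑ j, ι (e' j) * (Y j : M) ^ p := by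
    change (coarse hπ).subtype _ = _
    rw [map_sum]
    refine Finset.sum_congr rfl fun j _ => ?_
    rw [map_mul, map_pow, he' j]
    rfl
  rw [h2] at h1
  rw [← hY, residue_coarse_eq_zero_iff]
  intro k
  have h3 := (hN (fun j => Y j) i).trans (h1 (k * p + N))
  rw [pow_add] at h3
  have h4 := le_of_mul_le_mul_right h3 (pow_pos hπ.1 N)
  rw [pow_mul] at h4
  exact (pow_le_pow_iff_left₀ zero_le zero_le hp.ne_zero).1 h4

theorem exists_pow_mul_le_of_mem_coarse (hπ : IsUniformizer v π) {ι : Type*} [Finite ι]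
    (x : ι → M) (hx : ∀ i, x i ∈ coarse hπ) : ∃ N : ℕ, ∀ i, v (π ^ N * x i) ≤ 1 := by
  classical
  have := Fintype.ofFinite ι
  choose N hN using hx
  refine ⟨∑ i, N i, fun i => ?_⟩
  rw [← Finset.sum_erase_add _ _ (Finset.mem_univ i), pow_add, mul_assoc, map_mul, map_pow,
    map_mul, map_pow]
  exact mul_le_one' (pow_le_one₀ zero_le hπ.le_one) (hN i)

end CoefficientFieldHenselian

section BoundedSolutions
open IsLocalRing Polynomial

/-- `(R4)` applied to a subfield that represents the residue field of a valuation ring. -/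
theorem R4N.exists_ev {n d : ℕ} (hR4 : R4N.{u} (n + 1)) (hd : d ≤ n) {M : Type u} [Field M]
    (O : ValuationSubring M) {F : Subfield M} (hF : ∀ x ∈ F, x ∈ O)
    (hsurj : Function.Surjective ((residue O).comp (inclHom O hF))) (hlarge : LargeField F)
    (G H : (MvPolynomial (Fin d) F)[X]) (s : Fin d → M) (b : M) (h0 : ev s b G = 0)
    (h1 : ev s b H ≠ 0) : ∃ (s' : Fin d → F) (b' : F), ev s' b' G = 0 ∧ ev s' b' H ≠ 0 := by
  obtain ⟨φ, -, hφ, hreal⟩ := exists_sentence hd G H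
  refine (hreal F).1 (hR4 M O.ValueGroup O.valuation F hlarge ?_ ?_ φ hφ
    ((hreal M).2 ⟨s, b, h0, h1⟩))
  · intro y hy
    have h2 : O.valuation (y : M) ≤ 1 := (O.valuation_le_one_iff _).2 (hF _ y.2)
    have h3 : O.valuation (y : M)⁻¹ ≤ 1 := (O.valuation_le_one_iff _).2 (hF _ (inv_mem y.2))
    refine le_antisymm h2 ?_
    rw [map_inv₀] at h3
    exact (inv_le_one₀ (zero_lt_iff.2 ((Valuation.ne_zero_iff _).2 hy))).1 h3
  · intro y hy
    rw [O.valuation_le_one_iff] at hy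
    obtain ⟨x, hx⟩ := hsurj (residue O ⟨y, hy⟩)
    refine ⟨x, ?_⟩
    have h2 : (⟨y, hy⟩ - inclHom O hF x : O) ∈ maximalIdeal O := by
      rw [← residue_eq_zero_iff, map_sub, sub_eq_zero]
      exact hx.symm
    exact (O.valuation_lt_one_iff _).1 h2

variable {C : Type u} [Field C] {u : Valuation C Zm0} {π : C} {K : Type u} [Field K] [Algebra C K]
  {Γ : Type u} [LinearOrderedCommGroupWithZero Γ] {v : Valuation K Γ}

/-- Over a henselian field a solvable system has a solution of bounded size at which the
inequation is bounded below. -/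
theorem exists_bounded_ev [Infinite C] (hKC : (v.comap (algebraMap C K)).IsEquiv u)
    (hv : IsHenselian v) (hπu : IsUniformizer u π) (hπv : IsUniformizer v (algebraMap C K π))
    {g : ResF u →+* ResF v} (hg : ResCompat u v g) (hsep : IsSepExtHom g)
    (hexc : ExcellentCompletion C u) {n d : ℕ} (hR4 : R4N.{u} (n + 1)) (hd : d ≤ n)
    (G H : (MvPolynomial (Fin d) C)[X]) (s : Fin d → K) (b : K) (h0 : ev s b G = 0)
    (h1 : ev s b H ≠ 0) : ∃ (s' : Fin d → K) (b' : K) (N : ℕ), ev s' b' G = 0 ∧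
      (∀ i, v (algebraMap C K π ^ N * s' i) ≤ 1) ∧ v (algebraMap C K π ^ N * b') ≤ 1 ∧
      v (algebraMap C K π ^ N) ≤ v (ev s' b' H) := by
  obtain ⟨M, _, Γ', _, vM, mk, h⟩ := exists_isUltrapower v
  let ι : C →+* M := h.diag.comp (algebraMap C K)
  let : Algebra C M := ι.toAlgebra
  have ha : algebraMap C M = h.diag.comp (algebraMap C K) := rfl
  have hπM : IsUniformizer vM (ι π) := h.isUniformizer hπv
  have hvM : IsHenselian vM := h.isHenselian hv
  have hle : ∀ x y : C, vM (ι x) ≤ vM (ι y) ↔ u x ≤ u y :=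
    fun x y => (h.le_diag _ _).trans (hKC x y)
  have hfin : ∀ c, ι c ∈ coarse hπM := by
    intro c
    obtain ⟨N, hN⟩ := hπu.exists_pow_mul_le c
    refine ⟨N, ?_⟩
    have h2 := (hle (π ^ N * c) 1).2 (by rwa [map_one])
    rwa [map_one, map_one, map_mul, map_mul, map_pow, map_pow] at h2
  have hgood : GoodSub (coarse hπM) ι.fieldRange := by
    refine goodSub_of_frobBound hπM ι hfin fun p hp _ m e he => ?_
    obtain ⟨N, hN⟩ := frobBound hKC hπu hπv hg hsep hexc p hp e he
    refine ⟨N, fun a i => ?_⟩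
    choose A hA using fun i => h.surjective (a i)
    obtain rfl := funext hA
    have h2 : ∑ j, ι (e j) * mk (A j) ^ p =
        mk (∑ j, (fun _ => algebraMap C K (e j)) * A j ^ p) := by
      rw [map_sum]
      refine Finset.sum_congr rfl fun j _ => ?_
      rw [map_mul, map_pow]
      rfl
    have h3 : vM (mk (A i)) ^ p * vM (ι π) ^ N =
        vM (mk (A i ^ p * (fun _ => algebraMap C K π) ^ N)) := by
      rw [map_mul, map_mul, map_pow, map_pow, map_pow, map_pow]
      rfl
    rw [h2, h3]
    refine (h.le_iff _ _).2 (Filter.Eventually.of_forall fun k => ?_)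
    have h4 := hN (fun j => A j k) i
    simpa using h4
  obtain ⟨F, hF, hF0, hsurj⟩ := exists_coefficient_field (coarse hπM) ι.fieldRange hgood
    (fun F hF X => exists_lift_of_saturated hπM hvM h.saturated hF X)
  have hιF : ∀ c, ι c ∈ F := fun c => hF0 ⟨c, rfl⟩
  let ιF : C →+* F := ι.codRestrict F hιF
  have : Infinite F := Infinite.of_injective ιF ιF.injective
  have hvF : IsHenselian (vM.comap F.subtype) := isHenselian_coefficientField hπM hvM hF.1 hsurj
  have hbelow : ∀ c ∈ F, c ≠ 0 → ∃ N : ℕ, vM (ι π) ^ N ≤ vM c := by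
    intro c hc hc0
    obtain ⟨N, hN⟩ := hF.1 _ (inv_mem hc)
    refine ⟨N, ?_⟩
    rwa [map_inv₀, ← div_eq_mul_inv,
      div_le_one₀ (zero_lt_iff.2 ((Valuation.ne_zero_iff _).2 hc0))] at hN
  have hlarge : LargeField F := by
    refine largeField_of_isHenselian _ hvF (ιF π) ((map_ne_zero ιF).2 hπu.ne_zero) fun c hc => ?_
    obtain ⟨N, hN⟩ := hbelow c c.2 fun h => hc (Subtype.ext h)
    refine ⟨N + 1, fun k hk => lt_of_lt_of_le ?_ hN⟩
    change vM (ι π) ^ k < vM (ι π) ^ N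
    exact pow_lt_pow_right_of_lt_one₀ hπM.1 hπM.2.1 (Nat.lt_of_succ_le hk)
  have hevM : ∀ (P : (MvPolynomial (Fin d) C)[X]) (s : Fin d → M) (b : M),
      ev s b (P.map (MvPolynomial.map ιF)) = ev s b P := by
    intro P s b
    rw [ev_map_eq_evr, ev_eq_evr]
    rfl
  have hevK : ∀ P : (MvPolynomial (Fin d) C)[X],
      ev (fun i => h.diag (s i)) (h.diag b) P = h.diag (ev s b P) := by
    intro P
    rw [ev_eq_evr, ev_eq_evr, map_evr]
    rfl
  obtain ⟨s₁, b₁, hs0, hs1⟩ := hR4.exists_ev hd (coarse hπM) hF.1 hsurj hlarge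
    (G.map (MvPolynomial.map ιF)) (H.map (MvPolynomial.map ιF)) (fun i => h.diag (s i)) (h.diag b)
    (by rw [hevM, hevK, h0, map_zero])
    (by
      rw [hevM, hevK]
      exact (map_ne_zero h.diag).2 h1)
  have hevF : ∀ P : (MvPolynomial (Fin d) C)[X],
      ((ev s₁ b₁ (P.map (MvPolynomial.map ιF)) : F) : M) = ev (fun i => (s₁ i : M)) (b₁ : M) P := by
    intro P
    rw [ev_map_eq_evr, ev_eq_evr]
    exact map_evr _ F.subtype _ _ _
  obtain ⟨N₁, hN₁⟩ := exists_pow_mul_le_of_mem_coarse hπM (fun i => (s₁ i : M))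
    fun i => hF.1 _ (s₁ i).2
  obtain ⟨N₂, hN₂⟩ := hF.1 _ b₁.2
  obtain ⟨N₃, hN₃⟩ := hbelow (ev s₁ b₁ (H.map (MvPolynomial.map ιF)) : F) (SetLike.coe_mem _)
    fun h => hs1 (Subtype.ext h)
  have hG : ev (fun i => (s₁ i : M)) (b₁ : M) G = 0 := by rw [← hevF, hs0]; rfl
  rw [hevF] at hN₃
  choose S hS using fun i => h.surjective (s₁ i : M)
  obtain ⟨B, hB⟩ := h.surjective (b₁ : M)
  have hpow : ∀ (N : ℕ) (x : ℕ → K), ι π ^ N * mk x = mk fun k => algebraMap C K π ^ N * x k := by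
    intro N x
    rw [show (fun k => algebraMap C K π ^ N * x k) = (fun _ => algebraMap C K π) ^ N * x from rfl,
      map_mul, map_pow]
    rfl
  simp only [← hS, ← hB] at hN₁ hN₂ hN₃ hG
  rw [h.ev_mk ha] at hN₃ hG
  rw [h.eq_zero_iff] at hG
  rw [← map_pow, ← map_mul, hpow, h.le_one_iff] at hN₂
  rw [← map_pow, ← mul_one (ι π ^ N₃), ← map_one mk, hpow, h.le_iff] at hN₃
  have hN₁' := fun i => by
    have h2 := hN₁ i
    rw [hpow, h.le_one_iff] at h2
    exact h2
  obtain ⟨k, ⟨⟨hk0, hk1⟩, hk2⟩, hk3⟩ :=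
    (((hG.and (Filter.eventually_all.2 hN₁')).and hN₂).and hN₃).exists
  have hmono : ∀ (N N' : ℕ) (x : K), v (algebraMap C K π ^ N * x) ≤ 1 →
      v (algebraMap C K π ^ (N' + N) * x) ≤ 1 := by
    intro N N' x hx
    rw [pow_add, mul_assoc, map_mul, map_pow]
    exact mul_le_one' (pow_le_one₀ zero_le hπv.le_one) hx
  refine ⟨fun i => S i k, B k, N₃ + (N₂ + N₁), hk0, fun i => ?_, ?_, ?_⟩
  · rw [← add_assoc]
    exact hmono _ _ _ (hk1 i)
  · rw [add_comm N₂, ← add_assoc]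
    exact hmono _ _ _ hk2
  · refine le_trans ?_ hk3
    rw [Pi.one_apply, mul_one, map_pow, map_pow]
    exact pow_le_pow_of_le_one zero_le hπv.le_one (Nat.le_add_right _ _)

end BoundedSolutions

section Scaling
open Polynomial

/-- The substitution multiplying all variables by the constant `c`. -/
noncomputable def scaleVars {C : Type*} [Field C] {d : ℕ} (c : C)
    (P : (MvPolynomial (Fin d) C)[X]) : (MvPolynomial (Fin d) C)[X] :=
  (P.map (MvPolynomial.aeval (R := C) fun i => MvPolynomial.C c * MvPolynomial.X i).toRingHom).comp
    (Polynomial.C (MvPolynomial.C c) * X)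

theorem ev_scaleVars {C L : Type*} [Field C] [Field L] [Algebra C L] {d : ℕ} (c : C)
    (s : Fin d → L) (b : L) (P : (MvPolynomial (Fin d) C)[X]) :
    ev s b (scaleVars c P) = ev (fun i => algebraMap C L c * s i) (algebraMap C L c * b) P := by
  have h : ((ev s b).toRingHom.comp ((compRingHom (Polynomial.C (MvPolynomial.C c) * X)).comp
      (mapRingHom (MvPolynomial.aeval (R := C)
        fun i => (MvPolynomial.C c * MvPolynomial.X i : MvPolynomial (Fin d) C)).toRingHom))) =
      (ev (fun i => algebraMap C L c * s i) (algebraMap C L c * b)).toRingHom := by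
    ext <;> simp [ev_C, ev_X]
  exact congrArg (fun f => f P) h

theorem derivative_scaleVars {C : Type*} [Field C] {d : ℕ} (c : C)
    (P : (MvPolynomial (Fin d) C)[X]) : derivative (scaleVars c P) =
      Polynomial.C (MvPolynomial.C c) * scaleVars c (derivative P) := by
  rw [scaleVars, derivative_comp, derivative_map, derivative_C_mul, derivative_X, mul_one]
  rfl

/-- Denominators can be cleared by a power of the uniformizer. -/
theorem exists_integral_multiple {C : Type*} [Field C] {u : Valuation C Zm0} {π : C}
    (hπ : IsUniformizer u π) {d : ℕ} (P : (MvPolynomial (Fin d) C)[X]) :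
    ∃ (N : ℕ) (Q : (MvPolynomial (Fin d) u.valuationSubring)[X]),
      Q.map (MvPolynomial.map u.valuationSubring.subtype) =
        Polynomial.C (MvPolynomial.C (π ^ N)) * P := by
  let ϖ : u.valuationSubring := ⟨π, hπ.le_one⟩
  have hϖ : u.valuationSubring.subtype ϖ = π := rfl
  have hadd : ∀ P₁ P₂ : (MvPolynomial (Fin d) C)[X],
      (∃ (N : ℕ) (Q : (MvPolynomial (Fin d) u.valuationSubring)[X]),
        Q.map (MvPolynomial.map u.valuationSubring.subtype) =
          Polynomial.C (MvPolynomial.C (π ^ N)) * P₁) →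
      (∃ (N : ℕ) (Q : (MvPolynomial (Fin d) u.valuationSubring)[X]),
        Q.map (MvPolynomial.map u.valuationSubring.subtype) =
          Polynomial.C (MvPolynomial.C (π ^ N)) * P₂) →
      ∃ (N : ℕ) (Q : (MvPolynomial (Fin d) u.valuationSubring)[X]),
        Q.map (MvPolynomial.map u.valuationSubring.subtype) =
          Polynomial.C (MvPolynomial.C (π ^ N)) * (P₁ + P₂) := by
    rintro P₁ P₂ ⟨N₁, Q₁, h₁⟩ ⟨N₂, Q₂, h₂⟩
    refine ⟨N₁ + N₂, Polynomial.C (MvPolynomial.C (ϖ ^ N₂)) * Q₁ +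
      Polynomial.C (MvPolynomial.C (ϖ ^ N₁)) * Q₂, ?_⟩
    rw [Polynomial.map_add, Polynomial.map_mul, Polynomial.map_mul, h₁, h₂]
    rw [Polynomial.map_C, Polynomial.map_C, MvPolynomial.map_C, MvPolynomial.map_C,
      map_pow _ ϖ, map_pow _ ϖ, hϖ]
    simp only [map_pow]
    ring
  induction P using Polynomial.induction_on' with
  | add P₁ P₂ h₁ h₂ => exact hadd P₁ P₂ h₁ h₂
  | monomial k a =>
    induction a using MvPolynomial.induction_on' with
    | add a₁ a₂ h₁ h₂ =>
      rw [map_add]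
      exact hadd _ _ h₁ h₂
    | monomial m c =>
      obtain ⟨N, hN⟩ := hπ.exists_pow_mul_le c
      refine ⟨N, Polynomial.monomial k (MvPolynomial.monomial m ⟨π ^ N * c, hN⟩), ?_⟩
      rw [Polynomial.map_monomial, MvPolynomial.map_monomial, Polynomial.C_mul_monomial,
        MvPolynomial.C_mul_monomial]
      rfl

end Scaling

section Assembly
open Polynomial

theorem ev_eq_evr_of_integral {C K : Type u} [Field C] [Field K] [Algebra C K]
    {Γ₀ : Type x} [LinearOrderedCommGroupWithZero Γ₀] {u : Valuation C Γ₀}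
    {Γ : Type w} [LinearOrderedCommGroupWithZero Γ] {v : Valuation K Γ}
    (h : (v.comap (algebraMap C K)).IsEquiv u) {d : ℕ} (s : Fin d → v.valuationSubring)
    (b : v.valuationSubring) (Q : (MvPolynomial (Fin d) u.valuationSubring)[X]) :
    ((evr (valHom h) s b Q : v.valuationSubring) : K) =
      ev (fun i => (s i : K)) (b : K) (Q.map (MvPolynomial.map u.valuationSubring.subtype)) := by
  rw [ev_map_eq_evr]
  exact map_evr _ v.valuationSubring.subtype _ _ _

/-- A solution in `K` of bounded size transfers to `L`. -/
theorem exists_ev_of_bounded {n : ℕ} {C : Type u} [Field C] {u : Valuation C Zm0} {π : C}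
    (hπu : IsUniformizer u π) {K : Type u} [Field K] [Algebra C K] {ΓK : Type u}
    [LinearOrderedCommGroupWithZero ΓK] {v : Valuation K ΓK}
    (hKC : (v.comap (algebraMap C K)).IsEquiv u) (hπv : IsUniformizer v (algebraMap C K π))
    {L : Type u} [Field L] [Algebra C L] {ΓL : Type u} [LinearOrderedCommGroupWithZero ΓL]
    {w : Valuation L ΓL} (hLC : (w.comap (algebraMap C L)).IsEquiv u) (hL : IsHenselian w)
    (hπw : IsUniformizer w (algebraMap C L π)) {gK : ResF u →+* ResF v} (hgK : ResCompat u v gK)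
    (hsepK : IsSepExtHom gK) {gL : ResF u →+* ResF w} (hgL : ResCompat u w gL)
    (hres : ThRingSub (fun {_} φ => IsExistsNE1 n φ) (ResF v) gK (ResF w) gL)
    {d : ℕ} (hd : d ≤ n) (G H : (MvPolynomial (Fin d) C)[X]) (s : Fin d → K) (b : K) (N : ℕ)
    (h0 : ev s b G = 0) (hs : ∀ i, v (algebraMap C K π ^ N * s i) ≤ 1)
    (hb : v (algebraMap C K π ^ N * b) ≤ 1)
    (h1 : v (algebraMap C K π ^ N) ≤ v (ev s b (H * derivative G))) :
    ∃ (s' : Fin d → L) (b' : L), ev s' b' G = 0 ∧ ev s' b' H ≠ 0 := by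
  let c : C := (π ^ N)⁻¹
  have hπ0 : π ^ N ≠ 0 := pow_ne_zero _ hπu.ne_zero
  have hcK : ∀ x, algebraMap C K c * (algebraMap C K π ^ N * x) = x := by
    intro x
    rw [← map_pow, ← mul_assoc, ← map_mul, inv_mul_cancel₀ hπ0, map_one, one_mul]
  let s₁ : Fin d → v.valuationSubring := fun i => ⟨algebraMap C K π ^ N * s i, hs i⟩
  let b₁ : v.valuationSubring := ⟨algebraMap C K π ^ N * b, hb⟩
  have hscale : ∀ P : (MvPolynomial (Fin d) C)[X],
      ev (fun i => (s₁ i : K)) (b₁ : K) (scaleVars c P) = ev s b P := by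
    intro P
    rw [ev_scaleVars]
    simp only [s₁, b₁, hcK]
  obtain ⟨N₁, G', hG'⟩ := exists_integral_multiple hπu (scaleVars c G)
  obtain ⟨N₂, H', hH'⟩ := exists_integral_multiple hπu (scaleVars c H)
  have hconst : ∀ {E : Type u} [Field E] [Algebra C E] (s : Fin d → E) (b : E) (a : C)
      (P : (MvPolynomial (Fin d) C)[X]),
      ev s b (Polynomial.C (MvPolynomial.C a) * P) = algebraMap C E a * ev s b P := by
    intro E _ _ s b a P
    rw [map_mul, ev_C]
    simp
  have hGd : (derivative G').map (MvPolynomial.map u.valuationSubring.subtype) =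
      Polynomial.C (MvPolynomial.C (π ^ N₁)) * (Polynomial.C (MvPolynomial.C c) *
        scaleVars c (derivative G)) := by
    rw [← derivative_map, hG', derivative_C_mul, derivative_scaleVars]
  have hprod : evr (valHom hKC) s₁ b₁ (derivative G') * evr (valHom hKC) s₁ b₁ H' ∣
      valHom hKC ⟨π, hπu.le_one⟩ ^ (N₁ + N₂ + N) := by
    rw [valuationSubring_dvd_iff]
    have h2 : ((evr (valHom hKC) s₁ b₁ (derivative G') * evr (valHom hKC) s₁ b₁ H' :
        v.valuationSubring) : K) = algebraMap C K π ^ N₁ * algebraMap C K π ^ N₂ *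
          (algebraMap C K c * ev s b (H * derivative G)) := by
      change ((evr (valHom hKC) s₁ b₁ (derivative G') : v.valuationSubring) : K) *
        ((evr (valHom hKC) s₁ b₁ H' : v.valuationSubring) : K) = _
      rw [ev_eq_evr_of_integral, ev_eq_evr_of_integral, hGd, hH', hconst, hconst, hconst, hscale,
        hscale, map_mul, map_pow, map_pow]
      ring
    have h3 : ((valHom hKC ⟨π, hπu.le_one⟩ ^ (N₁ + N₂ + N) : v.valuationSubring) : K) =
        algebraMap C K π ^ N₁ * algebraMap C K π ^ N₂ * algebraMap C K π ^ N := by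
      rw [← pow_add, ← pow_add]
      rfl
    have hc : 1 ≤ v (algebraMap C K c) := by
      rw [map_inv₀, map_inv₀, map_pow, map_pow]
      exact (one_le_inv₀ (pow_pos hπv.1 N)).2 (pow_le_one₀ zero_le hπv.le_one)
    rw [h2, h3, map_mul, map_mul _ _ (algebraMap C K c * _), map_mul _ (algebraMap C K c)]
    refine mul_le_mul_right (h1.trans ?_) _
    exact le_mul_of_one_le_left zero_le hc
  have hzero : evr (valHom hKC) s₁ b₁ G' = 0 := by
    apply Subtype.ext
    rw [ev_eq_evr_of_integral, hG', hconst, hscale, h0, mul_zero]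
    rfl
  obtain ⟨s', b', hs', hb'⟩ := exists_solution_transfer hπu hKC hπv hLC hL hπw hgK hsepK hgL hres hd
    G' H' s₁ b₁ (N₁ + N₂ + N) hzero (dvd_of_mul_right_dvd hprod) (dvd_of_mul_left_dvd hprod)
  refine ⟨fun i => algebraMap C L c * s' i, algebraMap C L c * b', ?_, fun h => hb' ?_⟩
  · have h2 := congrArg Subtype.val hs'
    rw [ev_eq_evr_of_integral, hG', hconst, ev_scaleVars] at h2
    refine (mul_eq_zero.1 h2).resolve_left ?_
    exact (_root_.map_ne_zero _).2 (pow_ne_zero _ hπu.ne_zero)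
  · apply Subtype.ext
    rw [ev_eq_evr_of_integral, hH', hconst, ev_scaleVars, h, mul_zero]
    rfl

end Assembly

theorem IsUniformizer.infinite {C : Type*} [Field C] {Γ : Type*} [LinearOrderedCommGroupWithZero Γ]
    {u : Valuation C Γ} {π : C} (h : IsUniformizer u π) : Infinite C := by
  refine Infinite.of_injective (fun k : ℕ => π ^ k) fun i j hij => ?_
  have h1 : u π ^ i = u π ^ j := by rw [← map_pow, ← map_pow]; exact congrArg u hij
  exact (pow_right_strictAnti₀ h.1 h.2.1).injective h1

theorem thRingSub_of_base {α : Type*}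
    {P : ∀ {k : ℕ}, (Language.ring[[α]]).BoundedFormula Empty k → Prop}
    {K : Type*} [CommRing K] {fK : α → K} {L : Type*} [CommRing L] {fL : α → L}
    (h : ∀ φ : (Language.ring[[α]]).Sentence, P φ → RealizeRing K fK φ → RealizeRing L fL φ) :
    ThRingSub P K fK L fL := by
  have key : ∀ {k : ℕ} (φ : (Language.ring[[α]]).BoundedFormula Empty k), IsPosBC P φ →
      ∀ (x : Fin k → K) (y : Fin k → L), k = 0 →
        @BoundedFormula.Realize _ K (ringConStructure fK) _ k φ default x →
        @BoundedFormula.Realize _ L (ringConStructure fL) _ k φ default y := by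
    intro k φ hφ
    induction hφ with
    | base hφ =>
      rintro x y rfl
      rw [Subsingleton.elim x default, Subsingleton.elim y default]
      exact h _ hφ
    | inf _ _ ih₁ ih₂ =>
      intro x y hk hr
      have hr' := (@BoundedFormula.realize_inf _ K (ringConStructure fK) _ _ _ _ _ _).1 hr
      exact (@BoundedFormula.realize_inf _ L (ringConStructure fL) _ _ _ _ _ _).2
        ⟨ih₁ x y hk hr'.1, ih₂ x y hk hr'.2⟩
    | sup _ _ ih₁ ih₂ =>
      intro x y hk hr
      have hr' := (@BoundedFormula.realize_sup _ K (ringConStructure fK) _ _ _ _ _ _).1 hr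
      exact (@BoundedFormula.realize_sup _ L (ringConStructure fL) _ _ _ _ _ _).2
        (hr'.imp (ih₁ x y hk) (ih₂ x y hk))
  exact fun φ hφ => key φ hφ default default rfl

/-- Theorem `thm:ENE1` of the paper.
With `(C, u)` equicharacteristic `ℤ`-valued with excellent valuation ring and uniformizer `π`,
and `(K, v)`, `(L, w)` henselian extensions with uniformizer `π` and separable residue
extensions: if `Th_{∃_n∃_1}(Kv, Cu) ⊆ Th_{∃_n∃_1}(Lw, Cu)` and `(R4_{n+1})` holds, then
`Th_{∃_n∃_1}(K, C) ⊆ Th_{∃_n∃_1}(L, C)`. -/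
theorem statement14 (n : ℕ)
    (C : Type u) [Field C] (u : Valuation C Zm0) (hZ : Function.Surjective u)
    (hequichar : ringChar C = ringChar (ResF u))
    (π : C) (hπu : IsUniformizer u π)
    (hexc : ExcellentCompletion C u)
    (K : Type u) [Field K] [Algebra C K]
    (ΓK : Type u) [LinearOrderedCommGroupWithZero ΓK] (v : Valuation K ΓK)
    (hKC : (v.comap (algebraMap C K)).IsEquiv u)
    (hKhens : IsHenselian v) (hπv : IsUniformizer v (algebraMap C K π))
    (L : Type u) [Field L] [Algebra C L]
    (ΓL : Type u) [LinearOrderedCommGroupWithZero ΓL] (w : Valuation L ΓL)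
    (hLC : (w.comap (algebraMap C L)).IsEquiv u)
    (hLhens : IsHenselian w) (hπw : IsUniformizer w (algebraMap C L π))
    (gK : ResF u →+* ResF v) (hgK : ResCompat u v gK) (hsepK : IsSepExtHom gK)
    (gL : ResF u →+* ResF w) (hgL : ResCompat u w gL) (hsepL : IsSepExtHom gL)
    -- `(R4_{n+1})`
    (hR4 : R4N.{u} (n + 1))
    -- `Th_{∃_n∃_1}(Kv, Cu) ⊆ Th_{∃_n∃_1}(Lw, Cu)`
    (hres : ThRingSub (fun {k} φ => IsExistsNE1 n φ) (ResF v) gK (ResF w) gL) :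
    -- `Th_{∃_n∃_1}(K, C) ⊆ Th_{∃_n∃_1}(L, C)`
    ThRingSub (fun {k} φ => IsExistsNE1 n φ) K (algebraMap C K) L (algebraMap C L) := by
  have : Infinite C := hπu.infinite
  refine thRingSub_of_base fun φ hφ hx => ?_
  obtain ⟨Z, htr, hZ'⟩ := exists_witnesses_sentence hφ hx
  refine hZ' L ?_
  obtain ⟨d, hd, s, b, G, H, h0, h1, h2, hhom⟩ := exists_hypersurface_adjoin.{u, u, u}
    (sep_of_frobBound hKC hπu hπv hgK hsepK hexc) n Z htr
  obtain ⟨s₁, b₁, N, g0, g1, g2, g3⟩ := exists_bounded_ev hKC hKhens hπu hπv hgK hsepK hexc hR4 hd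
    G (H * Polynomial.derivative G) s b h0 (by rw [map_mul]; exact mul_ne_zero h2 h1)
  obtain ⟨s', b', k0, k1⟩ := exists_ev_of_bounded hπu hKC hπv hLC hLhens hπw hgK hsepK hgL hres hd
    G H s₁ b₁ N g0 g1 g2 g3
  exact hhom L s' b' k0 k1

end Paper
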